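/- (Hinz–Lodemann Brun–Titchmarsh inequality for number fields.) Let F be a number field, and let 𝔞, 𝔮 be integral ideals of O_F with (𝔞,𝔮) = 1. If N(𝔮) < x, then π(x,𝔮,𝔞) ≤ (2x/(h(𝔮) · log(x/N(𝔮)))) · (1 + O(log log(3x/N(𝔮)) / log(x/N(𝔮)))). -/

import Mathlib

/-!
STATEMENT 7 (Hinz–Lodemann Brun–Titchmarsh inequality for number fields). Mathlib has no ray
class groups, so the ray class equivalence on ideals, the ray class number `h(𝔮)` and the
counting function `π(x,𝔮,𝔞)` are defined from scratch.  The `O(·)` term inside the estimate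
is expressed by an explicit constant `C` depending only on the field `F`.
-/

open NumberField

/-- `a` and `b` lie in the same ray class modulo `q`: `(α)·a = (β)·b` for some `α, β ∈ O_F`
with `α ≡ β ≡ 1 (mod q)` that are totally positive at the real places of `F`. -/
def SameRayClass (F : Type*) [Field F] [NumberField F] (q a b : Ideal (𝓞 F)) : Prop :=
  ∃ α β : 𝓞 F, α - 1 ∈ q ∧ β - 1 ∈ q ∧
    (∀ φ : F →+* ℝ, 0 < φ (algebraMap (𝓞 F) F α)) ∧
    (∀ φ : F →+* ℝ, 0 < φ (algebraMap (𝓞 F) F β)) ∧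
    Ideal.span {α} * a = Ideal.span {β} * b

/-- `h(q)`, the cardinality of the ray class group modulo `q`. -/
noncomputable def rayClassNumber (F : Type*) [Field F] [NumberField F]
    (q : Ideal (𝓞 F)) : ℕ :=
  Nat.card (Quot fun a b : {I : Ideal (𝓞 F) // I ≠ ⊥ ∧ IsCoprime I q} =>
    SameRayClass F q a.1 b.1)

/-- `π(x,q,a)`: the number of prime ideals `𝔭` of `O_F` with `N𝔭 ≤ x` lying in the same ray
class as `a` modulo `q`. -/
noncomputable def piRay (F : Type*) [Field F] [NumberField F]
    (x : ℝ) (q a : Ideal (𝓞 F)) : ℕ :=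
  Nat.card {p : Ideal (𝓞 F) | p.IsPrime ∧ p ≠ ⊥ ∧ (Ideal.absNorm p : ℝ) ≤ x ∧
    SameRayClass F q p a}


set_option linter.unusedSectionVars false
set_option linter.unusedSimpArgs false
set_option linter.unusedVariables false

namespace BT

section Selberg
variable {ι : Type*} [DecidableEq ι]

/-- the sieve dimension sum -/
noncomputable def selS (P : Finset ι) (N : ι → ℝ) (z : ℝ) : ℝ :=
  ∑ d ∈ P.powerset with ∏ p ∈ d, N p ≤ z, ∏ p ∈ d, (N p - 1)⁻¹

lemma prod_eq_sum_sub_one (N : ι → ℝ) (k : Finset ι) :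
    ∏ p ∈ k, N p = ∑ e ∈ k.powerset, ∏ p ∈ e, (N p - 1) := by
  have := Finset.prod_one_add (f := fun p => N p - 1) k
  simpa using this

lemma one_le_prod_of {N : ι → ℝ} {d : Finset ι} (h : ∀ p ∈ d, 1 < N p) : 1 ≤ ∏ p ∈ d, N p := by
  have := Finset.prod_le_prod (s := d) (f := fun _ => (1:ℝ)) (g := N) (by simp) (fun p hp => (h p hp).le)
  simpa using this

lemma prod_mono_of {N : ι → ℝ} {d e : Finset ι} (hde : d ⊆ e) (h : ∀ p ∈ e, 1 < N p) :
    ∏ p ∈ d, N p ≤ ∏ p ∈ e, N p := by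
  rw [← Finset.prod_sdiff hde]
  have h1 : 1 ≤ ∏ p ∈ e \ d, N p := one_le_prod_of (fun p hp => h p (Finset.mem_sdiff.1 hp).1)
  have h2 : 0 ≤ ∏ p ∈ d, N p := Finset.prod_nonneg (fun p hp => by linarith [h p (hde hp)])
  nlinarith

lemma mobius_interval (e f : Finset ι) (hef : e ⊆ f) :
    ∑ d ∈ f.powerset with e ⊆ d, ((-1:ℝ)) ^ (d.card) = if e = f then (-1) ^ f.card else 0 := by
  have h : ∑ d ∈ f.powerset with e ⊆ d, ((-1:ℝ)) ^ (d.card)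
      = ∑ m ∈ (f \ e).powerset, (-1:ℝ) ^ e.card * (-1) ^ m.card := by
    refine Finset.sum_bij' (fun d _ => d \ e) (fun m _ => m ∪ e) ?_ ?_ ?_ ?_ ?_
    · intro d hd
      simp only [Finset.mem_filter, Finset.mem_powerset] at hd ⊢
      exact Finset.sdiff_subset_sdiff hd.1 le_rfl
    · intro m hm
      simp only [Finset.mem_filter, Finset.mem_powerset] at hm ⊢
      exact ⟨Finset.union_subset (hm.trans Finset.sdiff_subset) hef, Finset.subset_union_right⟩
    · intro d hd
      simp only [Finset.mem_filter, Finset.mem_powerset] at hd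
      exact Finset.sdiff_union_of_subset hd.2
    · intro m hm
      simp only [Finset.mem_powerset] at hm
      rw [Finset.union_sdiff_right]
      exact Finset.sdiff_eq_self_of_disjoint (Finset.disjoint_of_subset_left hm Finset.sdiff_disjoint)
    · intro d hd
      simp only [Finset.mem_filter, Finset.mem_powerset] at hd
      rw [← pow_add, add_comm, Finset.card_sdiff_add_card_eq_card hd.2]
  rw [h, ← Finset.mul_sum]
  have h2 := Finset.sum_powerset_neg_one_pow_card (x := f \ e)
  have h3 : ∑ m ∈ (f \ e).powerset, (-1:ℝ) ^ m.card = if f \ e = ∅ then 1 else 0 := by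
    have := congrArg (fun n : ℤ => (n:ℝ)) h2
    push_cast at this
    simpa using this
  rw [h3]
  by_cases hc : e = f
  · subst hc; simp
  · have : f \ e ≠ ∅ := by
      intro h0
      exact hc (Finset.Subset.antisymm hef (Finset.sdiff_eq_empty_iff_subset.1 h0))
    simp [hc, this]

theorem selberg_weights (P : Finset ι) (N : ι → ℝ) (hN : ∀ p ∈ P, 1 < N p) (z : ℝ) (hz : 1 ≤ z) :
    ∃ lam : Finset ι → ℝ, lam ∅ = 1 ∧ (∀ d, lam d ≠ 0 → d ⊆ P ∧ ∏ p ∈ d, N p ≤ z) ∧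
      (∀ d, |lam d| ≤ 1) ∧
      ∑ d₁ ∈ P.powerset, ∑ d₂ ∈ P.powerset, lam d₁ * lam d₂ * (∏ p ∈ d₁ ∪ d₂, N p)⁻¹
        = (selS P N z)⁻¹ := by
  set D : Finset (Finset ι) := P.powerset.filter (fun d => ∏ p ∈ d, N p ≤ z) with hD
  set φ : Finset ι → ℝ := fun d => ∏ p ∈ d, (N p - 1) with hφ
  set S := selS P N z with hS
  have hmemD : ∀ d, d ∈ D ↔ d ⊆ P ∧ ∏ p ∈ d, N p ≤ z := by intro d; simp [hD]
  have hφpos : ∀ d, d ⊆ P → 0 < φ d := fun d hd =>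
    Finset.prod_pos (fun p hp => by linarith [hN p (hd hp)])
  have hNpos : ∀ d, d ⊆ P → 0 < ∏ p ∈ d, N p := fun d hd =>
    Finset.prod_pos (fun p hp => by linarith [hN p (hd hp)])
  have hSdef : S = ∑ d ∈ D, (φ d)⁻¹ := by
    rw [hS, selS]
    refine Finset.sum_congr rfl (fun d _ => ?_)
    simp [hφ, Finset.prod_inv_distrib]
  have hempty : (∅ : Finset ι) ∈ D := by simp [hmemD, hz]
  have hDP : ∀ d ∈ D, d ⊆ P := fun d hd => ((hmemD d).1 hd).1
  have hSpos : 0 < S := by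
    rw [hSdef]
    exact Finset.sum_pos (fun d hd => inv_pos.2 (hφpos d (hDP d hd))) ⟨∅, hempty⟩
  set T : Finset ι → ℝ := fun d => ∑ e ∈ D with d ⊆ e, (φ e)⁻¹ with hT
  set lam : Finset ι → ℝ := fun d => (-1) ^ d.card * (∏ p ∈ d, N p) * S⁻¹ * T d with hlam
  have hsupp : ∀ d, lam d ≠ 0 → d ⊆ P ∧ ∏ p ∈ d, N p ≤ z := by
    intro d hd
    have hTd : T d ≠ 0 := fun h => hd (by simp [hlam, h])
    obtain ⟨e, he, -⟩ := Finset.exists_ne_zero_of_sum_ne_zero hTd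
    rw [Finset.mem_filter, hmemD] at he
    obtain ⟨⟨he1, he2⟩, he3⟩ := he
    exact ⟨he3.trans he1, (prod_mono_of he3 (fun p hp => hN p (he1 hp))).trans he2⟩
  refine ⟨lam, ?_, hsupp, ?_, ?_⟩
  · simp only [hlam, hT]
    simp only [Finset.card_empty, pow_zero, Finset.prod_empty, Finset.empty_subset,
      Finset.filter_true, one_mul]
    rw [← hSdef]; field_simp
  · intro d
    by_cases hd0 : lam d = 0
    · rw [hd0]; simp
    obtain ⟨hdP, -⟩ := hsupp d hd0
    have hTnn : 0 ≤ T d := Finset.sum_nonneg (fun e he =>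
      (inv_pos.2 (hφpos e (hDP e (Finset.mem_filter.1 he).1))).le)
    have habs : |lam d| = (∏ p ∈ d, N p) * T d * S⁻¹ := by
      simp only [hlam, abs_mul, abs_pow, abs_neg, abs_one, one_pow, one_mul]
      rw [abs_of_pos (hNpos d hdP), abs_of_pos (inv_pos.2 hSpos), abs_of_nonneg hTnn]; ring
    rw [habs, ← div_eq_mul_inv, div_le_one hSpos, prod_eq_sum_sub_one N d, hSdef, hT]
    rw [Finset.sum_mul_sum, ← Finset.sum_product']
    have hval : ∀ x ∈ d.powerset ×ˢ (D.filter (fun e => d ⊆ e)),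
        (∏ p ∈ x.1, (N p - 1)) * (φ x.2)⁻¹ = (φ (x.2 \ x.1))⁻¹ := by
      intro x hx
      simp only [Finset.mem_product, Finset.mem_powerset, Finset.mem_filter] at hx
      have hsub : x.1 ⊆ x.2 := hx.1.trans hx.2.2
      have h1 : φ (x.2 \ x.1) * ∏ p ∈ x.1, (N p - 1) = φ x.2 := Finset.prod_sdiff hsub
      have h2 := hφpos _ (hDP _ hx.2.1)
      have h3 := hφpos x.1 (hx.1.trans hdP)
      have h4 := hφpos (x.2 \ x.1) (Finset.sdiff_subset.trans (hDP _ hx.2.1))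
      have h3' : (0:ℝ) < ∏ p ∈ x.1, (N p - 1) := h3
      rw [← h1]; field_simp
    rw [Finset.sum_congr rfl hval]
    refine (Finset.sum_image (f := fun e => (φ e)⁻¹) (g := fun x : Finset ι × Finset ι => x.2 \ x.1) ?_).symm.trans_le ?_
    · intro x hx y hy hxy
      simp only [Finset.coe_product, Set.mem_prod, Finset.mem_coe, Finset.mem_powerset, Finset.mem_filter] at hx hy
      simp only at hxy
      have e1 : ∀ u : Finset ι × Finset ι, u.1 ⊆ d → d ⊆ u.2 → u.2 = (u.2 \ u.1) ∪ d := by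
        intro u h1 h2
        ext p; simp only [Finset.mem_union, Finset.mem_sdiff]
        constructor
        · intro hp; by_cases hpd : p ∈ d
          · exact Or.inr hpd
          · exact Or.inl ⟨hp, fun h => hpd (h1 h)⟩
        · rintro (h | h)
          · exact h.1
          · exact h2 h
      have e2 : ∀ u : Finset ι × Finset ι, u.1 ⊆ d → d ⊆ u.2 → u.1 = d \ (u.2 \ u.1) := by
        intro u h1 h2
        ext p; simp only [Finset.mem_sdiff]
        constructor
        · intro hp; exact ⟨h1 hp, fun h => h.2 hp⟩
        · rintro ⟨h, h'⟩
          by_contra hc; exact h' ⟨h2 h, hc⟩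
      refine Prod.ext ?_ ?_
      · rw [e2 x hx.1 hx.2.2, e2 y hy.1 hy.2.2, hxy]
      · rw [e1 x hx.1 hx.2.2, e1 y hy.1 hy.2.2, hxy]
    · refine Finset.sum_le_sum_of_subset_of_nonneg ?_ (fun e he _ => (inv_pos.2 (hφpos e (hDP e he))).le)
      intro e he
      obtain ⟨x, hx, rfl⟩ := Finset.mem_image.1 he
      simp only [Finset.mem_product, Finset.mem_powerset, Finset.mem_filter] at hx
      have h := (hmemD _).1 hx.2.1
      exact (hmemD _).2 ⟨Finset.sdiff_subset.trans h.1,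
        (prod_mono_of Finset.sdiff_subset (fun p hp => hN p (h.1 hp))).trans h.2⟩
  · have hy : ∀ e ∈ P.powerset, ∑ d ∈ P.powerset with e ⊆ d, lam d * (∏ p ∈ d, N p)⁻¹
        = if e ∈ D then (-1) ^ e.card * S⁻¹ * (φ e)⁻¹ else 0 := by
      intro e he
      have h1 : ∀ d ∈ P.powerset.filter (fun d => e ⊆ d), lam d * (∏ p ∈ d, N p)⁻¹
          = ∑ f ∈ D, if d ⊆ f then (-1) ^ d.card * (S⁻¹ * (φ f)⁻¹) else 0 := by
        intro d hd
        have hdP : d ⊆ P := Finset.mem_powerset.1 (Finset.mem_filter.1 hd).1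
        have := (hNpos d hdP).ne'
        simp only [hlam, hT]
        rw [Finset.sum_filter, Finset.mul_sum, Finset.sum_mul]
        refine Finset.sum_congr rfl (fun f _ => ?_)
        split_ifs
        · field_simp
        · simp
      rw [Finset.sum_congr rfl h1, Finset.sum_comm]
      have h2 : ∀ f ∈ D, ∑ d ∈ P.powerset with e ⊆ d, (if d ⊆ f then (-1:ℝ) ^ d.card * (S⁻¹ * (φ f)⁻¹) else 0)
          = if e = f then (-1) ^ e.card * S⁻¹ * (φ e)⁻¹ else 0 := by
        intro f hf
        rw [← Finset.sum_filter, Finset.filter_filter]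
        have hset : P.powerset.filter (fun d => e ⊆ d ∧ d ⊆ f) = f.powerset.filter (fun d => e ⊆ d) := by
          ext d; simp only [Finset.mem_filter, Finset.mem_powerset]
          exact ⟨fun h => ⟨h.2.2, h.2.1⟩, fun h => ⟨h.1.trans (hDP f hf), h.2, h.1⟩⟩
        rw [hset, ← Finset.sum_mul]
        by_cases hef : e ⊆ f
        · rw [mobius_interval e f hef]
          split_ifs with h
          · subst h; ring
          · simp
        · have : f.powerset.filter (fun d => e ⊆ d) = ∅ := by
            refine Finset.filter_eq_empty_iff.2 (fun d hd hed => hef (hed.trans (Finset.mem_powerset.1 hd)))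
          rw [this]
          have : e ≠ f := fun h => hef (h ▸ Finset.Subset.refl _)
          simp [this]
      rw [Finset.sum_congr rfl h2, Finset.sum_ite_eq]
    have hQ : ∑ d₁ ∈ P.powerset, ∑ d₂ ∈ P.powerset, lam d₁ * lam d₂ * (∏ p ∈ d₁ ∪ d₂, N p)⁻¹
        = ∑ e ∈ P.powerset, φ e * (∑ d ∈ P.powerset with e ⊆ d, lam d * (∏ p ∈ d, N p)⁻¹) ^ 2 := by
      have h1 : ∀ d₁ ∈ P.powerset, ∀ d₂ ∈ P.powerset,
          lam d₁ * lam d₂ * (∏ p ∈ d₁ ∪ d₂, N p)⁻¹ =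
          ∑ e ∈ P.powerset, φ e * ((if e ⊆ d₁ then lam d₁ * (∏ p ∈ d₁, N p)⁻¹ else 0) *
            (if e ⊆ d₂ then lam d₂ * (∏ p ∈ d₂, N p)⁻¹ else 0)) := by
        intro d₁ h₁ d₂ h₂
        rw [Finset.mem_powerset] at h₁ h₂
        have hi : ∏ p ∈ d₁ ∩ d₂, N p = ∑ e ∈ P.powerset with e ⊆ d₁ ∩ d₂, φ e := by
          rw [prod_eq_sum_sub_one]
          refine Finset.sum_congr ?_ (fun _ _ => rfl)
          ext e; simp only [Finset.mem_filter, Finset.mem_powerset]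
          exact ⟨fun h => ⟨h.trans (Finset.inter_subset_left.trans h₁), h⟩, fun h => h.2⟩
        have hu : (∏ p ∈ d₁ ∪ d₂, N p)⁻¹ = (∏ p ∈ d₁ ∩ d₂, N p) * (∏ p ∈ d₁, N p)⁻¹ * (∏ p ∈ d₂, N p)⁻¹ := by
          have := Finset.prod_union_inter (s₁ := d₁) (s₂ := d₂) (f := N)
          have a := hNpos _ h₁
          have b := hNpos _ h₂
          have c := hNpos _ (Finset.union_subset h₁ h₂)
          have e := hNpos _ (Finset.inter_subset_left.trans h₁ : d₁ ∩ d₂ ⊆ P)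
          field_simp
          linarith
        rw [hu, hi, Finset.sum_filter, Finset.sum_mul, Finset.sum_mul, Finset.mul_sum]
        refine Finset.sum_congr rfl (fun e _ => ?_)
        by_cases a : e ⊆ d₁ <;> by_cases b : e ⊆ d₂ <;> simp [a, b, Finset.subset_inter_iff]
        ring
      rw [Finset.sum_congr rfl (fun d₁ h₁ => Finset.sum_congr rfl (h1 d₁ h₁))]
      have : ∀ d₁ ∈ P.powerset, ∑ d₂ ∈ P.powerset, ∑ e ∈ P.powerset, φ e * ((if e ⊆ d₁ then lam d₁ * (∏ p ∈ d₁, N p)⁻¹ else 0) *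
            (if e ⊆ d₂ then lam d₂ * (∏ p ∈ d₂, N p)⁻¹ else 0)) =
          ∑ e ∈ P.powerset, ∑ d₂ ∈ P.powerset, φ e * ((if e ⊆ d₁ then lam d₁ * (∏ p ∈ d₁, N p)⁻¹ else 0) *
            (if e ⊆ d₂ then lam d₂ * (∏ p ∈ d₂, N p)⁻¹ else 0)) := fun _ _ => Finset.sum_comm
      rw [Finset.sum_congr rfl this, Finset.sum_comm]
      refine Finset.sum_congr rfl (fun e _ => ?_)
      rw [sq, Finset.sum_filter, Finset.sum_mul_sum, Finset.mul_sum]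
      refine Finset.sum_congr rfl (fun d _ => ?_)
      rw [Finset.mul_sum]
    rw [hQ]
    have h3 : ∀ e ∈ P.powerset, φ e * (∑ d ∈ P.powerset with e ⊆ d, lam d * (∏ p ∈ d, N p)⁻¹) ^ 2
        = if e ∈ D then S⁻¹ ^ 2 * (φ e)⁻¹ else 0 := by
      intro e he
      rw [hy e he]
      have := (hφpos e (Finset.mem_powerset.1 he)).ne'
      split_ifs
      · have h1 : ((-1:ℝ) ^ e.card) ^ 2 = 1 := by rw [← pow_mul, mul_comm, pow_mul]; simp
        rw [mul_pow, mul_pow, h1]; field_simp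
      · simp
    rw [Finset.sum_congr rfl h3, ← Finset.sum_filter]
    have h4 : P.powerset.filter (fun e => e ∈ D) = D := by
      ext e; simp only [Finset.mem_filter, Finset.mem_powerset]
      exact ⟨fun h => h.2, fun h => ⟨hDP e h, h⟩⟩
    rw [h4, ← Finset.mul_sum, ← hSdef]
    field_simp

/-- the sum over pairs is at most the cube of the sum -/
lemma pair_sum_le_cube (P : Finset ι) (N : ι → ℝ) (hN : ∀ p ∈ P, 1 < N p) (z : ℝ) :
    ∑ d₁ ∈ P.powerset with ∏ p ∈ d₁, N p ≤ z, ∑ d₂ ∈ P.powerset with ∏ p ∈ d₂, N p ≤ z,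
      (∏ p ∈ d₁ ∪ d₂, N p)⁻¹ ≤ (∑ d ∈ P.powerset with ∏ p ∈ d, N p ≤ z, (∏ p ∈ d, N p)⁻¹) ^ 3 := by
  set D : Finset (Finset ι) := P.powerset.filter (fun d => ∏ p ∈ d, N p ≤ z) with hD
  have hmemD : ∀ d, d ∈ D ↔ d ⊆ P ∧ ∏ p ∈ d, N p ≤ z := by intro d; simp [hD]
  have hsub : ∀ d e, d ∈ D → e ⊆ d → e ∈ D := by
    intro d e hd he
    rw [hmemD] at hd ⊢
    exact ⟨he.trans hd.1, (prod_mono_of he (fun p hp => hN p (hd.1 hp))).trans hd.2⟩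
  have hpos : ∀ d ∈ D, 0 < (∏ p ∈ d, N p)⁻¹ := fun d hd =>
    inv_pos.2 (Finset.prod_pos (fun p hp => by linarith [hN p (((hmemD d).1 hd).1 hp)]))
  have hrhs : (∑ d ∈ D, (∏ p ∈ d, N p)⁻¹) ^ 3 = ∑ t ∈ D ×ˢ (D ×ˢ D),
      (∏ p ∈ t.1, N p)⁻¹ * ((∏ p ∈ t.2.1, N p)⁻¹ * (∏ p ∈ t.2.2, N p)⁻¹) := by
    rw [Finset.sum_product]
    simp_rw [← Finset.mul_sum]
    rw [← Finset.sum_mul, Finset.sum_product]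
    simp_rw [← Finset.mul_sum]
    rw [← Finset.sum_mul]; ring
  rw [hrhs, ← Finset.sum_product']
  set F : Finset ι × Finset ι → Finset ι × (Finset ι × Finset ι) :=
    fun x => (x.1 \ x.2, (x.1 ∩ x.2, x.2 \ x.1)) with hF
  have hinj : Set.InjOn F (D ×ˢ D : Finset _) := by
    intro x _ y _ hxy
    simp only [hF, Prod.mk.injEq] at hxy
    obtain ⟨h1, h2, h3⟩ := hxy
    refine Prod.ext ?_ ?_
    · rw [← Finset.sdiff_union_inter x.1 x.2, h1, h2, Finset.sdiff_union_inter]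
    · rw [← Finset.sdiff_union_inter x.2 x.1, h3, Finset.inter_comm, h2, Finset.inter_comm, Finset.sdiff_union_inter]
  have hval : ∀ x ∈ D ×ˢ D, (∏ p ∈ x.1 ∪ x.2, N p)⁻¹ =
      (fun t : Finset ι × (Finset ι × Finset ι) => (∏ p ∈ t.1, N p)⁻¹ * ((∏ p ∈ t.2.1, N p)⁻¹ * (∏ p ∈ t.2.2, N p)⁻¹)) (F x) := by
    intro x _
    simp only [hF]
    rw [← mul_inv, ← mul_inv]
    congr 1
    rw [← mul_assoc, ← Finset.prod_union (Finset.disjoint_sdiff_inter _ _), Finset.sdiff_union_inter,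
      ← Finset.prod_union Finset.disjoint_sdiff, Finset.union_sdiff_self_eq_union]
  rw [Finset.sum_congr rfl hval]
  refine (Finset.sum_image (f := fun t : Finset ι × (Finset ι × Finset ι) => (∏ p ∈ t.1, N p)⁻¹ *
    ((∏ p ∈ t.2.1, N p)⁻¹ * (∏ p ∈ t.2.2, N p)⁻¹)) hinj).symm.trans_le ?_
  refine Finset.sum_le_sum_of_subset_of_nonneg ?_ ?_
  · intro t ht
    obtain ⟨x, hx, rfl⟩ := Finset.mem_image.1 ht
    rw [Finset.mem_product] at hx
    simp only [hF, Finset.mem_product]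
    exact ⟨hsub _ _ hx.1 Finset.sdiff_subset, hsub _ _ hx.1 Finset.inter_subset_left,
      hsub _ _ hx.2 Finset.sdiff_subset⟩
  · intro t ht _
    simp only [Finset.mem_product] at ht
    exact mul_nonneg (hpos _ ht.1).le (mul_nonneg (hpos _ ht.2.1).le (hpos _ ht.2.2).le)

end Selberg

end BT

set_option linter.unusedVariables false

namespace BT

lemma abel_aux (a : ℕ → ℝ) (M : ℕ) :
    ∑ k ∈ Finset.Icc 1 M, a k / k = (∑ k ∈ Finset.Icc 1 M, a k) / (M + 1)
      + ∑ n ∈ Finset.Icc 1 M, (∑ k ∈ Finset.Icc 1 n, a k) / (n * (n + 1)) := by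
  induction M with
  | zero => simp
  | succ M ih =>
    rw [Finset.sum_Icc_succ_top (by omega), ih, Finset.sum_Icc_succ_top (b := M) (by omega) (f := fun n : ℕ => (∑ k ∈ Finset.Icc 1 n, a k) / ((n:ℝ) * (n + 1))),
      Finset.sum_Icc_succ_top (by omega)]
    push_cast
    have h1 : (M:ℝ) + 1 ≠ 0 := by positivity
    have h2 : (M:ℝ) + 1 + 1 ≠ 0 := by positivity
    field_simp
    ring

lemma sum_inv_succ (M : ℕ) : ∑ n ∈ Finset.Icc 1 M, ((n:ℝ) + 1)⁻¹ = (harmonic (M + 1) : ℝ) - 1 := by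
  induction M with
  | zero => simp [harmonic]
  | succ M ih =>
    rw [Finset.sum_Icc_succ_top (by omega), ih, harmonic_succ (M + 1)]
    push_cast; ring

lemma abel_lower (a : ℕ → ℝ) (ha : ∀ n, 0 ≤ a n) (κ C δ : ℝ) (hκ : 0 ≤ κ) (hC : 0 ≤ C) (hδ : 0 < δ)
    (hA : ∀ n : ℕ, 1 ≤ n → κ * n - C * (n:ℝ) ^ (1 - δ) ≤ ∑ k ∈ Finset.Icc 1 n, a k) :
    ∃ C' : ℝ, 0 ≤ C' ∧ ∀ z : ℝ, 1 ≤ z → κ * Real.log z - C' ≤ ∑ k ∈ Finset.Icc 1 ⌊z⌋₊, a k / k := by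
  have hsum : Summable (fun n : ℕ => (n:ℝ) ^ (-(1 + δ))) :=
    Real.summable_nat_rpow.2 (by linarith)
  have hnn : ∀ n : ℕ, 0 ≤ (n:ℝ) ^ (-(1 + δ)) := fun n => by positivity
  refine ⟨κ + C * ∑' n : ℕ, (n:ℝ) ^ (-(1 + δ)), add_nonneg hκ (mul_nonneg hC (tsum_nonneg hnn)), ?_⟩
  intro z hz
  set M := ⌊z⌋₊ with hM
  rw [abel_aux]
  have h0 : 0 ≤ (∑ k ∈ Finset.Icc 1 M, a k) / ((M:ℝ) + 1) := by
    have := Finset.sum_nonneg (s := Finset.Icc 1 M) (fun k _ => ha k)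
    positivity
  have h1 : ∑ n ∈ Finset.Icc 1 M, (κ * ((n:ℝ) + 1)⁻¹ - C * (n:ℝ) ^ (-(1 + δ))) ≤
      ∑ n ∈ Finset.Icc 1 M, (∑ k ∈ Finset.Icc 1 n, a k) / (n * (n + 1)) := by
    refine Finset.sum_le_sum (fun n hn => ?_)
    have hn1 : 1 ≤ n := (Finset.mem_Icc.1 hn).1
    have hnp : (0:ℝ) < n := by exact_mod_cast hn1
    have h := hA n hn1
    rw [le_div_iff₀ (by positivity)]
    refine le_trans ?_ h
    have e1 : (n:ℝ) ^ (-(1 + δ)) * (n * n) = (n:ℝ) ^ (1 - δ) := by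
      rw [show (n:ℝ) * n = (n:ℝ) ^ (2:ℝ) by rw [Real.rpow_two]; ring, ← Real.rpow_add hnp]
      congr 1; ring
    have e2 : (n:ℝ) ^ (1 - δ) ≤ (n:ℝ) ^ (-(1 + δ)) * (n * (n + 1)) := by
      rw [← e1]
      gcongr
      linarith
    have e3 : κ * ((n:ℝ) + 1)⁻¹ * (n * (n + 1)) = κ * n := by field_simp
    nlinarith
  rw [Finset.sum_sub_distrib, ← Finset.mul_sum, ← Finset.mul_sum, sum_inv_succ] at h1
  have h2 : ∑ n ∈ Finset.Icc 1 M, (n:ℝ) ^ (-(1 + δ)) ≤ ∑' n : ℕ, (n:ℝ) ^ (-(1 + δ)) :=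
    hsum.sum_le_tsum _ (fun n _ => hnn n)
  have h3 : Real.log z ≤ harmonic (M + 1) := by
    refine le_trans ?_ (log_add_one_le_harmonic (M + 1))
    refine Real.log_le_log (by linarith) ?_
    have := (Nat.lt_floor_add_one z).le
    push_cast; linarith
  nlinarith [mul_le_mul_of_nonneg_left h2 hC, mul_le_mul_of_nonneg_left h3 hκ]

lemma abel_upper (a : ℕ → ℝ) (C : ℝ) (hC : 0 ≤ C)
    (hA : ∀ n : ℕ, 1 ≤ n → ∑ k ∈ Finset.Icc 1 n, a k ≤ C * n) (z : ℝ) (hz : 1 ≤ z) :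
    ∑ k ∈ Finset.Icc 1 ⌊z⌋₊, a k / k ≤ C * (2 + Real.log z) := by
  set M := ⌊z⌋₊ with hM
  have hM1 : 1 ≤ M := Nat.le_floor (by simpa using hz)
  rw [abel_aux]
  have h0 : (∑ k ∈ Finset.Icc 1 M, a k) / ((M:ℝ) + 1) ≤ C := by
    rw [div_le_iff₀ (by positivity)]
    have := hA M hM1; nlinarith
  have h1 : ∑ n ∈ Finset.Icc 1 M, (∑ k ∈ Finset.Icc 1 n, a k) / ((n:ℝ) * (n + 1)) ≤
      ∑ n ∈ Finset.Icc 1 M, (C * ((n:ℝ) + 1)⁻¹) := by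
    refine Finset.sum_le_sum (fun n hn => ?_)
    have hn1 : 1 ≤ n := (Finset.mem_Icc.1 hn).1
    have hnp : (0:ℝ) < n := by exact_mod_cast hn1
    rw [div_le_iff₀ (by positivity)]
    refine (hA n hn1).trans_eq ?_
    field_simp
  rw [← Finset.mul_sum, sum_inv_succ] at h1
  have h3 : (harmonic (M+1) : ℝ) - 1 ≤ 1 + Real.log z := by
    rw [harmonic_succ]
    have h4 := harmonic_le_one_add_log M
    have h5 : Real.log M ≤ Real.log z := Real.log_le_log (by exact_mod_cast hM1) (Nat.floor_le (by linarith))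
    have h6 : ((M:ℝ) + 1)⁻¹ ≤ 1 := inv_le_one_of_one_le₀ (by linarith [show (0:ℝ) ≤ M by positivity])
    push_cast at h4 ⊢
    linarith
  nlinarith [mul_le_mul_of_nonneg_left h3 hC]

end BT

set_option linter.unusedVariables false

namespace BT
open MeasureTheory

section lattice
variable {E : Type*} [NormedAddCommGroup E] [NormedSpace ℝ E] [FiniteDimensional ℝ E]
  [MeasurableSpace E] [BorelSpace E] (μ : Measure E) [μ.IsAddHaarMeasure]

lemma packing (s : Finset E) (v : E) (R η : ℝ) (hη : 0 < η) (hR : 0 ≤ R)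
    (h1 : ∀ c ∈ s, ‖c + v‖ ≤ R) (h2 : ∀ c ∈ s, ∀ d ∈ s, c ≠ d → η ≤ ‖c - d‖) :
    (s.card : ℝ) ≤ (2 * R / η + 1) ^ (Module.finrank ℝ E) := by
  borelize E
  let μ : Measure E := Measure.addHaar
  set n := Module.finrank ℝ E
  set A := ⋃ c ∈ s, Metric.ball (c : E) (η / 2) with hA
  have D : Set.Pairwise (s : Set E) (Function.onFun Disjoint fun c => Metric.ball (c : E) (η / 2)) := by
    rintro c hc d hd hcd
    apply Metric.ball_disjoint_ball
    rw [dist_eq_norm]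
    linarith [h2 c hc d hd hcd]
  have A_subset : A ⊆ Metric.ball (-v) (R + η) := by
    refine Set.iUnion₂_subset fun x hx => ?_
    apply Metric.ball_subset_ball'
    rw [dist_eq_norm, sub_neg_eq_add]
    linarith [h1 x hx]
  have A_subset : A ⊆ Metric.ball (-v) (R + η / 2) := by
    refine Set.iUnion₂_subset fun x hx => ?_
    apply Metric.ball_subset_ball'
    rw [dist_eq_norm, sub_neg_eq_add]
    linarith [h1 x hx]
  have I : (s.card : ENNReal) * ENNReal.ofReal ((η / 2) ^ n) * μ (Metric.ball 0 1) ≤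
      ENNReal.ofReal ((R + η / 2) ^ n) * μ (Metric.ball 0 1) :=
    calc
      (s.card : ENNReal) * ENNReal.ofReal ((η / 2) ^ n) * μ (Metric.ball 0 1) = μ A := by
        rw [hA, measure_biUnion_finset D fun c _ => measurableSet_ball]
        have J : 0 < η / 2 := by positivity
        simp only [μ.addHaar_ball_of_pos _ J, Finset.sum_const, nsmul_eq_mul, mul_assoc, n]
      _ ≤ μ (Metric.ball (-v) (R + η / 2)) := measure_mono A_subset
      _ = ENNReal.ofReal ((R + η / 2) ^ n) * μ (Metric.ball 0 1) := by
        rw [μ.addHaar_ball_of_pos _ (by positivity)]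
  have J : (s.card : ENNReal) * ENNReal.ofReal ((η / 2) ^ n) ≤ ENNReal.ofReal ((R + η / 2) ^ n) :=
    (ENNReal.mul_le_mul_iff_left (Metric.measure_ball_pos _ _ zero_lt_one).ne' measure_ball_lt_top.ne).1 I
  have K : (s.card : ℝ) * (η / 2) ^ n ≤ (R + η / 2) ^ n := by
    have : (s.card : ENNReal) = ENNReal.ofReal (s.card : ℝ) := by simp
    rw [this, ← ENNReal.ofReal_mul (by positivity)] at J
    exact (ENNReal.ofReal_le_ofReal_iff (by positivity)).1 J
  rw [← le_div_iff₀ (by positivity), ← div_pow] at K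
  refine K.trans_eq ?_
  congr 1
  field_simp

lemma packing_finite (L : Submodule ℤ E) (η : ℝ) (hη : 0 < η) (hsep : ∀ l ∈ L, l ≠ 0 → η ≤ ‖l‖)
    (v : E) (R : ℝ) (hR : 0 ≤ R) :
    ({l : L | ‖(l : E) + v‖ ≤ R}).Finite ∧
      (({l : L | ‖(l : E) + v‖ ≤ R}).ncard : ℝ) ≤ (2 * R / η + 1) ^ (Module.finrank ℝ E) := by
  have key : ∀ s : Finset L, (s : Set L) ⊆ {l : L | ‖(l : E) + v‖ ≤ R} →
      (s.card : ℝ) ≤ (2 * R / η + 1) ^ (Module.finrank ℝ E) := by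
    intro s hs
    have h := packing (s.map (Function.Embedding.subtype _)) v R η hη hR ?_ ?_
    · simpa using h
    · intro c hc
      obtain ⟨l, hl, rfl⟩ := Finset.mem_map.1 hc
      exact hs hl
    · intro c hc d hd hcd
      obtain ⟨l, hl, rfl⟩ := Finset.mem_map.1 hc
      obtain ⟨l', hl', rfl⟩ := Finset.mem_map.1 hd
      exact hsep _ (L.sub_mem l.2 l'.2) (sub_ne_zero.2 hcd)
  have hfin : ({l : L | ‖(l : E) + v‖ ≤ R}).Finite := by
    by_contra hinf
    obtain ⟨t, ht, hc⟩ := Set.Infinite.exists_subset_card_eq hinf (⌊(2 * R / η + 1) ^ (Module.finrank ℝ E)⌋₊ + 1)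
    have := key t ht
    rw [hc] at this
    push_cast at this
    linarith [Nat.lt_floor_add_one ((2 * R / η + 1) ^ (Module.finrank ℝ E))]
  refine ⟨hfin, ?_⟩
  have := key hfin.toFinset (by simp)
  rwa [← Set.ncard_eq_toFinset_card _ hfin] at this

theorem lattice_riemann (L : Submodule ℤ E) [Countable L] (D : Set E) (hD : IsAddFundamentalDomain L D μ)
    (hDb : Bornology.IsBounded D) (hDm : MeasurableSet D) (η δ Λ R : ℝ) (hη : 0 < η) (hδ : 0 ≤ δ) (hΛ : 0 ≤ Λ) (hR : 0 ≤ R)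
    (hsep : ∀ l ∈ L, l ≠ 0 → η ≤ ‖l‖) (hcov : ∀ y : E, ∃ l ∈ L, ‖y - l‖ ≤ δ)
    (f : E → ℝ) (hf : ∀ v w, |f v - f w| ≤ Λ * ‖v - w‖) (hsupp : ∀ v, f v ≠ 0 → ‖v‖ ≤ R) (v0 : E) :
    |μ.real D * ∑' l : L, f (l + v0) - ∫ v, f v ∂μ| ≤
      μ.real D * (Λ * δ * (2 * (R + δ) / η + 1) ^ (Module.finrank ℝ E)) := by
  have hDfin : μ D < ⊤ := hDb.measure_lt_top
  have hcont : Continuous f := by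
    have : LipschitzWith ⟨Λ, hΛ⟩ f := LipschitzWith.of_dist_le_mul (fun v w => by
      rw [Real.dist_eq, dist_eq_norm]; exact hf v w)
    exact this.continuous
  have hcs : HasCompactSupport f := by
    refine HasCompactSupport.of_support_subset_isCompact (isCompact_closedBall (0:E) R) ?_
    intro v hv
    simpa using hsupp v hv
  have hfint : Integrable f μ := hcont.integrable_of_hasCompactSupport hcs
  set φ : E → ℝ := fun y => ∑' l : L, f (l + y) with hφ
  have hvar : ∀ y, |φ v0 - φ y| ≤ Λ * δ * (2 * (R + δ) / η + 1) ^ (Module.finrank ℝ E) := by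
    intro y
    obtain ⟨l0, hl0, hl0'⟩ := hcov (y - v0)
    set y' := y - l0 with hy'
    have hyy : ‖v0 - y'‖ ≤ δ := by
      rw [← norm_neg]; refine le_trans (le_of_eq ?_) hl0'
      congr 1; rw [hy']; abel
    have hshift : φ y = φ y' := by
      simp only [hφ]
      rw [← (Equiv.addRight (⟨l0, hl0⟩ : L)).tsum_eq (fun l : L => f (l + y'))]
      refine tsum_congr (fun l => ?_)
      congr 1
      simp [hy']
    rw [hshift]
    obtain ⟨hfin, hcard⟩ := packing_finite L η hη hsep v0 (R + δ) (by positivity)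
    have hz : ∀ w, ‖v0 - w‖ ≤ δ → ∀ l : L, l ∉ hfin.toFinset → f (l + w) = 0 := by
      intro w hw l hl
      by_contra hne
      apply hl
      have h1 := hsupp _ hne
      simp only [Set.Finite.mem_toFinset, Set.mem_ofPred_eq]
      calc ‖(l:E) + v0‖ = ‖((l:E) + w) + (v0 - w)‖ := by congr 1; abel
        _ ≤ R + δ := (norm_add_le _ _).trans (add_le_add h1 hw)
    have e1 : φ v0 = ∑ l ∈ hfin.toFinset, f (l + v0) := tsum_eq_sum (hz v0 (by simpa using hδ))
    have e2 : φ y' = ∑ l ∈ hfin.toFinset, f (l + y') := tsum_eq_sum (hz y' hyy)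
    rw [e1, e2, ← Finset.sum_sub_distrib]
    refine (Finset.abs_sum_le_sum_abs _ _).trans ?_
    have : ∀ l ∈ hfin.toFinset, |f (l + v0) - f (l + y')| ≤ Λ * δ := by
      intro l _
      refine (hf _ _).trans ?_
      gcongr
      simpa using hyy
    refine (Finset.sum_le_card_nsmul _ _ _ this).trans ?_
    rw [nsmul_eq_mul, mul_comm]
    rw [Set.ncard_eq_toFinset_card _ hfin] at hcard
    gcongr
  obtain ⟨ρ, hρ⟩ := hDb.exists_norm_le
  obtain ⟨hfin, -⟩ := packing_finite L η hη hsep 0 (R + |ρ|) (by positivity)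
  have hz : ∀ y ∈ D, ∀ l : L, l ∉ hfin.toFinset → f (l + y) = 0 := by
    intro y hy l hl
    by_contra hne
    apply hl
    have h1 := hsupp _ hne
    simp only [Set.Finite.mem_toFinset, Set.mem_ofPred_eq]
    calc ‖(l:E) + 0‖ = ‖((l:E) + y) - y‖ := by congr 1; abel
      _ ≤ R + |ρ| := (norm_sub_le _ _).trans (add_le_add h1 ((hρ y hy).trans (le_abs_self ρ)))
  have hfintl : ∀ l : L, Integrable (fun y => f (l + y)) μ := fun l => hfint.comp_add_left (l:E)
  haveI : VAddInvariantMeasure L E μ := ⟨fun c s _ => measure_preimage_add μ (c:E) s⟩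
  have hI : ∫ v, f v ∂μ = ∫ y in D, ∑ l ∈ hfin.toFinset, f (l + y) ∂μ := by
    rw [integral_finsetSum _ (fun l _ => (hfintl l).integrableOn), hD.integral_eq_tsum'' f hfint]
    refine tsum_eq_sum (fun l hl => ?_)
    refine setIntegral_eq_zero_of_forall_eq_zero (fun y hy => ?_)
    exact hz y hy l hl
  have hφD : ∀ y ∈ D, φ y = ∑ l ∈ hfin.toFinset, f (l + y) := fun y hy => tsum_eq_sum (hz y hy)
  have hIφ : μ.real D * φ v0 - ∫ v, f v ∂μ = ∫ y in D, (φ v0 - ∑ l ∈ hfin.toFinset, f (l + y)) ∂μ := by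
    haveI : IsFiniteMeasure (μ.restrict D) := ⟨by simpa using hDfin⟩
    rw [integral_sub (integrable_const _) (integrable_finsetSum _ (fun l _ => (hfintl l).integrableOn)), hI]
    simp
  rw [hIφ, ← Real.norm_eq_abs, mul_comm (μ.real D)]
  refine norm_setIntegral_le_of_norm_le_const hDfin (fun y hy => ?_)
  rw [← hφD y hy]
  exact hvar y

end lattice
end BT


namespace BT
section weights

/-- the tent function -/
noncomputable def tau (t : ℝ) : ℝ := max 0 (1 - |t|)

theorem tau_nonneg (t : ℝ) : 0 ≤ tau t := le_max_left _ _
theorem tau_le_one (t : ℝ) : tau t ≤ 1 := max_le zero_le_one (by linarith [abs_nonneg t])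
theorem tau_lip (a b : ℝ) : |tau a - tau b| ≤ |a - b| := by
  unfold tau
  refine (abs_max_sub_max_le_max _ _ _ _).trans ?_
  refine max_le (by simp) ?_
  rw [show (1 - |a|) - (1 - |b|) = |b| - |a| by ring, abs_sub_comm a b]
  exact abs_abs_sub_abs_le_abs_sub b a
theorem tau_ne_zero {t : ℝ} (h : tau t ≠ 0) : |t| < 1 := by
  by_contra h'
  exact h (max_eq_left (by linarith))
theorem tau_zero : tau 0 = 1 := by simp [tau]

theorem tau_sum (t : ℝ) : ∑ k ∈ ({-⌊t⌋, -⌊t⌋ - 1} : Finset ℤ), tau (t + k) = 1 := by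
  rw [Finset.sum_pair (by omega)]
  have h1 := Int.floor_le t
  have h2 := Int.lt_floor_add_one t
  unfold tau
  push_cast
  rw [abs_of_nonneg (by linarith), abs_of_nonpos (by linarith), max_eq_right (by linarith), max_eq_right (by linarith)]
  ring

theorem tau_mem {t : ℝ} {k : ℤ} (h : tau (t + k) ≠ 0) : k ∈ ({-⌊t⌋, -⌊t⌋ - 1} : Finset ℤ) := by
  have := abs_lt.1 (tau_ne_zero h)
  have h1 := Int.floor_le t
  have h2 := Int.lt_floor_add_one t
  have h3 : k < -⌊t⌋ + 1 := by
    have : (k:ℝ) < ((-⌊t⌋ + 1 : ℤ):ℝ) := by push_cast; linarith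
    exact_mod_cast this
  have h4 : -⌊t⌋ - 2 < k := by
    have : ((-⌊t⌋ - 2 : ℤ):ℝ) < k := by push_cast; linarith
    exact_mod_cast this
  simp only [Finset.mem_insert, Finset.mem_singleton]
  omega

/-- the cut-off function in logarithmic scale -/
noncomputable def wcut (ε s : ℝ) : ℝ := max 0 (min 1 (min (s - Real.log ε) ((ε - s) / ε)))

theorem wcut_nonneg (ε s : ℝ) : 0 ≤ wcut ε s := le_max_left _ _
theorem wcut_le_one (ε s : ℝ) : wcut ε s ≤ 1 := max_le zero_le_one (min_le_left _ _)
theorem wcut_lip {ε : ℝ} (h0 : 0 < ε) (h1 : ε ≤ 1) (a b : ℝ) : |wcut ε a - wcut ε b| ≤ ε⁻¹ * |a - b| := by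
  unfold wcut
  have hp : 0 ≤ ε⁻¹ * |a - b| := by positivity
  refine (abs_max_sub_max_le_max _ _ _ _).trans (max_le (by simpa using hp) ?_)
  refine (abs_min_sub_min_le_max _ _ _ _).trans (max_le (by simpa using hp) ?_)
  refine (abs_min_sub_min_le_max _ _ _ _).trans (max_le ?_ ?_)
  · rw [sub_sub_sub_cancel_right]
    have : 1 ≤ ε⁻¹ := (one_le_inv₀ h0).2 h1
    nlinarith [abs_nonneg (a - b)]
  · rw [show (ε - a) / ε - (ε - b) / ε = -(ε⁻¹ * (a - b)) by field_simp; ring, abs_neg, abs_mul, abs_of_pos (inv_pos.2 h0)]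
theorem wcut_ne_zero {ε s : ℝ} (h0 : 0 < ε) (h : wcut ε s ≠ 0) : Real.log ε < s ∧ s < ε := by
  by_contra h'
  apply h
  refine max_eq_left ?_
  by_cases hs : Real.log ε < s
  · have : ε ≤ s := by
      by_contra h2
      exact h' ⟨hs, not_le.1 h2⟩
    refine (min_le_right _ _).trans ((min_le_right _ _).trans ?_)
    exact div_nonpos_of_nonpos_of_nonneg (by linarith) h0.le
  · exact (min_le_right _ _).trans ((min_le_left _ _).trans (by linarith))
theorem wcut_eq_one {ε s : ℝ} (h0 : 0 < ε) (h1 : Real.log ε + 1 ≤ s) (h2 : s ≤ 0) : wcut ε s = 1 := by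
  unfold wcut
  have : 1 ≤ (ε - s) / ε := by rw [le_div_iff₀ h0]; linarith
  rw [min_eq_left (le_min (by linarith) this)]
  simp

theorem abs_prod_sub_le {ι : Type*} (s : Finset ι) (a b : ι → ℝ) (ha : ∀ i, 0 ≤ a i ∧ a i ≤ 1)
    (hb : ∀ i, 0 ≤ b i ∧ b i ≤ 1) : |∏ i ∈ s, a i - ∏ i ∈ s, b i| ≤ ∑ i ∈ s, |a i - b i| := by
  classical
  induction s using Finset.induction_on with
  | empty => simp
  | insert i s hi ih =>
    rw [Finset.prod_insert hi, Finset.prod_insert hi, Finset.sum_insert hi]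
    have h1 : |∏ j ∈ s, b j| ≤ 1 := by
      rw [abs_of_nonneg (Finset.prod_nonneg fun j _ => (hb j).1)]
      exact Finset.prod_le_one (fun j _ => (hb j).1) (fun j _ => (hb j).2)
    have h2 : |a i| ≤ 1 := by rw [abs_of_nonneg (ha i).1]; exact (ha i).2
    calc |a i * ∏ j ∈ s, a j - b i * ∏ j ∈ s, b j|
        = |a i * (∏ j ∈ s, a j - ∏ j ∈ s, b j) + (a i - b i) * ∏ j ∈ s, b j| := by congr 1; ring
      _ ≤ |a i| * |∏ j ∈ s, a j - ∏ j ∈ s, b j| + |a i - b i| * |∏ j ∈ s, b j| := by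
          rw [← abs_mul, ← abs_mul]; exact abs_add_le _ _
      _ ≤ 1 * (∑ j ∈ s, |a j - b j|) + |a i - b i| * 1 := by gcongr
      _ = _ := by ring

end weights

section cone
open NumberField NumberField.mixedEmbedding NumberField.InfinitePlace NumberField.Units
  NumberField.Units.dirichletUnitTheorem Module
open scoped Classical

variable (K : Type*) [Field K] [NumberField K]

/-- logarithmic norm as a linear functional -/
noncomputable def sL : (InfinitePlace K → ℝ) →ₗ[ℝ] ℝ := ∑ w : InfinitePlace K, (mult w : ℝ) • LinearMap.proj w

theorem sL_apply (l : InfinitePlace K → ℝ) : sL K l = ∑ w, (mult w : ℝ) * l w := by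
  simp [sL]

/-- unit lattice basis -/
noncomputable def uB : Basis (Fin (rank K)) ℝ (logSpace K) := (basisUnitLattice K).ofZLatticeBasis ℝ _

/-- the part of the logs visible in the log space -/
noncomputable def preT : (InfinitePlace K → ℝ) →ₗ[ℝ] (logSpace K) :=
  LinearMap.pi fun w : {w : InfinitePlace K // w ≠ w₀} =>
    (mult w.1 : ℝ) • (LinearMap.proj w.1 - ((finrank ℚ K : ℝ)⁻¹) • sL K)

/-- coordinates -/
noncomputable def Tl : (InfinitePlace K → ℝ) →ₗ[ℝ] (Fin (rank K) → ℝ) :=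
  (uB K).equivFun.toLinearMap ∘ₗ preT K

/-- vector of logs -/
noncomputable def ell (v : mixedSpace K) : InfinitePlace K → ℝ := fun w => Real.log (normAtPlace w v)

variable {K}

theorem sL_ell (v : mixedSpace K) (hv : mixedEmbedding.norm v ≠ 0) : sL K (ell K v) = Real.log (mixedEmbedding.norm v) := by
  rw [sL_apply, mixedEmbedding.norm_apply, Real.log_prod]
  · simp [ell]
  · intro w _
    exact pow_ne_zero _ (mixedEmbedding.norm_ne_zero_iff.1 hv w)

theorem Tl_ell (v : mixedSpace K) (hv : mixedEmbedding.norm v ≠ 0) :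
    Tl K (ell K v) = (uB K).equivFun (logMap v) := by
  simp only [Tl, LinearMap.coe_comp, Function.comp]
  change (uB K).equivFun (preT K (ell K v)) = _
  congr 1
  ext w
  simp only [preT, LinearMap.pi_apply, LinearMap.smul_apply, LinearMap.sub_apply, LinearMap.proj_apply, logMap_apply, sL_ell v hv, smul_eq_mul]
  simp [ell, mul_comm]

theorem sL_const (c : ℝ) : sL K (fun _ => c) = finrank ℚ K * c := by
  rw [sL_apply, ← Finset.sum_mul]
  congr 1
  exact_mod_cast sum_mult_eq (K := K)

theorem Tl_const (c : ℝ) : Tl K (fun _ => c) = 0 := by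
  have : preT K (fun _ => c) = 0 := by
    ext w
    have : (finrank ℚ K : ℝ) ≠ 0 := by exact_mod_cast finrank_pos.ne'
    simp only [preT, LinearMap.pi_apply, LinearMap.smul_apply, LinearMap.sub_apply, LinearMap.proj_apply, sL_const, smul_eq_mul]
    simp [this]
  simp [Tl, this]

theorem ker_aux (l : InfinitePlace K → ℝ) (h1 : Tl K l = 0) (h2 : sL K l = 0) : l = 0 := by
  have h3 : preT K l = 0 := by
    simpa [Tl] using h1
  have h4 : ∀ w : InfinitePlace K, w ≠ w₀ → l w = 0 := by
    intro w hw
    have := congrFun h3 ⟨w, hw⟩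
    simp only [preT, LinearMap.pi_apply, LinearMap.smul_apply, LinearMap.sub_apply, LinearMap.proj_apply, h2, smul_eq_mul] at this
    simpa [mult_coe_ne_zero] using this
  ext w
  by_cases hw : w = w₀
  · rw [sL_apply, Finset.sum_eq_single w₀ (fun b _ hb => by rw [h4 b hb, mul_zero]) (by simp)] at h2
    rw [hw]
    simpa [mult_coe_ne_zero] using h2
  · exact h4 w hw

variable (K) in
theorem T_bound : ∃ C : ℝ, 0 ≤ C ∧ ∀ l : InfinitePlace K → ℝ, (∀ i, |Tl K l i| ≤ 1) →
    ∀ w, |l w - sL K l / finrank ℚ K| ≤ C := by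
  have hn : (finrank ℚ K : ℝ) ≠ 0 := by exact_mod_cast finrank_pos.ne'
  have hinj : LinearMap.ker ((Tl K).prod (sL K)) = ⊥ := by
    rw [LinearMap.ker_eq_bot']
    intro l hl
    have := Prod.ext_iff.1 hl
    exact ker_aux l this.1 this.2
  obtain ⟨C, -, hC⟩ := LinearMap.exists_antilipschitzWith _ hinj
  refine ⟨C, C.2, fun l hl w => ?_⟩
  set m : InfinitePlace K → ℝ := l - fun _ => sL K l / finrank ℚ K with hm
  have h1 : Tl K m = Tl K l := by rw [hm, map_sub, Tl_const, sub_zero]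
  have h2 : sL K m = 0 := by rw [hm, map_sub, sL_const]; field_simp; ring
  have h3 := hC.le_mul_dist m 0
  rw [map_zero, dist_zero_right, dist_zero_right] at h3
  have h4 : ‖((Tl K).prod (sL K)) m‖ ≤ 1 := by
    have h7 : ((Tl K).prod (sL K)) m = (Tl K l, 0) := Prod.ext h1 h2
    rw [h7, Prod.norm_def]
    simp only [norm_zero]
    refine max_le ?_ zero_le_one
    rw [pi_norm_le_iff_of_nonneg zero_le_one]
    exact hl
  have h5 : ‖m w‖ ≤ ‖m‖ := norm_le_pi_norm m w
  have h6 : (C:ℝ) * ‖((Tl K).prod (sL K)) m‖ ≤ C * 1 := by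
    have := C.2
    gcongr
  calc |l w - sL K l / finrank ℚ K| = ‖m w‖ := rfl
    _ ≤ C := by linarith

variable (K) in
theorem T_lip : ∃ C : ℝ, 0 ≤ C ∧ ∀ l m : InfinitePlace K → ℝ, (∀ i, |Tl K l i - Tl K m i| ≤ C * ‖l - m‖) ∧
    |sL K l - sL K m| ≤ C * ‖l - m‖ := by
  let A := LinearMap.toContinuousLinearMap ((Tl K).prod (sL K))
  refine ⟨‖A‖, norm_nonneg _, fun l m => ?_⟩
  have h := A.le_opNorm (l - m)
  have h1 : A (l - m) = (Tl K l - Tl K m, sL K l - sL K m) := by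
    change ((Tl K).prod (sL K)) (l - m) = _
    simp
  rw [h1, Prod.norm_def] at h
  refine ⟨fun i => ?_, (le_max_right _ _).trans h⟩
  exact (norm_le_pi_norm (Tl K l - Tl K m) i).trans ((le_max_left _ _).trans h)

/-- the smooth weight in log coordinates -/
noncomputable def psiL (l : InfinitePlace K → ℝ) : ℝ := ∏ i, tau (Tl K l i)

theorem psiL_nonneg (l : InfinitePlace K → ℝ) : 0 ≤ psiL l := Finset.prod_nonneg fun _ _ => tau_nonneg _
theorem psiL_le_one (l : InfinitePlace K → ℝ) : psiL l ≤ 1 :=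
  Finset.prod_le_one (fun _ _ => tau_nonneg _) fun _ _ => tau_le_one _
theorem psiL_ne_zero {l : InfinitePlace K → ℝ} (h : psiL l ≠ 0) (i) : |Tl K l i| ≤ 1 :=
  (tau_ne_zero (Finset.prod_ne_zero_iff.1 h i (Finset.mem_univ _))).le

/-- weight in log coordinates -/
noncomputable def Hw (ε : ℝ) (l : InfinitePlace K → ℝ) : ℝ := psiL l * wcut ε (sL K l)

variable (K) in
theorem Hw_lip : ∃ C : ℝ, 0 ≤ C ∧ ∀ ε : ℝ, 0 < ε → ε ≤ 1 → ∀ l m : InfinitePlace K → ℝ,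
    |Hw ε l - Hw ε m| ≤ C * ε⁻¹ * ‖l - m‖ := by
  obtain ⟨C, hC, h⟩ := T_lip K
  refine ⟨(rank K + 1) * C, by positivity, fun ε h0 h1 l m => ?_⟩
  have hε : 1 ≤ ε⁻¹ := (one_le_inv₀ h0).2 h1
  have e1 : |psiL l - psiL m| ≤ rank K * (C * ‖l - m‖) := by
    refine (abs_prod_sub_le _ _ _ (fun i => ⟨tau_nonneg _, tau_le_one _⟩) (fun i => ⟨tau_nonneg _, tau_le_one _⟩)).trans ?_
    refine (Finset.sum_le_card_nsmul _ _ (C * ‖l - m‖) (fun i _ => (tau_lip _ _).trans ((h l m).1 i))).trans ?_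
    simp
  have e2 : |wcut ε (sL K l) - wcut ε (sL K m)| ≤ ε⁻¹ * (C * ‖l - m‖) :=
    (wcut_lip h0 h1 _ _).trans (by gcongr; exact (h l m).2)
  have p1 : |wcut ε (sL K l)| ≤ 1 := by rw [abs_of_nonneg (wcut_nonneg _ _)]; exact wcut_le_one _ _
  have p2 : |psiL m| ≤ 1 := by rw [abs_of_nonneg (psiL_nonneg _)]; exact psiL_le_one _
  calc |Hw ε l - Hw ε m| = |(psiL l - psiL m) * wcut ε (sL K l) + psiL m * (wcut ε (sL K l) - wcut ε (sL K m))| := by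
        unfold Hw; congr 1; ring
    _ ≤ |psiL l - psiL m| * |wcut ε (sL K l)| + |psiL m| * |wcut ε (sL K l) - wcut ε (sL K m)| := by
        rw [← abs_mul, ← abs_mul]; exact abs_add_le _ _
    _ ≤ (rank K * (C * ‖l - m‖)) * 1 + 1 * (ε⁻¹ * (C * ‖l - m‖)) := by gcongr
    _ ≤ ε⁻¹ * (rank K * (C * ‖l - m‖)) + 1 * (ε⁻¹ * (C * ‖l - m‖)) := by
        have : 0 ≤ rank K * (C * ‖l - m‖) := by positivity
        nlinarith
    _ = _ := by ring

/-- admissible points: prescribed signs and nonzero norm -/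
def Good (σ : {w : InfinitePlace K // IsReal w} → SignType) (v : mixedSpace K) : Prop :=
  (∀ w, SignType.sign (v.1 w) = σ w) ∧ mixedEmbedding.norm v ≠ 0

/-- the weight function on the mixed space -/
noncomputable def Gw (ε : ℝ) (σ : {w : InfinitePlace K // IsReal w} → SignType) (v : mixedSpace K) : ℝ :=
  if Good σ v then Hw ε (ell K v) else 0

theorem Gw_nonneg (ε : ℝ) (σ) (v : mixedSpace K) : 0 ≤ Gw ε σ v := by
  unfold Gw; split_ifs
  · exact mul_nonneg (psiL_nonneg _) (wcut_nonneg _ _)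
  · exact le_rfl
theorem Gw_le_one (ε : ℝ) (σ) (v : mixedSpace K) : Gw ε σ v ≤ 1 := by
  unfold Gw; split_ifs
  · exact mul_le_one₀ (psiL_le_one _) (wcut_nonneg _ _) (wcut_le_one _ _)
  · exact zero_le_one

theorem normAtPlace_le_norm (w : InfinitePlace K) (v : mixedSpace K) : normAtPlace w v ≤ ‖v‖ := by
  rw [norm_eq_sup'_normAtPlace]
  exact Finset.le_sup' (fun w => normAtPlace w v) (Finset.mem_univ w)

theorem norm_le_of_normAtPlace (v : mixedSpace K) (C : ℝ) (h : ∀ w, normAtPlace w v ≤ C) : ‖v‖ ≤ C := by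
  rw [norm_eq_sup'_normAtPlace]
  exact Finset.sup'_le _ _ (fun w _ => h w)

variable (K) in
/-- bounds on the support of the cone function -/
theorem cone_bound : ∃ C : ℝ, 0 ≤ C ∧ ∀ v : mixedSpace K, mixedEmbedding.norm v ≠ 0 → psiL (ell K v) ≠ 0 → ∀ w,
    |Real.log (normAtPlace w v) - Real.log (mixedEmbedding.norm v) / finrank ℚ K| ≤ C := by
  obtain ⟨C, hC, h⟩ := T_bound K
  refine ⟨C, hC, fun v hv hp w => ?_⟩
  have := h (ell K v) (psiL_ne_zero hp) w
  rwa [sL_ell v hv] at this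

variable (K) in
theorem Gw_supp : ∃ C : ℝ, 1 ≤ C ∧ ∀ ε : ℝ, 0 < ε → ε ≤ 1 → ∀ σ, ∀ v : mixedSpace K, Gw ε σ v ≠ 0 →
    ‖v‖ ≤ C ∧ ∀ w, C⁻¹ * ε ≤ normAtPlace w v := by
  obtain ⟨C, hC, h⟩ := cone_bound K
  have hn : (1:ℝ) ≤ (finrank ℚ K : ℝ) := by exact_mod_cast finrank_pos
  refine ⟨Real.exp (C + 1), Real.one_le_exp (by linarith), fun ε h0 h1 σ v hv => ?_⟩
  have hg : Good σ v := by
    by_contra hg; exact hv (if_neg hg)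
  have hH : Hw ε (ell K v) ≠ 0 := by
    rwa [Gw, if_pos hg] at hv
  have h2 := wcut_ne_zero h0 (right_ne_zero_of_mul hH)
  rw [sL_ell v hg.2] at h2
  have h3 := h v hg.2 (left_ne_zero_of_mul hH)
  have hlog : Real.log ε ≤ 0 := Real.log_nonpos h0.le h1
  have hpos : ∀ w, 0 < normAtPlace w v := fun w =>
    lt_of_le_of_ne (normAtPlace_nonneg w v) (Ne.symm (mixedEmbedding.norm_ne_zero_iff.1 hg.2 w))
  have h4 : Real.log (mixedEmbedding.norm v) / finrank ℚ K ≤ 1 := by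
    rw [div_le_one (by linarith)]; linarith
  have h5 : Real.log ε ≤ Real.log (mixedEmbedding.norm v) / finrank ℚ K := by
    rw [le_div_iff₀ (by linarith)]; nlinarith
  constructor
  · refine norm_le_of_normAtPlace _ _ (fun w => ?_)
    rw [← Real.log_le_iff_le_exp (hpos w)]
    linarith [(abs_le.1 (h3 w)).2]
  · intro w
    rw [← Real.exp_neg]
    have : Real.exp (-(C+1)) * ε = Real.exp (-(C+1) + Real.log ε) := by rw [Real.exp_add, Real.exp_log h0]
    rw [this, ← Real.le_log_iff_exp_le (hpos w)]
    linarith [(abs_le.1 (h3 w)).1]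

theorem log_sub_le {a b c r : ℝ} (hc : 0 < c) (ha : c ≤ a) (hb : c ≤ b) (h : |a - b| ≤ r) :
    |Real.log a - Real.log b| ≤ r / c := by
  have key : ∀ a b : ℝ, c ≤ a → c ≤ b → |a - b| ≤ r → Real.log a - Real.log b ≤ r / c := by
    intro a b ha hb h
    have hb0 : 0 < b := lt_of_lt_of_le hc hb
    have ha0 : 0 < a := lt_of_lt_of_le hc ha
    have hr : 0 ≤ r := (abs_nonneg _).trans h
    rw [← Real.log_div ha0.ne' hb0.ne']
    refine (Real.log_le_sub_one_of_pos (by positivity)).trans ?_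
    calc a / b - 1 = (a - b) / b := by field_simp
      _ ≤ r / b := by gcongr; exact (le_abs_self _).trans h
      _ ≤ r / c := by gcongr
  rw [abs_le]
  have h1 := key a b ha hb h
  have h2 := key b a hb ha (by rwa [abs_sub_comm])
  constructor <;> linarith

theorem abs_normAtPlace_sub (w : InfinitePlace K) (v v' : mixedSpace K) :
    |normAtPlace w v - normAtPlace w v'| ≤ ‖v - v'‖ := by
  have key : ∀ v v' : mixedSpace K, normAtPlace w v - normAtPlace w v' ≤ ‖v - v'‖ := by
    intro v v'
    have h := normAtPlace_add_le w (v - v') v'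
    rw [sub_add_cancel] at h
    linarith [normAtPlace_le_norm w (v - v')]
  rw [abs_le]
  have := key v' v
  rw [norm_sub_rev] at this
  constructor <;> linarith [key v v']

variable (K) in
theorem Gw_lip : ∃ C : ℝ, 0 ≤ C ∧ ∀ ε : ℝ, 0 < ε → ε ≤ 1 → ∀ σ, ∀ v v' : mixedSpace K,
    |Gw ε σ v - Gw ε σ v'| ≤ C * (ε⁻¹) ^ 2 * ‖v - v'‖ := by
  obtain ⟨C₁, hC₁, hsupp⟩ := Gw_supp K
  obtain ⟨C₂, hC₂, hlip⟩ := Hw_lip K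
  refine ⟨2 * C₁ * (C₂ + 1), by positivity, ?_⟩
  have key : ∀ ε : ℝ, 0 < ε → ε ≤ 1 → ∀ σ, ∀ v v' : mixedSpace K, Gw ε σ v ≠ 0 → 
    |Gw ε σ v - Gw ε σ v'| ≤ 2 * C₁ * (C₂ + 1) * (ε⁻¹) ^ 2 * ‖v - v'‖ := by
    intro ε h0 h1 σ v v' hv
    have hε : 1 ≤ ε⁻¹ := (one_le_inv₀ h0).2 h1
    set c : ℝ := C₁⁻¹ * ε with hc
    have hc0 : 0 < c := by positivity
    have hlow := (hsupp ε h0 h1 σ v hv).2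
    have hg : Good σ v := by
      by_contra hg; exact hv (if_neg hg)
    have e : (2 / c) = 2 * C₁ * ε⁻¹ := by rw [hc]; field_simp
    by_cases hr : ‖v - v'‖ < c / 2
    · have hlow' : ∀ w, c / 2 ≤ normAtPlace w v' := by
        intro w
        have := (abs_le.1 (abs_normAtPlace_sub w v v')).2
        linarith [hlow w]
      have hg' : Good σ v' := by
        constructor
        · intro w
          rw [← hg.1 w]
          have e1 : |v.1 w - v'.1 w| ≤ ‖v - v'‖ := 
            (norm_le_pi_norm (v - v').1 w).trans (norm_fst_le _)
          have e2 : c ≤ |v.1 w| := by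
            have := hlow w.1
            rwa [normAtPlace_apply_of_isReal w.2] at this
          rcases le_abs.1 e2 with h | h
          · rw [sign_pos (by linarith : 0 < v.1 w), sign_pos]
            linarith [(abs_le.1 e1).2]
          · rw [sign_neg (by linarith : v.1 w < 0), sign_neg]
            linarith [(abs_le.1 e1).1]
        · rw [mixedEmbedding.norm_ne_zero_iff]
          intro w
          have := hlow' w
          linarith
      rw [Gw, Gw, if_pos hg, if_pos hg']
      refine (hlip ε h0 h1 _ _).trans ?_
      have : ‖ell K v - ell K v'‖ ≤ ‖v - v'‖ / (c / 2) := by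
        rw [pi_norm_le_iff_of_nonneg (by positivity)]
        intro w
        exact log_sub_le (by positivity) (by linarith [hlow w]) (hlow' w) (abs_normAtPlace_sub w v v')
      calc C₂ * ε⁻¹ * ‖ell K v - ell K v'‖ ≤ C₂ * ε⁻¹ * (‖v - v'‖ / (c / 2)) := by gcongr
        _ = C₂ * ε⁻¹ * ((2 / c) * ‖v - v'‖) := by field_simp
        _ = 2 * C₁ * C₂ * (ε⁻¹) ^ 2 * ‖v - v'‖ := by rw [e]; ring
        _ ≤ _ := by gcongr; linarith
    · have h2 : |Gw ε σ v - Gw ε σ v'| ≤ 1 := by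
        rw [abs_le]
        constructor <;> linarith [Gw_nonneg ε σ v, Gw_nonneg ε σ v', Gw_le_one ε σ v, Gw_le_one ε σ v']
      refine h2.trans ?_
      have h3 : 1 ≤ (2 / c) * ‖v - v'‖ := by
        rw [div_mul_eq_mul_div, le_div_iff₀ hc0]; linarith
      rw [e] at h3
      calc (1:ℝ) ≤ 2 * C₁ * ε⁻¹ * ‖v - v'‖ := h3
        _ = (2 * C₁ * ‖v - v'‖) * (1 * ε⁻¹) := by ring
        _ ≤ (2 * C₁ * ‖v - v'‖) * ((C₂ + 1) * (ε⁻¹ ^ 2)) := by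
          gcongr
          · linarith
          · nlinarith
        _ = _ := by ring
  intro ε h0 h1 σ v v'
  by_cases hv : Gw ε σ v = 0
  · by_cases hv' : Gw ε σ v' = 0
    · rw [hv, hv']; simp; positivity
    · rw [abs_sub_comm, norm_sub_rev]; exact key ε h0 h1 σ v' v hv'
  · exact key ε h0 h1 σ v v' hv

end cone
end BT


namespace BT
section cone
open NumberField NumberField.mixedEmbedding NumberField.InfinitePlace NumberField.Units
  NumberField.Units.dirichletUnitTheorem Module MeasureTheory
open scoped Classical

variable {K : Type*} [Field K] [NumberField K]

/-- the sharp cut-off weight -/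
noncomputable def Gs (Y : ℝ) (σ : {w : InfinitePlace K // IsReal w} → SignType) (v : mixedSpace K) : ℝ :=
  if Good σ v ∧ mixedEmbedding.norm v ≤ Y then psiL (ell K v) else 0

theorem Gs_nonneg (Y : ℝ) (σ) (v : mixedSpace K) : 0 ≤ Gs Y σ v := by
  unfold Gs; split_ifs
  · exact psiL_nonneg _
  · exact le_rfl
theorem Gs_le_one (Y : ℝ) (σ) (v : mixedSpace K) : Gs Y σ v ≤ 1 := by
  unfold Gs; split_ifs
  · exact psiL_le_one _
  · exact zero_le_one

variable (K) in
theorem Gs_supp : ∃ C : ℝ, 1 ≤ C ∧ ∀ Y : ℝ, 0 < Y → ∀ σ, ∀ v : mixedSpace K, Gs Y σ v ≠ 0 →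
    ‖v‖ ≤ C * Y ^ ((finrank ℚ K : ℝ)⁻¹) := by
  obtain ⟨C, hC, h⟩ := cone_bound K
  have hn : (1:ℝ) ≤ (finrank ℚ K : ℝ) := by exact_mod_cast finrank_pos
  refine ⟨Real.exp C, Real.one_le_exp (by linarith), fun Y hY σ v hv => ?_⟩
  have hg : Good σ v ∧ mixedEmbedding.norm v ≤ Y := by
    by_contra hg; exact hv (if_neg hg)
  rw [Gs, if_pos hg] at hv
  have h3 := h v hg.1.2 hv
  have hpos : ∀ w, 0 < normAtPlace w v := fun w =>
    lt_of_le_of_ne (normAtPlace_nonneg w v) (Ne.symm (mixedEmbedding.norm_ne_zero_iff.1 hg.1.2 w))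
  have hNpos : 0 < mixedEmbedding.norm v := lt_of_le_of_ne (mixedEmbedding.norm_nonneg v) (Ne.symm hg.1.2)
  refine norm_le_of_normAtPlace _ _ (fun w => ?_)
  rw [Real.rpow_def_of_pos hY, ← Real.exp_add, ← Real.log_le_iff_le_exp (hpos w)]
  have h4 : Real.log (mixedEmbedding.norm v) / finrank ℚ K ≤ Real.log Y * (finrank ℚ K : ℝ)⁻¹ := by
    rw [div_eq_mul_inv]
    gcongr
    exact hg.2
  linarith [(abs_le.1 (h3 w)).2]

theorem measurable_ell : Measurable (ell K) := by
  refine measurable_pi_lambda _ (fun w => ?_)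
  exact Real.measurable_log.comp (continuous_normAtPlace w).measurable

theorem measurable_psi : Measurable (fun v : mixedSpace K => psiL (ell K v)) := by
  unfold psiL
  refine Finset.measurable_prod _ (fun i _ => ?_)
  have h1 : Continuous (fun l : InfinitePlace K → ℝ => tau (Tl K l i)) := by
    have : Continuous (Tl K) := LinearMap.continuous_of_finiteDimensional _
    unfold tau
    fun_prop
  exact h1.measurable.comp measurable_ell

theorem measurableSet_good (σ) : MeasurableSet {v : mixedSpace K | Good σ v} := by
  have hs : ∀ s : SignType, MeasurableSet {x : ℝ | SignType.sign x = s} := by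
    intro s
    cases s with
    | zero => exact (measurableSet_singleton (0:ℝ)).congr (by ext x; exact (sign_eq_zero_iff (a := x)).symm)
    | neg => exact (measurableSet_Iio (a := (0:ℝ))).congr (by ext x; exact (sign_eq_neg_one_iff (a := x)).symm)
    | pos => exact (measurableSet_Ioi (a := (0:ℝ))).congr (by ext x; exact (sign_eq_one_iff (a := x)).symm)
  have h1 : MeasurableSet {v : mixedSpace K | ∀ w, SignType.sign (v.1 w) = σ w} := by
    rw [Set.ofPred_forall]
    refine MeasurableSet.iInter (fun w => ?_)
    have : Measurable (fun v : mixedSpace K => v.1 w) := (measurable_pi_apply w).comp measurable_fst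
    exact this (hs (σ w))
  have h2 : MeasurableSet {v : mixedSpace K | mixedEmbedding.norm v ≠ 0} :=
    ((mixedEmbedding.continuous_norm K).measurable (measurableSet_singleton 0)).compl
  exact h1.inter h2

theorem measurable_Gs (Y : ℝ) (σ) : Measurable (Gs (K := K) Y σ) := by
  unfold Gs
  refine Measurable.ite ?_ measurable_psi measurable_const
  exact (measurableSet_good σ).inter ((mixedEmbedding.continuous_norm K).measurable measurableSet_Iic)

theorem integrable_Gs (Y : ℝ) (hY : 0 < Y) (σ) : Integrable (Gs (K := K) Y σ) := by
  obtain ⟨C, hC, h⟩ := Gs_supp K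
  have : IntegrableOn (Gs (K := K) Y σ) (Metric.closedBall 0 (C * Y ^ ((finrank ℚ K : ℝ)⁻¹))) := by
    refine Measure.integrableOn_of_bounded (M := 1) ?_ (measurable_Gs Y σ).aestronglyMeasurable ?_
    · exact (Metric.isBounded_closedBall.measure_lt_top).ne
    · refine Filter.Eventually.of_forall (fun v => ?_)
      rw [Real.norm_of_nonneg (Gs_nonneg _ _ _)]
      exact Gs_le_one _ _ _
  refine (integrableOn_iff_integrable_of_support_subset ?_).1 this
  intro v hv
  simpa using h Y hY σ v hv

theorem good_smul (σ) {c : ℝ} (hc : 0 < c) (v : mixedSpace K) : Good σ (c • v) ↔ Good σ v := by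
  unfold Good
  refine and_congr (forall_congr' fun w => ?_) ?_
  · have : (c • v).1 w = c * v.1 w := rfl
    rw [this, sign_mul, sign_pos hc, one_mul]
  · rw [mixedEmbedding.norm_smul]
    simp [hc.ne']

theorem psi_smul {c : ℝ} (hc : 0 < c) (v : mixedSpace K) (hv : mixedEmbedding.norm v ≠ 0) :
    psiL (ell K (c • v)) = psiL (ell K v) := by
  have hv' : mixedEmbedding.norm (c • v) ≠ 0 := by
    rw [mixedEmbedding.norm_smul]; simp [hc.ne', hv]
  unfold psiL
  rw [Tl_ell v hv, Tl_ell _ hv', logMap_real_smul hv hc.ne']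

theorem Gs_smul (σ) {c : ℝ} (hc : 0 < c) (v : mixedSpace K) :
    Gs (c ^ finrank ℚ K) σ (c • v) = Gs 1 σ v := by
  unfold Gs
  have e : (Good σ (c • v) ∧ mixedEmbedding.norm (c • v) ≤ c ^ finrank ℚ K) ↔ (Good σ v ∧ mixedEmbedding.norm v ≤ 1) := by
    rw [good_smul σ hc, mixedEmbedding.norm_smul, abs_of_pos hc]
    have : 0 < c ^ finrank ℚ K := by positivity
    rw [mul_le_iff_le_one_right this]
  by_cases h : Good σ v ∧ mixedEmbedding.norm v ≤ 1
  · rw [if_pos h, if_pos (e.2 h), psi_smul hc v h.1.2]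
  · rw [if_neg h, if_neg (fun h' => h (e.1 h'))]

theorem integral_Gs (Y : ℝ) (hY : 0 < Y) (σ) : ∫ v, Gs (K := K) Y σ v = Y * ∫ v, Gs (K := K) 1 σ v := by
  set c := Y ^ ((finrank ℚ K : ℝ)⁻¹) with hc
  have hc0 : 0 < c := by positivity
  have hcn : c ^ finrank ℚ K = Y := Real.rpow_inv_natCast_pow hY.le finrank_pos.ne'
  have h := Measure.integral_comp_smul (volume : Measure (mixedSpace K)) (Gs Y σ) c
  rw [mixedEmbedding.finrank, hcn] at h
  have h2 : ∀ v : mixedSpace K, Gs Y σ (c • v) = Gs 1 σ v := fun v => by rw [← hcn]; exact Gs_smul σ hc0 v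
  simp_rw [h2] at h
  rw [h, smul_eq_mul, abs_of_pos (by positivity), mul_inv_cancel_left₀ hY.ne']

theorem good_negAt (σ : {w : InfinitePlace K // IsReal w} → SignType) (hσ : ∀ w, σ w ≠ 0) (v : mixedSpace K) :
    Good 1 (negAt {w | σ w = -1} v) ↔ Good σ v := by
  unfold Good
  rw [mixedEmbedding.norm_negAt]
  refine and_congr (forall_congr' fun w => ?_) Iff.rfl
  by_cases hw : σ w = -1
  · rw [negAt_apply_isReal_and_mem v (s := {w | σ w = -1}) hw, hw, Left.sign_neg]
    simp only [Pi.one_apply]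
    generalize SignType.sign (v.1 w) = s
    revert s; decide
  · rw [negAt_apply_isReal_and_notMem v (s := {w | σ w = -1}) hw]
    have : σ w = 1 := by
      have := hσ w
      revert this hw
      generalize σ w = s
      revert s; decide
    rw [this]; rfl

theorem ell_negAt (s) (v : mixedSpace K) : ell K (negAt s v) = ell K v := by
  ext w; simp [ell]

theorem integral_negAt (s) (f : mixedSpace K → ℝ) : ∫ v, f (negAt s v) = ∫ v, f v :=
  (volume_preserving_negAt (s := s)).integral_comp (negAt s).toHomeomorph.measurableEmbedding f

theorem integral_Gs_sign (Y : ℝ) (σ) (hσ : ∀ w, σ w ≠ 0) : ∫ v, Gs (K := K) Y σ v = ∫ v, Gs (K := K) Y 1 v := by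
  symm
  rw [← integral_negAt {w | σ w = -1}]
  congr 1
  ext v
  unfold Gs
  rw [good_negAt σ hσ, ell_negAt, mixedEmbedding.norm_negAt]

theorem Gw_le_Gs {ε : ℝ} (h0 : 0 < ε) (σ) (v : mixedSpace K) : Gw ε σ v ≤ Gs (Real.exp ε) σ v := by
  by_cases hv : Gw ε σ v = 0
  · rw [hv]; exact Gs_nonneg _ _ _
  have hg : Good σ v := by
    by_contra hg; exact hv (if_neg hg)
  have hH : Hw ε (ell K v) ≠ 0 := by
    rwa [Gw, if_pos hg] at hv
  have h2 := wcut_ne_zero h0 (right_ne_zero_of_mul hH)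
  rw [sL_ell v hg.2] at h2
  have hNpos : 0 < mixedEmbedding.norm v := lt_of_le_of_ne (mixedEmbedding.norm_nonneg v) (Ne.symm hg.2)
  have : Good σ v ∧ mixedEmbedding.norm v ≤ Real.exp ε := ⟨hg, by
    rw [← Real.log_le_iff_le_exp hNpos]; exact h2.2.le⟩
  rw [Gw, Gs, if_pos hg, if_pos this, Hw]
  exact mul_le_of_le_one_right (psiL_nonneg _) (wcut_le_one _ _)

theorem Gs_sub_le_Gw {ε : ℝ} (h0 : 0 < ε) (σ) (v : mixedSpace K) :
    Gs 1 σ v - Gs (Real.exp 1 * ε) σ v ≤ Gw ε σ v := by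
  by_cases hg : Good σ v
  · have hNpos : 0 < mixedEmbedding.norm v := lt_of_le_of_ne (mixedEmbedding.norm_nonneg v) (Ne.symm hg.2)
    by_cases h1 : mixedEmbedding.norm v ≤ 1
    · by_cases h2 : mixedEmbedding.norm v ≤ Real.exp 1 * ε
      · rw [Gs, Gs, if_pos ⟨hg, h1⟩, if_pos ⟨hg, h2⟩, sub_self]; exact Gw_nonneg _ _ _
      · rw [Gs, Gs, if_pos ⟨hg, h1⟩, if_neg (fun h => h2 h.2), Gw, if_pos hg, Hw, sL_ell v hg.2, wcut_eq_one h0, mul_one, sub_zero]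
        · have := Real.log_le_log (by positivity) (not_le.1 h2).le
          rw [Real.log_mul (by positivity) h0.ne', Real.log_exp] at this
          linarith
        · exact Real.log_nonpos hNpos.le h1
    · have : Gs 1 σ v = 0 := if_neg (fun h => h1 h.2)
      rw [this]; linarith [Gs_nonneg (Real.exp 1 * ε) σ v, Gw_nonneg ε σ v]
  · have : Gs 1 σ v = 0 := if_neg (fun h => hg h.1)
    rw [this]; linarith [Gs_nonneg (Real.exp 1 * ε) σ v, Gw_nonneg ε σ v]

theorem continuous_Gw {ε : ℝ} (h0 : 0 < ε) (h1 : ε ≤ 1) (σ) : Continuous (Gw (K := K) ε σ) := by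
  obtain ⟨C, hC, h⟩ := Gw_lip K
  have : LipschitzWith ⟨C * (ε⁻¹)^2, by positivity⟩ (Gw (K := K) ε σ) := LipschitzWith.of_dist_le_mul (fun v w => by
      rw [Real.dist_eq, dist_eq_norm]; exact h ε h0 h1 σ v w)
  exact this.continuous

theorem compact_Gw {ε : ℝ} (h0 : 0 < ε) (h1 : ε ≤ 1) (σ) : HasCompactSupport (Gw (K := K) ε σ) := by
  obtain ⟨C, hC, h⟩ := Gw_supp K
  refine HasCompactSupport.of_support_subset_isCompact (isCompact_closedBall (0:mixedSpace K) C) ?_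
  intro v hv
  simpa using (h ε h0 h1 σ v hv).1

theorem integrable_Gw {ε : ℝ} (h0 : 0 < ε) (h1 : ε ≤ 1) (σ) : Integrable (Gw (K := K) ε σ) :=
  (continuous_Gw h0 h1 σ).integrable_of_hasCompactSupport (compact_Gw h0 h1 σ)

variable (K) in
/-- the cone volume -/
noncomputable def Jv : ℝ := ∫ v, Gs (K := K) 1 1 v

variable (K) in
theorem Jv_pos : 0 < Jv K := by
  have hlog : Real.log (1/2) < 0 := Real.log_neg (by norm_num) (by norm_num)
  have h1 : 0 < ∫ v, Gw (K := K) (1/2) 1 v := by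
    refine (continuous_Gw (by norm_num) (by norm_num) 1).integral_pos_of_hasCompactSupport_nonneg_nonzero
      (compact_Gw (by norm_num) (by norm_num) 1) (fun v => Gw_nonneg _ _ _) (x := 1) ?_
    have hg : Good 1 (1 : mixedSpace K) := by
      constructor
      · intro w; simp
      · simp
    have hl : ell K 1 = 0 := by ext w; simp [ell]
    rw [Gw, if_pos hg, Hw, hl, psiL]
    simp only [map_zero, Pi.zero_apply, tau_zero, Finset.prod_const_one, one_mul]
    unfold wcut
    have : 0 < min 1 (min (0 - Real.log (1/2)) ((1/2 - 0) / (1/2))) := by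
      refine lt_min one_pos (lt_min (by linarith) (by norm_num))
    rw [max_eq_right this.le]
    exact this.ne'
  have h2 : ∫ v, Gw (K := K) (1/2) 1 v ≤ ∫ v, Gs (K := K) (Real.exp (1/2)) 1 v :=
    integral_mono (integrable_Gw (by norm_num) (by norm_num) 1) (integrable_Gs _ (by positivity) 1) (Gw_le_Gs (by norm_num) 1)
  rw [integral_Gs _ (by positivity)] at h2
  have h3 : 0 < Real.exp (1/2) * Jv K := lt_of_lt_of_le h1 h2
  exact pos_of_mul_pos_right h3 (by positivity)

theorem integral_Gw_bounds {ε : ℝ} (h0 : 0 < ε) (h1 : ε ≤ 1) (σ) (hσ : ∀ w, σ w ≠ 0) :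
    (1 - 3 * ε) * Jv K ≤ ∫ v, Gw (K := K) ε σ v ∧ ∫ v, Gw (K := K) ε σ v ≤ (1 + 2 * ε) * Jv K := by
  have hJ := Jv_pos K
  constructor
  · have h2 : ∫ v, (Gs (K := K) 1 σ v - Gs (K := K) (Real.exp 1 * ε) σ v) ≤ ∫ v, Gw (K := K) ε σ v :=
      integral_mono ((integrable_Gs _ one_pos σ).sub (integrable_Gs _ (by positivity) σ)) (integrable_Gw h0 h1 σ) (Gs_sub_le_Gw h0 σ)
    rw [integral_sub (integrable_Gs _ one_pos σ) (integrable_Gs _ (by positivity) σ), integral_Gs (Real.exp 1 * ε) (by positivity),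
      integral_Gs_sign 1 σ hσ] at h2
    change Jv K - (Real.exp 1 * ε) * Jv K ≤ _ at h2
    have h3 : Real.exp 1 ≤ 3 := by linarith [Real.exp_one_lt_d9]
    have h4 : Real.exp 1 * ε * Jv K ≤ 3 * ε * Jv K := by gcongr
    linarith
  · have h2 : ∫ v, Gw (K := K) ε σ v ≤ ∫ v, Gs (K := K) (Real.exp ε) σ v :=
      integral_mono (integrable_Gw h0 h1 σ) (integrable_Gs _ (by positivity) σ) (Gw_le_Gs h0 σ)
    rw [integral_Gs (Real.exp ε) (by positivity), integral_Gs_sign 1 σ hσ] at h2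
    refine h2.trans ?_
    have h3 := (abs_le.1 (Real.abs_exp_sub_one_sub_id_le (x := ε) (by rw [abs_of_pos h0]; exact h1))).2
    have h4 : Real.exp ε ≤ 1 + 2 * ε := by nlinarith
    change Real.exp ε * Jv K ≤ _
    gcongr

/-- exact independence of the smooth integral of signs -/
theorem integral_Gw_sign (ε : ℝ) (σ) (hσ : ∀ w, σ w ≠ 0) : ∫ v, Gw (K := K) ε σ v = ∫ v, Gw (K := K) ε 1 v := by
  symm
  rw [← integral_negAt {w | σ w = -1}]
  congr 1
  ext v
  unfold Gw
  rw [good_negAt σ hσ, ell_negAt]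

end cone
end BT


namespace BT
section core
open NumberField NumberField.mixedEmbedding NumberField.InfinitePlace NumberField.Units
  NumberField.Units.dirichletUnitTheorem Module MeasureTheory
open scoped Classical nonZeroDivisors

variable {K : Type*} [Field K] [NumberField K]

/-- fractional ideal unit attached to a nonzero ideal -/
noncomputable def fr (b : Ideal (𝓞 K)) (hb : b ≠ ⊥) : (FractionalIdeal (𝓞 K)⁰ K)ˣ :=
  FractionalIdeal.mk0 K ⟨b, mem_nonZeroDivisors_of_ne_zero hb⟩

theorem mem_fr (b : Ideal (𝓞 K)) (hb : b ≠ ⊥) (x : mixedSpace K) :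
    x ∈ idealLattice K (fr b hb) ↔ ∃ β ∈ b, mixedEmbedding K (β : K) = x := by
  rw [mem_idealLattice]
  simp only [fr, FractionalIdeal.coe_mk0]
  constructor
  · rintro ⟨y, hy, rfl⟩
    obtain ⟨β, hβ, rfl⟩ := (FractionalIdeal.mem_coeIdeal (𝓞 K)⁰).1 hy
    exact ⟨β, hβ, rfl⟩
  · rintro ⟨β, hβ, rfl⟩
    exact ⟨β, (FractionalIdeal.mem_coeIdeal (𝓞 K)⁰).2 ⟨β, hβ, rfl⟩, rfl⟩

variable (K) in
/-- covolume of the ring of integers -/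
noncomputable def V0 : ℝ := (volume (ZSpan.fundamentalDomain (latticeBasis K))).toReal

variable (K) in
theorem V0_pos : 0 < V0 K := by
  refine ENNReal.toReal_pos (ZSpan.measure_fundamentalDomain_ne_zero _) ?_
  exact (ZSpan.fundamentalDomain_isBounded _).measure_lt_top.ne

theorem absNorm_pos {b : Ideal (𝓞 K)} (hb : b ≠ ⊥) : (1:ℝ) ≤ Ideal.absNorm b := by
  have : Ideal.absNorm b ≠ 0 := by rwa [Ne, Ideal.absNorm_eq_zero_iff]
  exact_mod_cast Nat.one_le_iff_ne_zero.2 this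

theorem vol_fr (b : Ideal (𝓞 K)) (hb : b ≠ ⊥) :
    (volume : Measure (mixedSpace K)).real (ZSpan.fundamentalDomain (fractionalIdealLatticeBasis K (fr b hb))) = Ideal.absNorm b * V0 K := by
  rw [measureReal_def, volume_fundamentalDomain_fractionalIdealLatticeBasis, ENNReal.toReal_mul, ENNReal.toReal_ofReal, V0]
  · congr 1
    simp [fr, FractionalIdeal.coeIdeal_absNorm]
  · simp only [fr, FractionalIdeal.coe_mk0, FractionalIdeal.coeIdeal_absNorm]; positivity

theorem norm_le_pow (v : mixedSpace K) : mixedEmbedding.norm v ≤ ‖v‖ ^ finrank ℚ K := by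
  rw [mixedEmbedding.norm_apply]
  calc ∏ w, normAtPlace w v ^ mult w ≤ ∏ w : InfinitePlace K, ‖v‖ ^ mult w := by
        refine Finset.prod_le_prod (fun w _ => pow_nonneg (normAtPlace_nonneg _ _) _) (fun w _ => ?_)
        exact pow_le_pow_left₀ (normAtPlace_nonneg _ _) (normAtPlace_le_norm w v) _
    _ = _ := by rw [Finset.prod_pow_eq_pow_sum, sum_mult_eq]

theorem norm_int (β : 𝓞 K) : mixedEmbedding.norm (mixedEmbedding K (β : K)) = Ideal.absNorm (Ideal.span {β}) := by
  rw [mixedEmbedding.norm_eq_norm, Ideal.absNorm_span_singleton]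
  rw [← Algebra.coe_norm_int, Nat.cast_natAbs]
  push_cast
  rfl

theorem sep_fr (b : Ideal (𝓞 K)) (hb : b ≠ ⊥) : ∀ l ∈ idealLattice K (fr b hb), l ≠ 0 →
    (Ideal.absNorm b : ℝ) ^ ((finrank ℚ K : ℝ)⁻¹) ≤ ‖l‖ := by
  intro l hl hl0
  obtain ⟨β, hβ, rfl⟩ := (mem_fr b hb l).1 hl
  have hβ0 : β ≠ 0 := by rintro rfl; simp at hl0
  have h1 : (Ideal.absNorm b : ℝ) ≤ Ideal.absNorm (Ideal.span {β}) := by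
    have : Ideal.absNorm b ∣ Ideal.absNorm (Ideal.span {β}) :=
      Ideal.absNorm_dvd_absNorm_of_le ((Ideal.span_singleton_le_iff_mem _).2 hβ)
    have h0 : Ideal.absNorm (Ideal.span {β}) ≠ 0 := by
      rw [Ne, Ideal.absNorm_eq_zero_iff, Ideal.span_singleton_eq_bot]; exact hβ0
    exact_mod_cast Nat.le_of_dvd (Nat.pos_of_ne_zero h0) this
  rw [← norm_int] at h1
  have h2 := h1.trans (norm_le_pow _)
  have hn : (0:ℝ) < (finrank ℚ K : ℝ) := by exact_mod_cast finrank_pos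
  rw [← Real.rpow_natCast] at h2
  exact (Real.rpow_inv_le_iff_of_pos (by positivity) (_root_.norm_nonneg _) hn).2 h2

variable (K) in
theorem cov_fr : ∃ C : ℝ, 0 < C ∧ ∀ (b : Ideal (𝓞 K)) (hb : b ≠ ⊥), ∀ y : mixedSpace K,
    ∃ l ∈ idealLattice K (fr b hb), ‖y - l‖ ≤ C * (Ideal.absNorm b : ℝ) ^ ((finrank ℚ K : ℝ)⁻¹) := by
  have hV := V0_pos K
  set M : ℝ := ∑ i, ‖latticeBasis K i‖ with hM
  have hM0 : 0 ≤ M := Finset.sum_nonneg (fun _ _ => _root_.norm_nonneg _)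
  refine ⟨2 * (V0 K + 1) * (M + 1), by positivity, fun b hb y => ?_⟩
  set t : ℝ := 2 * (V0 K + 1) * (Ideal.absNorm b : ℝ) ^ ((finrank ℚ K : ℝ)⁻¹) with ht
  have hN := absNorm_pos hb
  have ht0 : 0 ≤ t := by positivity
  have htn : t ^ finrank ℚ K = 2 ^ finrank ℚ K * (V0 K + 1) ^ finrank ℚ K * Ideal.absNorm b := by
    rw [ht, mul_pow, mul_pow, Real.rpow_inv_natCast_pow (by positivity) finrank_pos.ne']
  have hmink : minkowskiBound K (fr b hb) < volume (convexBodyLT K (fun _ => (NNReal.mk t ht0))) := by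
    rw [convexBodyLT_volume, minkowskiBound, volume_fundamentalDomain_fractionalIdealLatticeBasis]
    have e1 : (FractionalIdeal.absNorm ((fr b hb : (FractionalIdeal (𝓞 K)⁰ K)ˣ) : FractionalIdeal (𝓞 K)⁰ K) : ℝ) = Ideal.absNorm b := by
      simp [fr, FractionalIdeal.coeIdeal_absNorm]
    rw [e1, mixedEmbedding.finrank]
    have e2 : volume (ZSpan.fundamentalDomain (latticeBasis K)) = ENNReal.ofReal (V0 K) := by
      rw [V0, ENNReal.ofReal_toReal]
      exact (ZSpan.fundamentalDomain_isBounded _).measure_lt_top.ne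
    rw [e2]
    have e3 : ((∏ w : InfinitePlace K, (NNReal.mk t ht0) ^ mult w : NNReal) : ENNReal) = ENNReal.ofReal (t ^ finrank ℚ K) := by
      rw [Finset.prod_pow_eq_pow_sum, sum_mult_eq, ENNReal.ofReal_pow ht0]
      push_cast
      congr 1
      rw [ENNReal.ofReal, Real.toNNReal_of_nonneg ht0]
    have e4 : (1 : ENNReal) ≤ (convexBodyLTFactor K : ENNReal) := by exact_mod_cast one_le_convexBodyLTFactor K
    refine lt_of_lt_of_le ?_ (mul_le_mul_left e4 _)
    rw [one_mul, e3, htn]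
    rw [← ENNReal.ofReal_mul (by positivity), show (2:ENNReal) ^ finrank ℚ K = ENNReal.ofReal (2 ^ finrank ℚ K) by
      rw [ENNReal.ofReal_pow (by norm_num)]; norm_num, ← ENNReal.ofReal_mul (by positivity)]
    rw [ENNReal.ofReal_lt_ofReal_iff (by positivity)]
    have : V0 K < (V0 K + 1) ^ finrank ℚ K := by
      have := le_self_pow₀ (by linarith : 1 ≤ V0 K + 1) (finrank_pos (R := ℚ) (M := K)).ne'
      linarith
    have h2 : (0:ℝ) < 2 ^ finrank ℚ K * Ideal.absNorm b := by positivity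
    nlinarith
  obtain ⟨a, ha, ha0, haw⟩ := exists_ne_zero_mem_ideal_lt K (fr b hb) hmink
  have haw' : ∀ w : InfinitePlace K, w a ≤ t := fun w => (haw w).le
  simp only [fr, FractionalIdeal.coe_mk0] at ha
  obtain ⟨β, hβ, rfl⟩ := (FractionalIdeal.mem_coeIdeal (𝓞 K)⁰).1 ha
  set y' : mixedSpace K := mixedEmbedding K (algebraMap (𝓞 K) K β)⁻¹ * y with hy'
  have hyy : y = mixedEmbedding K (algebraMap (𝓞 K) K β) * y' := by
    rw [hy', ← mul_assoc, ← map_mul, mul_inv_cancel₀ ha0, map_one, one_mul]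
  obtain ⟨o, ho⟩ : ∃ o : 𝓞 K, mixedEmbedding K (o : K) = (ZSpan.floor (latticeBasis K) y' : mixedSpace K) := by
    have h := (ZSpan.floor (latticeBasis K) y').2
    obtain ⟨o, ho⟩ := (mem_span_latticeBasis K).1 h
    exact ⟨o, ho⟩
  have hfr : ‖ZSpan.fract (latticeBasis K) y'‖ ≤ M := ZSpan.norm_fract_le _ _
  rw [ZSpan.fract_apply, ← ho] at hfr
  refine ⟨mixedEmbedding K ((β * o : 𝓞 K) : K), (mem_fr b hb _).2 ⟨β * o, b.mul_mem_right _ hβ, rfl⟩, ?_⟩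
  have e5 : y - mixedEmbedding K ((β * o : 𝓞 K) : K) = mixedEmbedding K (algebraMap (𝓞 K) K β) * (y' - mixedEmbedding K (o : K)) := by
    rw [hyy]
    push_cast
    rw [map_mul, mul_sub]
  rw [e5]
  refine norm_le_of_normAtPlace _ _ (fun w => ?_)
  rw [map_mul, normAtPlace_apply]
  calc w (algebraMap (𝓞 K) K β) * normAtPlace w (y' - mixedEmbedding K (o : K)) ≤ t * (M + 1) := by
        have := (normAtPlace_le_norm w (y' - mixedEmbedding K (o : K))).trans hfr
        have h0 := normAtPlace_nonneg w (y' - mixedEmbedding K (o : K))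
        have := haw' w
        gcongr
        linarith
    _ = _ := by rw [ht]; ring

/-- the ideal as a lattice -/
noncomputable def eqv (b : Ideal (𝓞 K)) (hb : b ≠ ⊥) : b ≃ idealLattice K (fr b hb) :=
  Equiv.ofBijective (fun β => ⟨mixedEmbedding K ((β : 𝓞 K) : K), (mem_fr b hb _).2 ⟨β, β.2, rfl⟩⟩) (by
    constructor
    · intro x y hxy
      have := mixedEmbedding_injective K (Subtype.ext_iff.1 hxy)
      exact Subtype.ext (RingOfIntegers.ext this)
    · rintro ⟨l, hl⟩
      obtain ⟨β, hβ, rfl⟩ := (mem_fr b hb l).1 hl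
      exact ⟨⟨β, hβ⟩, rfl⟩)

theorem eqv_coe (b : Ideal (𝓞 K)) (hb : b ≠ ⊥) (β : b) :
    (eqv b hb β : mixedSpace K) = mixedEmbedding K ((β : 𝓞 K) : K) := rfl

theorem fin_ball (b : Ideal (𝓞 K)) (hb : b ≠ ⊥) (ρ : 𝓞 K) (R : ℝ) (hR : 0 ≤ R) :
    {β : b | ‖mixedEmbedding K ((ρ + β : 𝓞 K) : K)‖ ≤ R}.Finite ∧
    ({β : b | ‖mixedEmbedding K ((ρ + β : 𝓞 K) : K)‖ ≤ R}.ncard : ℝ) ≤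
      (2 * R / ((Ideal.absNorm b : ℝ) ^ ((finrank ℚ K : ℝ)⁻¹)) + 1) ^ finrank ℚ K := by
  have hN := absNorm_pos hb
  obtain ⟨h1, h2⟩ := packing_finite (idealLattice K (fr b hb)) _ (by positivity) (sep_fr b hb) (mixedEmbedding K (ρ : K)) R hR
  have e : {β : b | ‖mixedEmbedding K ((ρ + β : 𝓞 K) : K)‖ ≤ R} = (eqv b hb) ⁻¹' {l | ‖(l : mixedSpace K) + mixedEmbedding K (ρ : K)‖ ≤ R} := by
    ext β
    simp only [Set.mem_preimage, Set.mem_ofPred_eq, eqv_coe]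
    push_cast
    rw [map_add, add_comm]
  rw [e]
  constructor
  · exact h1.preimage (eqv b hb).injective.injOn
  · rw [mixedEmbedding.finrank] at h2
    rw [Set.ncard_preimage_of_injective_subset_range (eqv b hb).injective (by simp)]
    exact h2

variable (K) in
theorem core_smooth : ∃ C : ℝ, 0 ≤ C ∧ ∀ ε : ℝ, 0 < ε → ε ≤ 1 → ∀ σ : {w : InfinitePlace K // IsReal w} → SignType, (∀ w, σ w ≠ 0) →
    ∀ b : Ideal (𝓞 K), b ≠ ⊥ → ∀ Y : ℝ, (Ideal.absNorm b : ℝ) ≤ Y → ∀ ρ : 𝓞 K,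
    |∑' β : b, Gw ε σ ((Y ^ ((finrank ℚ K : ℝ)⁻¹))⁻¹ • mixedEmbedding K ((ρ + β : 𝓞 K) : K)) -
      Y / Ideal.absNorm b * ((∫ v, Gw (K := K) ε 1 v) / V0 K)| ≤
      C * (ε⁻¹) ^ 2 * (Y / Ideal.absNorm b) * (Ideal.absNorm b / Y) ^ ((finrank ℚ K : ℝ)⁻¹) := by
  obtain ⟨C₁, hC₁, hsupp⟩ := Gw_supp K
  obtain ⟨C₂, hC₂, hlip⟩ := Gw_lip K
  obtain ⟨C₃, hC₃, hcov⟩ := cov_fr K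
  have hV := V0_pos K
  refine ⟨C₂ * C₃ * (2 * (C₁ + C₃) + 1) ^ finrank ℚ K, by positivity, ?_⟩
  intro ε h0 h1 σ hσ b hb Y hY ρ
  have hN := absNorm_pos hb
  have hY0 : 0 < Y := by linarith
  set n := finrank ℚ K with hn
  set c : ℝ := Y ^ ((n : ℝ)⁻¹) with hc
  set η : ℝ := (Ideal.absNorm b : ℝ) ^ ((n : ℝ)⁻¹) with hη
  have hc0 : 0 < c := by positivity
  have hη0 : 0 < η := by positivity
  have hηc : η ≤ c := Real.rpow_le_rpow (by positivity) hY (by positivity)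
  have hcn : c ^ n = Y := Real.rpow_inv_natCast_pow hY0.le finrank_pos.ne'
  have hηn : η ^ n = Ideal.absNorm b := Real.rpow_inv_natCast_pow (by positivity) finrank_pos.ne'
  have hratio : (Ideal.absNorm b / Y : ℝ) ^ ((n : ℝ)⁻¹) = η / c := by
    rw [Real.div_rpow (by positivity) hY0.le]
  have key := lattice_riemann (μ := (volume : Measure (mixedSpace K))) (idealLattice K (fr b hb)) _
    (fundamentalDomain_idealLattice K (fr b hb)) (ZSpan.fundamentalDomain_isBounded _) (ZSpan.fundamentalDomain_measurableSet _)
    η (C₃ * η) (C₂ * (ε⁻¹) ^ 2 * c⁻¹) (C₁ * c) hη0 (by positivity) (by positivity) (by positivity)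
    (sep_fr b hb) (hcov b hb) (fun v => Gw ε σ (c⁻¹ • v)) (fun v w => by
      refine (hlip ε h0 h1 σ _ _).trans (le_of_eq ?_)
      rw [← smul_sub, _root_.norm_smul, Real.norm_of_nonneg (by positivity)]; ring) (fun v hv => by
      have := (hsupp ε h0 h1 σ _ hv).1
      rw [_root_.norm_smul, Real.norm_of_nonneg (by positivity), inv_mul_le_iff₀ hc0] at this
      linarith) (mixedEmbedding K (ρ : K))
  rw [vol_fr b hb, mixedEmbedding.finrank, Measure.integral_comp_inv_smul, mixedEmbedding.finrank, ← hn, hcn, abs_of_pos hY0, smul_eq_mul, integral_Gw_sign ε σ hσ] at key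
  rw [← (eqv b hb).tsum_eq] at key
  have e : ∀ β : b, ((eqv b hb β : mixedSpace K) + mixedEmbedding K (ρ : K)) = mixedEmbedding K ((ρ + β : 𝓞 K) : K) := by
    intro β
    rw [eqv_coe]
    push_cast
    rw [map_add, add_comm]
  simp_rw [e] at key
  set S := ∑' β : b, Gw ε σ (c⁻¹ • mixedEmbedding K ((ρ + β : 𝓞 K) : K)) with hS
  set I := ∫ v, Gw (K := K) ε 1 v with hI
  have hA : 0 < Ideal.absNorm b * V0 K := by positivity
  have e2 : S - Y / Ideal.absNorm b * (I / V0 K) = (Ideal.absNorm b * V0 K)⁻¹ * (Ideal.absNorm b * V0 K * S - Y * I) := by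
    field_simp
  rw [e2, abs_mul, abs_of_pos (inv_pos.2 hA), hratio, inv_mul_le_iff₀ hA]
  refine key.trans (mul_le_mul_of_nonneg_left ?_ hA.le)
  have e3 : 2 * (C₁ * c + C₃ * η) / η + 1 ≤ (2 * (C₁ + C₃) + 1) * (c / η) := by
    rw [mul_div_assoc', div_add_one hη0.ne']
    gcongr
    nlinarith
  have e4 : (c / η) ^ n = Y / Ideal.absNorm b := by rw [div_pow, hcn, hηn]
  calc C₂ * ε⁻¹ ^ 2 * c⁻¹ * (C₃ * η) * (2 * (C₁ * c + C₃ * η) / η + 1) ^ n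
      ≤ C₂ * ε⁻¹ ^ 2 * c⁻¹ * (C₃ * η) * ((2 * (C₁ + C₃) + 1) * (c / η)) ^ n := by gcongr
    _ = _ := by rw [mul_pow, e4]; ring

variable (K) in
theorem core_count : ∃ C : ℝ, 0 ≤ C ∧ ∀ σ : {w : InfinitePlace K // IsReal w} → SignType, 
    ∀ b : Ideal (𝓞 K), b ≠ ⊥ → ∀ Y : ℝ, (Ideal.absNorm b : ℝ) ≤ Y → ∀ ρ : 𝓞 K,
    ∑' β : b, Gs Y σ (mixedEmbedding K ((ρ + β : 𝓞 K) : K)) ≤ C * (Y / Ideal.absNorm b) := by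
  obtain ⟨C₁, hC₁, hsupp⟩ := Gs_supp K
  refine ⟨(2 * C₁ + 1) ^ finrank ℚ K, by positivity, ?_⟩
  intro σ b hb Y hY ρ
  have hN := absNorm_pos hb
  have hY0 : 0 < Y := by linarith
  set n := finrank ℚ K with hn
  set c : ℝ := Y ^ ((n : ℝ)⁻¹) with hc
  set η : ℝ := (Ideal.absNorm b : ℝ) ^ ((n : ℝ)⁻¹) with hη
  have hc0 : 0 < c := by positivity
  have hη0 : 0 < η := by positivity
  have hηc : η ≤ c := Real.rpow_le_rpow (by positivity) hY (by positivity)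
  have hcn : c ^ n = Y := Real.rpow_inv_natCast_pow hY0.le finrank_pos.ne'
  have hηn : η ^ n = Ideal.absNorm b := Real.rpow_inv_natCast_pow (by positivity) finrank_pos.ne'
  obtain ⟨hfin, hcard⟩ := fin_ball b hb ρ (C₁ * c) (by positivity)
  rw [tsum_eq_sum (s := hfin.toFinset)]
  · refine (Finset.sum_le_card_nsmul _ _ 1 (fun β _ => Gs_le_one _ _ _)).trans ?_
    rw [nsmul_eq_mul, mul_one, ← Set.ncard_eq_toFinset_card _ hfin]
    refine hcard.trans ?_
    rw [← hη, ← hn]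
    have e3 : 2 * (C₁ * c) / η + 1 ≤ (2 * C₁ + 1) * (c / η) := by
      rw [mul_div_assoc', div_add_one hη0.ne']
      gcongr
      nlinarith
    have e4 : (c / η) ^ n = Y / Ideal.absNorm b := by rw [div_pow, hcn, hηn]
    rw [← e4, ← mul_pow]
    gcongr
  · intro β hβ
    by_contra hne
    apply hβ
    simpa using hsupp Y hY0 σ _ hne

end core
end BT


namespace BT
section cls
open NumberField NumberField.mixedEmbedding NumberField.InfinitePlace NumberField.Units
  NumberField.Units.dirichletUnitTheorem Module MeasureTheory
open scoped Classical nonZeroDivisors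

variable {K : Type*} [Field K] [NumberField K]

/-- parametrisation of the units -/
noncomputable def unitEquiv : (torsion K × (Fin (rank K) → ℤ)) ≃ (𝓞 K)ˣ :=
  Equiv.ofBijective (fun p => (p.1 : (𝓞 K)ˣ) * ∏ i, fundSystem K i ^ p.2 i) (by
    constructor
    · intro p p' h
      exact (exist_unique_eq_mul_prod K ((p.1 : (𝓞 K)ˣ) * ∏ i, fundSystem K i ^ p.2 i)).unique rfl h
    · intro u
      obtain ⟨p, hp, -⟩ := exist_unique_eq_mul_prod K u
      exact ⟨p, hp.symm⟩)

theorem unitEquiv_apply (p : torsion K × (Fin (rank K) → ℤ)) :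
    unitEquiv p = (p.1 : (𝓞 K)ˣ) * ∏ i, fundSystem K i ^ p.2 i := rfl

theorem log_unitEquiv (p : torsion K × (Fin (rank K) → ℤ)) :
    logEmbedding K (Additive.ofMul (unitEquiv p)) = ∑ i, (p.2 i : ℝ) • uB K i := by
  rw [unitEquiv_apply, ofMul_mul, map_add, (logEmbedding_eq_zero_iff (x := (p.1 : (𝓞 K)ˣ))).2 p.1.2, zero_add, ofMul_prod, map_sum]
  refine Finset.sum_congr rfl (fun i _ => ?_)
  rw [ofMul_zpow, map_zsmul, logEmbedding_fundSystem, uB, Basis.ofZLatticeBasis_apply, Int.cast_smul_eq_zsmul]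

theorem psi_unit (p : torsion K × (Fin (rank K) → ℤ)) (v : mixedSpace K) (hv : mixedEmbedding.norm v ≠ 0) :
    psiL (ell K (unitEquiv p • v)) = ∏ i, tau (Tl K (ell K v) i + p.2 i) := by
  have hv' : mixedEmbedding.norm (unitEquiv p • v) ≠ 0 := by rwa [norm_unit_smul]
  unfold psiL
  refine Finset.prod_congr rfl (fun i _ => ?_)
  rw [Tl_ell _ hv', Tl_ell _ hv, logMap_unit_smul _ hv, log_unitEquiv, map_add, Pi.add_apply, add_comm, map_sum]
  congr 2
  simp [Finset.sum_apply, Finsupp.single_apply]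

theorem unit_sum (v : mixedSpace K) (hv : mixedEmbedding.norm v ≠ 0) :
    ∑' u : (𝓞 K)ˣ, ENNReal.ofReal (psiL (ell K (u • v))) = torsionOrder K := by
  rw [← unitEquiv.tsum_eq, ENNReal.tsum_prod']
  simp_rw [psi_unit _ v hv]
  have h1 : ∑' e : Fin (rank K) → ℤ, ENNReal.ofReal (∏ i, tau (Tl K (ell K v) i + e i)) = 1 := by
    rw [tsum_eq_sum (s := Fintype.piFinset fun i => ({-⌊Tl K (ell K v) i⌋, -⌊Tl K (ell K v) i⌋ - 1} : Finset ℤ))]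
    · rw [← ENNReal.ofReal_sum_of_nonneg (fun e _ => Finset.prod_nonneg fun _ _ => tau_nonneg _),
        ← Finset.prod_univ_sum (fun i => ({-⌊Tl K (ell K v) i⌋, -⌊Tl K (ell K v) i⌋ - 1} : Finset ℤ)) (fun i k => tau (Tl K (ell K v) i + (k:ℤ)))]
      simp_rw [tau_sum]
      simp
    · intro e he
      rw [Fintype.mem_piFinset, not_forall] at he
      obtain ⟨i, hi⟩ := he
      rw [Finset.prod_eq_zero (Finset.mem_univ i), ENNReal.ofReal_zero]
      by_contra h
      exact hi (tau_mem h)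
  simp only [h1]
  haveI := Fintype.ofFinite (torsion K)
  rw [tsum_fintype]
  simp [torsionOrder, Nat.card_eq_fintype_card]

/-- signs of an integer -/
noncomputable def sg (β : 𝓞 K) (w : {w : InfinitePlace K // IsReal w}) : SignType :=
  SignType.sign ((mixedEmbedding K (β : K)).1 w)

/-- residue and signs -/
noncomputable def gam (q : Ideal (𝓞 K)) (β : 𝓞 K) : (𝓞 K ⧸ q) × ({w : InfinitePlace K // IsReal w} → SignType) :=
  (Ideal.Quotient.mk q β, sg β)

theorem sg_mul (a b : 𝓞 K) : sg (a * b) = sg a * sg b := by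
  ext w
  simp only [sg, Pi.mul_apply]
  push_cast
  rw [map_mul, ← sign_mul]
  rfl

theorem gam_mul (q : Ideal (𝓞 K)) (a b : 𝓞 K) : gam q (a * b) = gam q a * gam q b := by
  ext1
  · simp [gam]
  · simp [gam, sg_mul]

theorem norm_int_ne (β : 𝓞 K) : mixedEmbedding.norm (mixedEmbedding K (β : K)) ≠ 0 ↔ β ≠ 0 := by
  rw [norm_int, Nat.cast_ne_zero, Ne, Ideal.absNorm_eq_zero_iff, Ideal.span_singleton_eq_bot]

/-- class set -/
def KK (q c : Ideal (𝓞 K)) (Ω : Finset ((𝓞 K ⧸ q) × ({w : InfinitePlace K // IsReal w} → SignType))) : Set (Ideal (𝓞 K)) :=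
  {b | b ≠ ⊥ ∧ ∃ β, b * c = Ideal.span {β} ∧ gam q β ∈ Ω}

/-- general weight -/
noncomputable def Pw (g : ℝ → ℝ) (σ : {w : InfinitePlace K // IsReal w} → SignType) (v : mixedSpace K) : ℝ :=
  if Good σ v then psiL (ell K v) * g (mixedEmbedding.norm v) else 0

variable (q c d : Ideal (𝓞 K)) (Ω : Finset ((𝓞 K ⧸ q) × ({w : InfinitePlace K // IsReal w} → SignType)))

/-- invariance under units -/
def UInv : Prop := ∀ u : (𝓞 K)ˣ, ∀ m ∈ Ω, gam q (u : 𝓞 K) * m ∈ Ω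

theorem unfold_one (hc : c ≠ ⊥) (hU : UInv q Ω) (g : ℝ → ℝ) (hg : ∀ t, 0 ≤ g t) (b : Ideal (𝓞 K)) (hb : b ∈ KK q c Ω) :
    ∑' β : 𝓞 K, (if Ideal.span {β} = b * c ∧ gam q β ∈ Ω then
      ENNReal.ofReal (psiL (ell K (mixedEmbedding K (β : K))) * g (mixedEmbedding.norm (mixedEmbedding K (β : K)))) else 0) =
      torsionOrder K * ENNReal.ofReal (g (Ideal.absNorm b * Ideal.absNorm c)) := by
  obtain ⟨hb0, β₀, hβ₀, hβΩ⟩ := hb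
  have hβne : β₀ ≠ 0 := by
    rintro rfl
    rw [Ideal.span_singleton_eq_bot.2 rfl] at hβ₀
    rcases Ideal.mul_eq_bot.1 hβ₀ with h | h
    · exact hb0 h
    · exact hc h
  have hinj : Function.Injective (fun u : (𝓞 K)ˣ => (u : 𝓞 K) * β₀) := by
    intro u u' h
    exact Units.ext (mul_right_cancel₀ hβne h)
  rw [← hinj.tsum_eq]
  · have : ∀ u : (𝓞 K)ˣ, (if Ideal.span {(u : 𝓞 K) * β₀} = b * c ∧ gam q ((u : 𝓞 K) * β₀) ∈ Ω then
      ENNReal.ofReal (psiL (ell K (mixedEmbedding K (((u : 𝓞 K) * β₀ : 𝓞 K) : K))) * g (mixedEmbedding.norm (mixedEmbedding K (((u : 𝓞 K) * β₀ : 𝓞 K) : K)))) else 0) 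
      = ENNReal.ofReal (psiL (ell K (u • mixedEmbedding K (β₀ : K)))) * ENNReal.ofReal (g (Ideal.absNorm b * Ideal.absNorm c)) := by
      intro u
      have e1 : mixedEmbedding K (((u : 𝓞 K) * β₀ : 𝓞 K) : K) = u • mixedEmbedding K (β₀ : K) := by
        symm
        rw [unit_smul_eq_iff_mul_eq]
      rw [if_pos, e1, norm_unit_smul, norm_int, ← hβ₀, map_mul, Nat.cast_mul, ENNReal.ofReal_mul (psiL_nonneg _)]
      constructor
      · rw [hβ₀, Ideal.span_singleton_mul_left_unit u.isUnit]
      · rw [gam_mul]; exact hU u _ hβΩ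
    rw [tsum_congr this, ENNReal.tsum_mul_right, unit_sum _ ((norm_int_ne β₀).2 hβne)]
  · intro β hβ
    have h1 : Ideal.span {β} = b * c := by
      by_contra h
      exact hβ (if_neg (fun h' => h h'.1))
    rw [hβ₀, Ideal.span_singleton_eq_span_singleton] at h1
    obtain ⟨u, hu⟩ := h1.symm
    exact ⟨u, by rw [← hu]; exact mul_comm _ _⟩

theorem unfold_two (hc : c ≠ ⊥) (hU : UInv q Ω) (g : ℝ → ℝ) (hg : ∀ t, 0 ≤ g t) :
    torsionOrder K * ∑' b : Ideal (𝓞 K), (if b ∈ KK q c Ω ∧ d ∣ b then ENNReal.ofReal (g (Ideal.absNorm b * Ideal.absNorm c)) else 0) =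
    ∑' β : 𝓞 K, (if (β ≠ 0 ∧ β ∈ c * d) ∧ gam q β ∈ Ω then
      ENNReal.ofReal (psiL (ell K (mixedEmbedding K (β : K))) * g (mixedEmbedding.norm (mixedEmbedding K (β : K)))) else 0) := by
  rw [← ENNReal.tsum_mul_left]
  have h1 : ∀ b : Ideal (𝓞 K), torsionOrder K * (if b ∈ KK q c Ω ∧ d ∣ b then ENNReal.ofReal (g (Ideal.absNorm b * Ideal.absNorm c)) else 0)
    = ∑' β : 𝓞 K, (if (b ≠ ⊥ ∧ d ∣ b) ∧ (Ideal.span {β} = b * c ∧ gam q β ∈ Ω) then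
      ENNReal.ofReal (psiL (ell K (mixedEmbedding K (β : K))) * g (mixedEmbedding.norm (mixedEmbedding K (β : K)))) else 0) := by
    intro b
    by_cases hbd : b ≠ ⊥ ∧ d ∣ b
    · simp only [hbd.1, hbd.2, ne_eq, not_false_eq_true, true_and, and_true]
      by_cases hb : b ∈ KK q c Ω
      · rw [if_pos hb, unfold_one q c Ω hc hU g hg b hb]
      · rw [if_neg hb, mul_zero]
        symm
        rw [ENNReal.tsum_eq_zero]
        intro β
        rw [if_neg]
        rintro ⟨h, h'⟩
        exact hb ⟨hbd.1, β, h.symm, h'⟩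
    · rw [if_neg (fun h => hbd ⟨h.1.1, h.2⟩), mul_zero]
      symm
      rw [ENNReal.tsum_eq_zero]
      intro β
      rw [if_neg (fun h => hbd h.1)]
  rw [tsum_congr h1, ENNReal.tsum_comm]
  refine tsum_congr (fun β => ?_)
  by_cases hβ : (β ≠ 0 ∧ β ∈ c * d) ∧ gam q β ∈ Ω
  · rw [if_pos hβ]
    have hle : Ideal.span {β} ≤ c * d := (Ideal.span_singleton_le_iff_mem _).2 hβ.1.2
    obtain ⟨e, he⟩ := Ideal.dvd_iff_le.2 hle
    have hb₀ : Ideal.span {β} = (d * e) * c := by rw [he]; ring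
    have hne : d * e ≠ ⊥ := by
      intro h
      rw [h, Ideal.bot_mul, Ideal.span_singleton_eq_bot] at hb₀
      exact hβ.1.1 hb₀
    rw [tsum_eq_single (d * e), if_pos ⟨⟨hne, dvd_mul_right _ _⟩, hb₀, hβ.2⟩]
    intro b hb
    rw [if_neg]
    rintro ⟨-, h, -⟩
    rw [hb₀] at h
    exact hb (mul_right_cancel₀ hc h).symm
  · rw [if_neg hβ, ENNReal.tsum_eq_zero]
    intro b
    rw [if_neg]
    rintro ⟨⟨h1, h2⟩, h3, h4⟩
    refine hβ ⟨⟨?_, ?_⟩, h4⟩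
    · rintro rfl
      rw [Ideal.span_singleton_eq_bot.2 rfl] at h3
      rcases Ideal.mul_eq_bot.1 h3.symm with h | h
      · exact h1 h
      · exact hc h
    · rw [← Ideal.span_singleton_le_iff_mem, ← Ideal.dvd_iff_le, h3, mul_comm b c]
      exact mul_dvd_mul_left c h2

theorem unfold_three (hc : c ≠ ⊥) (hcop : IsCoprime (c * d) q) (hU : UInv q Ω) :
    ∃ ρ : ((𝓞 K ⧸ q) × ({w : InfinitePlace K // IsReal w} → SignType)) → 𝓞 K, ∀ (g : ℝ → ℝ) (hg : ∀ t, 0 ≤ g t),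
    torsionOrder K * ∑' b : Ideal (𝓞 K), (if b ∈ KK q c Ω ∧ d ∣ b then ENNReal.ofReal (g (Ideal.absNorm b * Ideal.absNorm c)) else 0) =
    ∑ m ∈ Ω, ∑' x : (c * d * q : Ideal (𝓞 K)), ENNReal.ofReal (Pw g m.2 (mixedEmbedding K ((ρ m + x : 𝓞 K) : K))) := by
  have hρ : ∀ m : ((𝓞 K ⧸ q) × ({w : InfinitePlace K // IsReal w} → SignType)), ∃ ρ : 𝓞 K, ρ ∈ c * d ∧ Ideal.Quotient.mk q ρ = m.1 := by
    intro m
    obtain ⟨r, hr⟩ := Ideal.Quotient.mk_surjective m.1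
    obtain ⟨a, ha, b, hb, hab⟩ := Ideal.isCoprime_iff_exists.1 hcop
    refine ⟨r * a, Ideal.mul_mem_left _ _ ha, ?_⟩
    rw [← hr, Ideal.Quotient.mk_eq_mk_iff_sub_mem]
    have : r * a - r = -(r * b) := by rw [← eq_sub_iff_add_eq] at hab; rw [hab]; ring
    rw [this]
    exact q.neg_mem (q.mul_mem_left _ hb)
  choose ρ hρ1 hρ2 using hρ
  refine ⟨ρ, fun g hg => ?_⟩
  rw [unfold_two q c d Ω hc hU g hg]
  have h1 : ∀ β : 𝓞 K, (if (β ≠ 0 ∧ β ∈ c * d) ∧ gam q β ∈ Ω then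
      ENNReal.ofReal (psiL (ell K (mixedEmbedding K (β : K))) * g (mixedEmbedding.norm (mixedEmbedding K (β : K)))) else 0)
      = ∑ m ∈ Ω, (if β ∈ c * d ∧ Ideal.Quotient.mk q β = m.1 then ENNReal.ofReal (Pw g m.2 (mixedEmbedding K (β : K))) else 0) := by
    intro β
    have hz : ∀ m ∈ Ω, m ≠ gam q β → (if β ∈ c * d ∧ Ideal.Quotient.mk q β = m.1 then ENNReal.ofReal (Pw g m.2 (mixedEmbedding K (β : K))) else 0) = 0 := by
      intro m _ hm
      split_ifs with h
      · rw [Pw, if_neg, ENNReal.ofReal_zero]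
        intro hG
        exact hm (Prod.ext h.2.symm (funext fun w => (hG.1 w).symm))
      · rfl
    by_cases hΩ : gam q β ∈ Ω
    · rw [Finset.sum_eq_single_of_mem _ hΩ hz]
      by_cases h0 : β = 0
      · have : ¬ Good (gam q β).2 (mixedEmbedding K (β : K)) := by
          intro h; exact (norm_int_ne β).1 h.2 h0
        rw [if_neg (fun h => h.1.1 h0), Pw, if_neg this]
        simp
      · have : Good (gam q β).2 (mixedEmbedding K (β : K)) := ⟨fun w => rfl, (norm_int_ne β).2 h0⟩
        by_cases h2 : β ∈ c * d
        · rw [if_pos ⟨⟨h0, h2⟩, hΩ⟩, if_pos ⟨h2, rfl⟩, Pw, if_pos this]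
        · rw [if_neg (fun h => h2 h.1.2), if_neg (fun h => h2 h.1)]
    · rw [if_neg (fun h => hΩ h.2), Finset.sum_eq_zero]
      intro m hm
      exact hz m hm (fun h => hΩ (h ▸ hm))
  rw [tsum_congr h1, Summable.tsum_finsetSum (fun _ _ => ENNReal.summable)]
  refine Finset.sum_congr rfl (fun m _ => ?_)
  have hinj : Function.Injective (fun x : (c * d * q : Ideal (𝓞 K)) => ρ m + (x : 𝓞 K)) := by
    intro x y h
    exact Subtype.ext (add_left_cancel h)
  have hinf : c * d * q = (c * d) ⊓ q := (Ideal.inf_eq_mul_of_isCoprime hcop).symm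
  rw [← hinj.tsum_eq]
  · refine tsum_congr (fun x => ?_)
    have hx : (x : 𝓞 K) ∈ (c * d) ⊓ q := hinf ▸ x.2
    rw [if_pos]
    refine ⟨add_mem (hρ1 m) hx.1, ?_⟩
    rw [map_add, hρ2, Ideal.Quotient.eq_zero_iff_mem.2 hx.2, add_zero]
  · intro β hβ
    have h2 : β ∈ c * d ∧ Ideal.Quotient.mk q β = m.1 := by
      by_contra h
      exact hβ (if_neg h)
    refine ⟨⟨β - ρ m, ?_⟩, by simp⟩
    rw [hinf]
    refine ⟨sub_mem h2.1 (hρ1 m), ?_⟩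
    exact (Ideal.Quotient.mk_eq_mk_iff_sub_mem _ _).1 (by rw [h2.2, hρ2])

end cls
end BT


namespace BT
section clsH
open NumberField NumberField.mixedEmbedding NumberField.InfinitePlace NumberField.Units
  NumberField.Units.dirichletUnitTheorem Module MeasureTheory
open scoped Classical nonZeroDivisors

variable {K : Type*} [Field K] [NumberField K]

variable (q c d : Ideal (𝓞 K)) (Ω : Finset ((𝓞 K ⧸ q) × ({w : InfinitePlace K // IsReal w} → SignType)))

/-- members of the class set of norm at most y -/
noncomputable def Bf (y : ℝ) : Finset (Ideal (𝓞 K)) :=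
  (Ideal.finite_setOfPred_absNorm_le (S := 𝓞 K) ⌊y⌋₊).toFinset.filter (· ∈ KK q c Ω)

theorem mem_Bf {y : ℝ} (hy : 0 ≤ y) (b : Ideal (𝓞 K)) :
    b ∈ Bf q c Ω y ↔ b ∈ KK q c Ω ∧ (Ideal.absNorm b : ℝ) ≤ y := by
  simp only [Bf, Finset.mem_filter, Set.Finite.mem_toFinset, Set.mem_ofPred_eq]
  rw [Nat.le_floor_iff hy, and_comm]

theorem unfold_real (hc : c ≠ ⊥) (hcop : IsCoprime (c * d) q) (hU : UInv q Ω) :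
    ∃ ρ : ((𝓞 K ⧸ q) × ({w : InfinitePlace K // IsReal w} → SignType)) → 𝓞 K, ∀ (g : ℝ → ℝ), (∀ t, 0 ≤ g t) →
    (∀ m, Summable (fun x : (c * d * q : Ideal (𝓞 K)) => Pw g m.2 (mixedEmbedding K ((ρ m + x : 𝓞 K) : K)))) →
    ∀ y : ℝ, 0 ≤ y → (∀ b : Ideal (𝓞 K), g (Ideal.absNorm b * Ideal.absNorm c) ≠ 0 → (Ideal.absNorm b : ℝ) ≤ y) →
    torsionOrder K * ∑ b ∈ Bf q c Ω y with d ∣ b, g (Ideal.absNorm b * Ideal.absNorm c) =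
    ∑ m ∈ Ω, ∑' x : (c * d * q : Ideal (𝓞 K)), Pw g m.2 (mixedEmbedding K ((ρ m + x : 𝓞 K) : K)) := by
  obtain ⟨ρ, h⟩ := unfold_three q c d Ω hc hcop hU
  refine ⟨ρ, fun g hg hs y hy hgy => ?_⟩
  have h1 := h g hg
  have hP : ∀ σ (v : mixedSpace K), 0 ≤ Pw g σ v := by
    intro σ v
    unfold Pw
    split_ifs
    · exact mul_nonneg (psiL_nonneg _) (hg _)
    · exact le_rfl
  rw [tsum_eq_sum (s := (Bf q c Ω y).filter (d ∣ ·))] at h1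
  · rw [Finset.sum_congr rfl (g := fun b : Ideal (𝓞 K) => ENNReal.ofReal (g (Ideal.absNorm b * Ideal.absNorm c)))] at h1
    · rw [← ENNReal.ofReal_sum_of_nonneg (fun _ _ => hg _)] at h1
      simp_rw [← ENNReal.ofReal_tsum_of_nonneg (fun _ => hP _ _) (hs _)] at h1
      rw [← ENNReal.ofReal_sum_of_nonneg (fun _ _ => tsum_nonneg (fun _ => hP _ _)), ← ENNReal.ofReal_natCast,
        ← ENNReal.ofReal_mul (Nat.cast_nonneg _)] at h1
      rwa [ENNReal.ofReal_eq_ofReal_iff] at h1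
      · exact mul_nonneg (Nat.cast_nonneg _) (Finset.sum_nonneg fun _ _ => hg _)
      · exact Finset.sum_nonneg fun _ _ => tsum_nonneg (fun _ => hP _ _)
    · intro b hb
      rw [Finset.mem_filter, mem_Bf _ _ _ hy] at hb
      rw [if_pos ⟨hb.1.1, hb.2⟩]
  · intro b hb
    split_ifs with h2
    · rw [Finset.mem_filter, mem_Bf _ _ _ hy] at hb
      by_contra h3
      exact hb ⟨⟨h2.1, hgy b (fun h4 => h3 (by rw [h4]; simp))⟩, h2.2⟩
    · rfl

theorem Gw_Pw (ε Y : ℝ) (hY : 0 < Y) (σ) (v : mixedSpace K) :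
    Gw ε σ ((Y ^ ((finrank ℚ K : ℝ)⁻¹))⁻¹ • v) = Pw (fun t => wcut ε (Real.log (t / Y))) σ v := by
  have hc : 0 < (Y ^ ((finrank ℚ K : ℝ)⁻¹))⁻¹ := by positivity
  unfold Gw Pw
  simp only [good_smul σ hc]
  split_ifs with h
  · unfold Hw
    have hv := h.2
    have hn : (finrank ℚ K : ℝ) ≠ 0 := by exact_mod_cast finrank_pos.ne'
    have e : mixedEmbedding.norm ((Y ^ ((finrank ℚ K : ℝ)⁻¹))⁻¹ • v) = mixedEmbedding.norm v / Y := by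
      rw [mixedEmbedding.norm_smul, abs_of_pos hc, inv_pow, ← Real.rpow_natCast, ← Real.rpow_mul hY.le, inv_mul_cancel₀ hn,
        Real.rpow_one]
      ring
    rw [psi_smul hc v hv, sL_ell, e]
    rw [e]; exact div_ne_zero hv hY.ne'
  · rfl

theorem Gs_Pw (Y : ℝ) (σ) (v : mixedSpace K) :
    Gs Y σ v = Pw (fun t => if t ≤ Y then 1 else 0) σ v := by
  unfold Gs Pw
  by_cases h : Good σ v <;> by_cases h' : mixedEmbedding.norm v ≤ Y <;> simp [h, h']

theorem sum_Gw (ε Y : ℝ) (h0 : 0 < ε) (h1 : ε ≤ 1) (hY : 0 < Y) (b : Ideal (𝓞 K)) (hb : b ≠ ⊥) (σ) (ρ : 𝓞 K) :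
    Summable (fun β : b => Gw ε σ ((Y ^ ((finrank ℚ K : ℝ)⁻¹))⁻¹ • mixedEmbedding K ((ρ + β : 𝓞 K) : K))) := by
  obtain ⟨C, hC, h⟩ := Gw_supp K
  have hc : 0 < Y ^ ((finrank ℚ K : ℝ)⁻¹) := by positivity
  refine summable_of_finite_support ((fin_ball b hb ρ (C * Y ^ ((finrank ℚ K : ℝ)⁻¹)) (by positivity)).1.subset ?_)
  intro β hβ
  have := (h ε h0 h1 σ _ hβ).1
  rw [_root_.norm_smul, norm_inv, Real.norm_of_nonneg hc.le, inv_mul_le_iff₀ hc] at this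
  rw [Set.mem_ofPred_eq]
  linarith

theorem sum_Gs (Y : ℝ) (hY : 0 < Y) (b : Ideal (𝓞 K)) (hb : b ≠ ⊥) (σ) (ρ : 𝓞 K) :
    Summable (fun β : b => Gs Y σ (mixedEmbedding K ((ρ + β : 𝓞 K) : K))) := by
  obtain ⟨C, hC, h⟩ := Gs_supp K
  refine summable_of_finite_support ((fin_ball b hb ρ (C * Y ^ ((finrank ℚ K : ℝ)⁻¹)) (by positivity)).1.subset ?_)
  intro β hβ
  exact h Y hY σ _ hβ

variable (K) in
theorem class_smooth : ∃ C : ℝ, 0 ≤ C ∧ ∀ ε : ℝ, 0 < ε → ε ≤ 1 → ∀ (q c d : Ideal (𝓞 K))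
    (Ω : Finset ((𝓞 K ⧸ q) × ({w : InfinitePlace K // IsReal w} → SignType))), q ≠ ⊥ → c ≠ ⊥ → d ≠ ⊥ →
    IsCoprime (c * d) q → UInv q Ω → (∀ m ∈ Ω, ∀ w, m.2 w ≠ 0) → ∀ x : ℝ, (Ideal.absNorm d * Ideal.absNorm q : ℝ) ≤ x →
    |(torsionOrder K : ℝ) * ∑ b ∈ Bf q c Ω (3 * x) with d ∣ b, wcut ε (Real.log (Ideal.absNorm b / x)) -
      Ω.card * (x / (Ideal.absNorm d * Ideal.absNorm q) * ((∫ v, Gw (K := K) ε 1 v) / V0 K))| ≤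
    C * Ω.card * (ε⁻¹) ^ 2 * (x / (Ideal.absNorm d * Ideal.absNorm q)) *
      ((Ideal.absNorm d * Ideal.absNorm q) / x) ^ ((finrank ℚ K : ℝ)⁻¹) := by
  obtain ⟨C, hC, h⟩ := core_smooth K
  refine ⟨C, hC, fun ε h0 h1 q c d Ω hq hc hd hcop hU hσ x hx => ?_⟩
  obtain ⟨ρ, hρ⟩ := unfold_real q c d Ω hc hcop hU
  have hNq := absNorm_pos hq
  have hNc := absNorm_pos hc
  have hNd := absNorm_pos hd
  have hx0 : 0 < x := lt_of_lt_of_le (by positivity) hx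
  have hY : 0 < x * Ideal.absNorm c := by positivity
  have hI : c * d * q ≠ ⊥ := by
    simp [Ideal.mul_eq_bot, hc, hd, hq]
  have hNI : (Ideal.absNorm (c * d * q) : ℝ) = Ideal.absNorm c * (Ideal.absNorm d * Ideal.absNorm q) := by
    rw [map_mul, map_mul]; push_cast; ring
  have e1 := hρ (fun t => wcut ε (Real.log (t / (x * Ideal.absNorm c)))) (fun t => wcut_nonneg _ _)
    (fun m => by simpa only [Gw_Pw ε _ hY] using sum_Gw ε _ h0 h1 hY _ hI m.2 (ρ m)) (3 * x) (by positivity) (by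
      intro b hb
      have hb2 := (wcut_ne_zero h0 hb).2
      by_contra! h3
      rw [mul_div_mul_right _ _ (by positivity)] at hb2
      have : Real.log 3 < Real.log (Ideal.absNorm b / x) :=
        Real.log_lt_log (by norm_num) (by rw [lt_div_iff₀ hx0]; linarith)
      have h4 : (1:ℝ) < Real.log 3 := by
        rw [Real.lt_log_iff_exp_lt (by norm_num)]
        exact Real.exp_one_lt_d9.trans (by norm_num)
      linarith)
  simp only [mul_div_mul_right _ _ (show (Ideal.absNorm c : ℝ) ≠ 0 by positivity)] at e1
  rw [e1]
  simp only [← Gw_Pw ε _ hY]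
  have hYI : (Ideal.absNorm (c * d * q) : ℝ) ≤ x * Ideal.absNorm c := by
    rw [hNI, mul_comm x]; gcongr
  have e2 : x * Ideal.absNorm c / Ideal.absNorm (c * d * q) = x / (Ideal.absNorm d * Ideal.absNorm q) := by
    rw [hNI, mul_comm x, mul_div_mul_left _ _ (by positivity)]
  have e3 : Ideal.absNorm (c * d * q) / (x * Ideal.absNorm c) = (Ideal.absNorm d * Ideal.absNorm q) / x := by
    rw [hNI, mul_comm x, mul_div_mul_left _ _ (by positivity)]
  rw [← nsmul_eq_mul (Ω.card), ← Finset.sum_const, ← Finset.sum_sub_distrib]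
  refine (Finset.abs_sum_le_sum_abs _ _).trans ?_
  refine (Finset.sum_le_card_nsmul _ _ (C * (ε⁻¹) ^ 2 * (x / (Ideal.absNorm d * Ideal.absNorm q)) *
      ((Ideal.absNorm d * Ideal.absNorm q) / x) ^ ((finrank ℚ K : ℝ)⁻¹)) ?_).trans ?_
  · intro m hm
    have := h ε h0 h1 m.2 (hσ m hm) (c * d * q) hI (x * Ideal.absNorm c) hYI (ρ m)
    rwa [e2, e3] at this
  · rw [nsmul_eq_mul]
    apply le_of_eq; ring

variable (K) in
theorem class_count : ∃ C : ℝ, 0 ≤ C ∧ ∀ (q c : Ideal (𝓞 K))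
    (Ω : Finset ((𝓞 K ⧸ q) × ({w : InfinitePlace K // IsReal w} → SignType))), q ≠ ⊥ → c ≠ ⊥ →
    IsCoprime c q → UInv q Ω → ∀ x : ℝ, (Ideal.absNorm q : ℝ) ≤ x →
    ((Bf q c Ω x).card : ℝ) ≤ C * Ω.card * (x / Ideal.absNorm q) := by
  obtain ⟨C, hC, h⟩ := core_count K
  refine ⟨C, hC, fun q c Ω hq hc hcop hU x hx => ?_⟩
  obtain ⟨ρ, hρ⟩ := unfold_real q c ⊤ Ω hc (by rwa [Ideal.mul_top]) hU
  have hNq := absNorm_pos hq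
  have hNc := absNorm_pos hc
  have hx0 : 0 < x := by linarith
  have hY : 0 < x * Ideal.absNorm c := by positivity
  have hI : c * ⊤ * q ≠ ⊥ := by
    simp [Ideal.mul_eq_bot, hc, hq]
  have hNI : (Ideal.absNorm (c * ⊤ * q) : ℝ) = Ideal.absNorm c * Ideal.absNorm q := by
    rw [Ideal.mul_top, map_mul]; push_cast; ring
  have e1 := hρ (fun t => if t ≤ x * Ideal.absNorm c then 1 else 0) (fun t => by positivity)
    (fun m => by simpa only [Gs_Pw] using sum_Gs _ hY _ hI m.2 (ρ m)) x (by positivity) (by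
      intro b hb
      have hb2 : (Ideal.absNorm b * Ideal.absNorm c : ℝ) ≤ x * Ideal.absNorm c := by
        by_contra h
        exact hb (if_neg h)
      exact le_of_mul_le_mul_right hb2 (by positivity))
  simp only [← Gs_Pw] at e1
  have e4 : ∑ b ∈ Bf q c Ω x with ⊤ ∣ b, (if (Ideal.absNorm b * Ideal.absNorm c : ℝ) ≤ x * Ideal.absNorm c then (1:ℝ) else 0) = (Bf q c Ω x).card := by
    rw [Finset.filter_true_of_mem (fun b _ => by rw [← Ideal.one_eq_top]; exact one_dvd b), Finset.sum_congr rfl (g := fun _ => (1:ℝ))]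
    · simp
    · intro b hb
      rw [mem_Bf _ _ _ hx0.le] at hb
      rw [if_pos]
      have := hb.2
      gcongr
  rw [e4] at e1
  have hw : (1:ℝ) ≤ torsionOrder K := by exact_mod_cast Nat.one_le_iff_ne_zero.2 (torsionOrder_ne_zero K)
  calc ((Bf q c Ω x).card : ℝ) ≤ torsionOrder K * (Bf q c Ω x).card := le_mul_of_one_le_left (by positivity) hw
    _ = _ := e1
    _ ≤ Ω.card • (C * (x / Ideal.absNorm q)) := by
      refine Finset.sum_le_card_nsmul _ _ _ (fun m hm => ?_)
      refine (h m.2 _ hI (x * Ideal.absNorm c) ?_ (ρ m)).trans (le_of_eq ?_)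
      · rw [hNI, mul_comm x]; gcongr
      · rw [hNI, mul_comm x, mul_div_mul_left _ _ (by positivity)]
    _ = _ := by rw [nsmul_eq_mul]; ring

end clsH
end BT


namespace BT
section clsI
open NumberField NumberField.mixedEmbedding NumberField.InfinitePlace NumberField.Units
  NumberField.Units.dirichletUnitTheorem Module MeasureTheory
open scoped Classical nonZeroDivisors

variable {K : Type*} [Field K] [NumberField K]

variable (K) in
/-- nonzero ideals of norm at most z -/
noncomputable def Wn (z : ℝ) : Finset (Ideal (𝓞 K)) :=
  (Ideal.finite_setOfPred_absNorm_le (S := 𝓞 K) ⌊z⌋₊).toFinset.filter (· ≠ ⊥)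

theorem mem_Wn {z : ℝ} (hz : 0 ≤ z) (b : Ideal (𝓞 K)) :
    b ∈ Wn K z ↔ b ≠ ⊥ ∧ (Ideal.absNorm b : ℝ) ≤ z := by
  simp only [Wn, Finset.mem_filter, Set.Finite.mem_toFinset, Set.mem_ofPred_eq]
  rw [Nat.le_floor_iff hz, and_comm]

variable (K) in
/-- nonzero sign patterns -/
noncomputable def SgS : Finset ({w : InfinitePlace K // IsReal w} → SignType) :=
  Finset.univ.filter (fun σ => ∀ w, σ w ≠ 0)

theorem mem_SgS (σ : {w : InfinitePlace K // IsReal w} → SignType) : σ ∈ SgS K ↔ ∀ w, σ w ≠ 0 := by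
  simp [SgS]

theorem SgS_pos : 0 < (SgS K).card := Finset.card_pos.2 ⟨1, by rw [mem_SgS]; simp⟩

theorem sg_ne_zero {β : 𝓞 K} (hβ : β ≠ 0) : sg β ∈ SgS K := by
  rw [mem_SgS]
  intro w h
  unfold sg at h
  rw [sign_eq_zero_iff, mixedEmbedding_apply_isReal] at h
  exact hβ (by simpa using h)

variable (K) in
/-- all patterns, trivial modulus -/
noncomputable def Ow : Finset ((𝓞 K ⧸ (⊤ : Ideal (𝓞 K))) × ({w : InfinitePlace K // IsReal w} → SignType)) :=
  {0} ×ˢ SgS K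

theorem mem_Ow (m) : m ∈ Ow K ↔ ∀ w, m.2 w ≠ 0 := by
  rw [Ow, Finset.mem_product, mem_SgS, Finset.mem_singleton]
  have : Subsingleton (𝓞 K ⧸ (⊤ : Ideal (𝓞 K))) := Ideal.Quotient.subsingleton_iff.2 rfl
  exact and_iff_right (Subsingleton.elim _ _)

theorem card_Ow : (Ow K).card = (SgS K).card := by simp [Ow]

theorem UInv_Ow : UInv (⊤ : Ideal (𝓞 K)) (Ow K) := by
  intro u m hm
  rw [mem_Ow] at hm ⊢
  intro w
  exact mul_ne_zero ((mem_SgS _).1 (sg_ne_zero u.ne_zero) w) (hm w)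

variable (K) in
theorem cc_exists : ∃ cc : ClassGroup (𝓞 K) → Ideal (𝓞 K), (∀ C, cc C ≠ ⊥) ∧
    ∀ b : Ideal (𝓞 K), ∀ hb : b ≠ ⊥, ∀ C, (b ∈ KK ⊤ (cc C) (Ow K) ↔
      ClassGroup.mk0 ⟨b, mem_nonZeroDivisors_of_ne_zero hb⟩ = C) := by
  have h : ∀ C : ClassGroup (𝓞 K), ∃ J : (Ideal (𝓞 K))⁰, ClassGroup.mk0 J = C⁻¹ := fun C => ClassGroup.mk0_surjective _
  choose J hJ using h
  have hJ0 : ∀ C, (J C : Ideal (𝓞 K)) ≠ ⊥ := fun C => nonZeroDivisors.ne_zero (J C).2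
  refine ⟨fun C => (J C : Ideal (𝓞 K)), hJ0, fun b hb C => ?_⟩
  have h1 : ClassGroup.mk0 ⟨b, mem_nonZeroDivisors_of_ne_zero hb⟩ = C ↔
      (b * (J C : Ideal (𝓞 K))).IsPrincipal := by
    rw [← mul_inv_eq_one, ← hJ, ← map_mul, ← ClassGroup.mk0_eq_one_iff (mem_nonZeroDivisors_of_ne_zero (mul_ne_zero hb (hJ0 C)))]
    rfl
  rw [h1]
  constructor
  · rintro ⟨_, β, hβ, _⟩
    exact ⟨β, hβ⟩
  · rintro ⟨β, hβ⟩
    refine ⟨hb, β, hβ, ?_⟩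
    rw [mem_Ow]
    refine (mem_SgS _).1 (sg_ne_zero ?_)
    rintro rfl
    have h2 : b * (J C : Ideal (𝓞 K)) ≠ ⊥ := mul_ne_zero hb (hJ0 C)
    apply h2
    rw [hβ]; simp

theorem card_Wn (cc : ClassGroup (𝓞 K) → Ideal (𝓞 K)) (hcc : ∀ b : Ideal (𝓞 K), ∀ hb : b ≠ ⊥, ∀ C, (b ∈ KK ⊤ (cc C) (Ow K) ↔
      ClassGroup.mk0 ⟨b, mem_nonZeroDivisors_of_ne_zero hb⟩ = C)) {z : ℝ} (hz : 0 ≤ z) :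
    (Wn K z).card = ∑ C, (Bf ⊤ (cc C) (Ow K) z).card := by
  rw [← Finset.card_biUnion]
  · congr 1
    ext b
    simp only [Finset.mem_biUnion, Finset.mem_univ, true_and, mem_Bf _ _ _ hz, mem_Wn hz]
    constructor
    · rintro ⟨hb, h⟩
      exact ⟨_, (hcc b hb _).2 rfl, h⟩
    · rintro ⟨C, hC, h⟩
      exact ⟨hC.1, h⟩
  · intro C _ D _ hCD
    rw [Function.onFun, Finset.disjoint_left]
    intro b h1 h2
    rw [mem_Bf _ _ _ hz] at h1 h2
    exact hCD (((hcc b h1.1.1 C).1 h1.1).symm.trans ((hcc b h1.1.1 D).1 h2.1))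

variable (K) in
theorem wide_count : ∃ C : ℝ, 0 ≤ C ∧ ∀ x : ℝ, 1 ≤ x → ((Wn K x).card : ℝ) ≤ C * x := by
  obtain ⟨C, hC, h⟩ := class_count K
  obtain ⟨cc, hcc0, hcc⟩ := cc_exists K
  refine ⟨∑ _D : ClassGroup (𝓞 K), C * (Ow K).card, by positivity, fun x hx => ?_⟩
  rw [card_Wn cc hcc (by linarith), Nat.cast_sum, Finset.sum_mul]
  refine Finset.sum_le_sum fun D _ => ?_
  have := h ⊤ (cc D) (Ow K) (by simp) (hcc0 D) (by rw [Ideal.isCoprime_iff_sup_eq]; simp) UInv_Ow x (by simpa using hx)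
  simpa using this

variable (K) in
/-- residue constant -/
noncomputable def kap : ℝ := classNumber K * (SgS K).card * (Jv K / V0 K) / torsionOrder K

theorem kap_pos : 0 < kap K := by
  have h1 : (0:ℝ) < classNumber K := by exact_mod_cast classNumber_pos K
  have h2 : (0:ℝ) < (SgS K).card := by exact_mod_cast SgS_pos
  have h3 := Jv_pos K
  have h4 := V0_pos K
  have h5 : (0:ℝ) < torsionOrder K := by exact_mod_cast torsionOrder_pos K
  unfold kap
  positivity

set_option maxHeartbeats 1600000 in
variable (K) in
theorem wide_lower : ∃ C : ℝ, 0 ≤ C ∧ ∃ δ : ℝ, 0 < δ ∧ ∀ m : ℕ, 1 ≤ m →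
    kap K * m - C * (m:ℝ) ^ (1 - δ) ≤ (Wn K m).card := by
  obtain ⟨C, hC, h⟩ := class_smooth K
  obtain ⟨cc, hcc0, hcc⟩ := cc_exists K
  have hn : (1:ℝ) ≤ (finrank ℚ K : ℝ) := by exact_mod_cast finrank_pos
  set N : ℝ := (finrank ℚ K : ℝ) with hN
  have hw : (1:ℝ) ≤ torsionOrder K := by exact_mod_cast torsionOrder_pos K
  have hE : (0:ℝ) < (SgS K).card := by exact_mod_cast SgS_pos
  have hh : (0:ℝ) < classNumber K := by exact_mod_cast classNumber_pos K
  have hJ := Jv_pos K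
  have hV := V0_pos K
  have hkapd : kap K * torsionOrder K = classNumber K * ((SgS K).card : ℝ) * (Jv K / V0 K) := by
    unfold kap; field_simp
  obtain ⟨E, hEd⟩ : ∃ E : ℝ, E = ((SgS K).card : ℝ) := ⟨_, rfl⟩
  obtain ⟨h', hhd⟩ : ∃ h' : ℝ, h' = (classNumber K : ℝ) := ⟨_, rfl⟩
  rw [← hEd] at hE hkapd
  rw [← hhd] at hh hkapd
  set J : ℝ := Jv K / V0 K with hJd
  have hJ' : 0 < J := by positivity
  have hkap := kap_pos (K := K)
  set δ : ℝ := 1 / (4 * N) with hδ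
  have hδ0 : 0 < δ := by positivity
  have hδ1 : δ ≤ 1 / 4 := by
    rw [hδ]; gcongr; linarith
  refine ⟨h' * (4 * E * J + C * E) + 3 * kap K, by positivity, δ, hδ0, fun m hm => ?_⟩
  have hm1 : (1:ℝ) ≤ m := by exact_mod_cast hm
  have hm0 : (0:ℝ) < m := by linarith
  have hmd : 1 ≤ (m:ℝ) ^ (1 - δ) := Real.one_le_rpow hm1 (by linarith)
  by_cases hm3 : m < 3
  · have : (m:ℝ) ≤ 3 := by exact_mod_cast hm3.le
    have h1 : kap K * m ≤ 3 * kap K * (m:ℝ) ^ (1 - δ) := by nlinarith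
    have h2 : 0 ≤ (h' * (4 * E * J + C * E)) * (m:ℝ) ^ (1 - δ) := by positivity
    have h3 : (0:ℝ) ≤ (Wn K m).card := by positivity
    nlinarith
  have hm3' : (3:ℝ) ≤ m := by exact_mod_cast not_lt.1 hm3
  set ε : ℝ := (m:ℝ) ^ (-δ) with hε
  have hε0 : 0 < ε := by positivity
  have hε1 : ε ≤ 1 := Real.rpow_le_one_of_one_le_of_nonpos hm1 (by linarith)
  set x : ℝ := m * Real.exp (-ε) with hx
  have hxm : x ≤ m := by
    have : Real.exp (-ε) ≤ 1 := Real.exp_le_one_iff.2 (by linarith)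
    nlinarith
  have hx0 : 0 < x := by positivity
  have hxl : m * (1 - ε) ≤ x := by
    have := Real.add_one_le_exp (-ε)
    rw [hx]; gcongr; linarith
  have hx1 : 1 ≤ x := by
    have h1 : Real.exp (-1) ≤ Real.exp (-ε) := Real.exp_le_exp.2 (by linarith)
    have h2 : 1 ≤ 3 * Real.exp (-1) := by
      rw [Real.exp_neg, ← div_eq_mul_inv, le_div_iff₀ (Real.exp_pos _)]
      linarith [Real.exp_one_lt_d9]
    rw [hx]; nlinarith [Real.exp_pos (-ε)]
  have key : ∀ D, E * J * m - (4 * E * J + C * E) * (m:ℝ) ^ (1 - δ) ≤ torsionOrder K * ((Bf ⊤ (cc D) (Ow K) m).card : ℝ) := by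
    intro D
    have h1 := h ε hε0 hε1 ⊤ (cc D) ⊤ (Ow K) (by simp) (hcc0 D) (by simp) (by rw [Ideal.isCoprime_iff_sup_eq]; simp) UInv_Ow
      (fun m hm => (mem_Ow m).1 hm) x (by simpa using hx1)
    simp only [Ideal.absNorm_top, Nat.cast_one, mul_one, div_one, card_Ow, ← hEd] at h1
    have h2 := (abs_le.1 h1).1
    have h3 : ∑ b ∈ Bf ⊤ (cc D) (Ow K) (3 * x) with ⊤ ∣ b, wcut ε (Real.log (Ideal.absNorm b / x)) ≤ ((Bf ⊤ (cc D) (Ow K) m).card : ℝ) := by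
      rw [← nsmul_one, ← Finset.sum_const]
      rw [← Finset.sum_filter_ne_zero]
      refine (Finset.sum_le_sum_of_subset_of_nonneg (?_ : _ ⊆ Bf ⊤ (cc D) (Ow K) (m:ℝ)) (fun _ _ _ => wcut_nonneg _ _)).trans (Finset.sum_le_sum fun b _ => wcut_le_one _ _)
      intro b hb
      rw [Finset.mem_filter, Finset.mem_filter, mem_Bf _ _ _ (by positivity)] at hb
      rw [mem_Bf _ _ _ (by positivity)]
      refine ⟨hb.1.1.1, ?_⟩
      have h4 := (wcut_ne_zero hε0 hb.2).2
      have hb1 := absNorm_pos hb.1.1.1.1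
      rw [Real.log_lt_iff_lt_exp (by positivity), div_lt_iff₀ hx0, hx] at h4
      have : Real.exp ε * (m * Real.exp (-ε)) = m := by
        rw [Real.exp_neg]; field_simp
      linarith
    have h5 := (integral_Gw_bounds (K := K) hε0 hε1 1 (by simp)).1
    have h6 : (1 - 3 * ε) * J ≤ (∫ v, Gw (K := K) ε 1 v) / V0 K := by
      rw [hJd, ← mul_div_assoc]; gcongr
    have h7 : m - 4 * (m:ℝ) ^ (1 - δ) ≤ x * (1 - 3 * ε) := by
      have e : (m:ℝ) ^ (1 - δ) = m * ε := by
        rw [hε, sub_eq_add_neg, Real.rpow_add hm0, Real.rpow_one]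
      rw [e]
      by_cases h : 0 ≤ 1 - 3 * ε
      · nlinarith [mul_le_mul_of_nonneg_right hxl h, mul_pos hm0 (mul_pos hε0 hε0)]
      · nlinarith [mul_pos hm0 hε0]
    have h8 : (ε⁻¹) ^ 2 * x * (1 / x) ^ N⁻¹ ≤ (m:ℝ) ^ (1 - δ) := by
      have e1 : (ε⁻¹) ^ 2 = (m:ℝ) ^ (2 * δ) := by
        rw [hε, ← Real.rpow_neg hm0.le, neg_neg, ← Real.rpow_natCast, ← Real.rpow_mul hm0.le]
        congr 1; push_cast; ring
      have e2 : N⁻¹ = 4 * δ := by rw [hδ]; field_simp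
      rw [e1, e2, one_div, Real.inv_rpow hx0.le, ← Real.rpow_neg hx0.le, mul_assoc]
      have e3 : x * x ^ (-(4 * δ)) = x ^ (1 - 4 * δ) := by
        rw [sub_eq_add_neg, Real.rpow_add hx0, Real.rpow_one]
      rw [e3]
      calc (m:ℝ) ^ (2 * δ) * x ^ (1 - 4 * δ) ≤ (m:ℝ) ^ (2 * δ) * (m:ℝ) ^ (1 - 4 * δ) := by
            gcongr; linarith
        _ = (m:ℝ) ^ (1 - 2 * δ) := by rw [← Real.rpow_add hm0]; congr 1; ring
        _ ≤ _ := Real.rpow_le_rpow_of_exponent_le hm1 (by linarith)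
    have h9 : E * ((m - 4 * (m:ℝ) ^ (1 - δ)) * J) ≤ E * (x * ((∫ v, Gw (K := K) ε 1 v) / V0 K)) := by
      calc E * ((m - 4 * (m:ℝ) ^ (1 - δ)) * J) ≤ E * (x * (1 - 3 * ε) * J) := by gcongr
        _ = E * (x * ((1 - 3 * ε) * J)) := by ring
        _ ≤ _ := by gcongr
    have h10 : C * E * (ε⁻¹) ^ 2 * x * (1 / x) ^ N⁻¹ ≤ C * E * (m:ℝ) ^ (1 - δ) := by
      calc C * E * (ε⁻¹) ^ 2 * x * (1 / x) ^ N⁻¹ = C * E * ((ε⁻¹) ^ 2 * x * (1 / x) ^ N⁻¹) := by ring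
        _ ≤ _ := by gcongr
    have h11 := mul_le_mul_of_nonneg_left h3 (by linarith : (0:ℝ) ≤ torsionOrder K)
    nlinarith
  have hs := Finset.sum_le_sum (s := Finset.univ) fun D _ => key D
  rw [← Finset.mul_sum, ← Nat.cast_sum, ← card_Wn cc hcc hm0.le, Finset.sum_const, nsmul_eq_mul, Finset.card_univ] at hs
  have hcl : (Fintype.card (ClassGroup (𝓞 K)) : ℝ) = h' := hhd.symm
  rw [hcl] at hs
  have hk : kap K * torsionOrder K = h' * E * J := hkapd
  have h1 : (torsionOrder K : ℝ) * (kap K * m - (h' * (4 * E * J + C * E) + 3 * kap K) * (m:ℝ) ^ (1 - δ)) ≤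
      torsionOrder K * (Wn K m).card := by
    refine le_trans ?_ hs
    have h2 : 0 ≤ h' * (4 * E * J + C * E) * (m:ℝ) ^ (1 - δ) := by positivity
    have h3 : 0 ≤ 3 * kap K * (m:ℝ) ^ (1 - δ) := by positivity
    nlinarith
  exact le_of_mul_le_mul_left h1 (by linarith)

theorem sum_Wn (f : ℕ → ℝ) (z : ℝ) (hz : 0 ≤ z) : ∑ b ∈ Wn K z, f (Ideal.absNorm b) =
    ∑ k ∈ Finset.Icc 1 ⌊z⌋₊, (((Wn K k).filter fun b => Ideal.absNorm b = k).card : ℝ) * f k := by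
  rw [← Finset.sum_fiberwise_of_maps_to (t := Finset.Icc 1 ⌊z⌋₊) (g := fun b : Ideal (𝓞 K) => Ideal.absNorm b)]
  · refine Finset.sum_congr rfl fun k hk => ?_
    rw [Finset.mem_Icc] at hk
    rw [Finset.sum_congr rfl (g := fun _ => f k), Finset.sum_const, nsmul_eq_mul]
    · congr 3
      ext b
      simp only [Finset.mem_filter, mem_Wn hz, mem_Wn (Nat.cast_nonneg k)]
      constructor
      · rintro ⟨⟨h1, h2⟩, h3⟩
        exact ⟨⟨h1, by rw [h3]⟩, h3⟩
      · rintro ⟨⟨h1, h2⟩, h3⟩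
        exact ⟨⟨h1, by rw [h3]; exact (Nat.le_floor_iff hz).1 hk.2⟩, h3⟩
    · intro b hb
      rw [(Finset.mem_filter.1 hb).2]
  · intro b hb
    rw [mem_Wn hz] at hb
    rw [Finset.mem_Icc]
    exact ⟨by exact_mod_cast absNorm_pos hb.1, Nat.le_floor hb.2⟩

variable (K) in
theorem recip_sum : ∃ C : ℝ, 0 ≤ C ∧ ∀ z : ℝ, 1 ≤ z →
    kap K * Real.log z - C ≤ ∑ b ∈ Wn K z, (Ideal.absNorm b : ℝ)⁻¹ ∧
    ∑ b ∈ Wn K z, (Ideal.absNorm b : ℝ)⁻¹ ≤ C * (2 + Real.log z) := by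
  obtain ⟨C1, hC1, h1⟩ := wide_count K
  obtain ⟨C2, hC2, δ, hδ, h2⟩ := wide_lower K
  set a : ℕ → ℝ := fun k => (((Wn K k).filter fun b => Ideal.absNorm b = k).card : ℝ) with ha
  have hA : ∀ n : ℕ, ∑ k ∈ Finset.Icc 1 n, a k = (Wn K n).card := by
    intro n
    have := sum_Wn (K := K) (fun _ => 1) n (Nat.cast_nonneg n)
    simp only [Nat.floor_natCast, mul_one] at this
    rw [ha, ← this]; simp
  obtain ⟨C3, hC3, h3⟩ := abel_lower a (fun n => by positivity) (kap K) C2 δ kap_pos.le hC2 hδ (fun n hn => by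
    rw [hA]; exact h2 n hn)
  refine ⟨C3 + C1, by positivity, fun z hz => ?_⟩
  have hl : 0 ≤ Real.log z := Real.log_nonneg hz
  have e : ∑ b ∈ Wn K z, (Ideal.absNorm b : ℝ)⁻¹ = ∑ k ∈ Finset.Icc 1 ⌊z⌋₊, a k / k := by
    rw [sum_Wn (fun k => (k:ℝ)⁻¹) z (by linarith)]
    rfl
  rw [e]
  constructor
  · have := h3 z hz
    linarith
  · have := abel_upper a C1 hC1 (fun n hn => by rw [hA]; exact h1 n (by exact_mod_cast hn)) z hz
    nlinarith [mul_nonneg hC3 (by linarith : (0:ℝ) ≤ 2 + Real.log z)]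

end clsI
end BT


namespace BT
section clsJ
open NumberField NumberField.mixedEmbedding NumberField.InfinitePlace NumberField.Units
  NumberField.Units.dirichletUnitTheorem Module MeasureTheory
open scoped Classical nonZeroDivisors

variable {K : Type*} [Field K] [NumberField K]

theorem totpos_iff (α : 𝓞 K) : (∀ φ : K →+* ℝ, 0 < φ (algebraMap (𝓞 K) K α)) ↔ sg α = 1 := by
  constructor
  · intro h
    ext1 w
    unfold sg
    rw [mixedEmbedding_apply_isReal]
    exact sign_pos (h _)
  · intro h φ
    set ψ : K →+* ℂ := Complex.ofRealHom.comp φ with hψ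
    have hψr : ComplexEmbedding.IsReal ψ := by
      rw [ComplexEmbedding.isReal_iff]
      ext x
      simp [hψ, ComplexEmbedding.conjugate]
    have hw : IsReal (InfinitePlace.mk ψ) := ⟨ψ, hψr, rfl⟩
    have h1 := congrFun h ⟨_, hw⟩
    unfold sg at h1
    rw [mixedEmbedding_apply_isReal] at h1
    have h2 := sign_eq_one_iff.1 h1
    have h3 : ((embedding_of_isReal hw (α : K) : ℝ) : ℂ) = (φ (α : K) : ℂ) := by
      rw [embedding_of_isReal_apply, embedding_mk_eq_of_isReal hψr]
      rfl
    have h4 := Complex.ofReal_injective h3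
    rw [← h4]
    exact h2

theorem isUnit_gam (q : Ideal (𝓞 K)) {ξ : 𝓞 K} (h0 : ξ ≠ 0) (h : IsCoprime (Ideal.span {ξ}) q) : IsUnit (gam q ξ) := by
  rw [Prod.isUnit_iff, Pi.isUnit_iff]
  constructor
  · obtain ⟨a, ha, b, hb, hab⟩ := Ideal.isCoprime_iff_exists.1 h
    obtain ⟨r, rfl⟩ := Ideal.mem_span_singleton'.1 ha
    refine IsUnit.of_mul_eq_one (Ideal.Quotient.mk q r) ?_
    have h2 : Ideal.Quotient.mk q (ξ * r) = 1 := by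
      rw [← map_one (Ideal.Quotient.mk q), Ideal.Quotient.mk_eq_mk_iff_sub_mem]
      have : ξ * r - 1 = - b := by rw [← hab]; ring
      rw [this]; exact q.neg_mem hb
    rw [← h2, map_mul]; rfl
  · intro w
    exact isUnit_iff_ne_zero.2 ((mem_SgS _).1 (sg_ne_zero h0) w)

theorem exists_cofactor (q a : Ideal (𝓞 K)) (hq : q ≠ ⊥) (ha : a ≠ ⊥) : ∃ (ξ : 𝓞 K) (c : Ideal (𝓞 K)),
    ξ ≠ 0 ∧ c ≠ ⊥ ∧ IsCoprime c q ∧ a * c = Ideal.span {ξ} := by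
  by_cases hqt : q = ⊤
  · obtain ⟨ξ, hξ, h0⟩ := Submodule.exists_mem_ne_zero_of_ne_bot ha
    obtain ⟨c, hc⟩ := Ideal.dvd_iff_le.2 ((Ideal.span_singleton_le_iff_mem _).2 hξ)
    refine ⟨ξ, c, h0, ?_, by rw [hqt, Ideal.isCoprime_iff_sup_eq]; simp, hc.symm⟩
    rintro rfl
    rw [Ideal.mul_bot, Ideal.span_singleton_eq_bot] at hc
    exact h0 hc
  · obtain ⟨ξ, hξ⟩ := IsDedekindDomain.exists_sup_span_eq (I := a * q) (J := a) Ideal.mul_le_left (mul_ne_zero ha hq)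
    obtain ⟨c, hc⟩ := Ideal.dvd_iff_le.2 (le_of_le_of_eq le_sup_right hξ)
    have h1 : a * (q ⊔ c) = a * ⊤ := by
      rw [Ideal.mul_sup, ← hc, hξ, Ideal.mul_top]
    have h2 : q ⊔ c = ⊤ := mul_left_cancel₀ ha h1
    have hc0 : c ≠ ⊥ := by
      rintro rfl
      rw [sup_bot_eq] at h2
      exact hqt h2
    refine ⟨ξ, c, ?_, hc0, by rw [Ideal.isCoprime_iff_sup_eq, sup_comm, h2], hc.symm⟩
    rintro rfl
    rw [Ideal.span_singleton_eq_bot.2 rfl] at hc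
    exact mul_ne_zero ha hc0 hc.symm

/-- orbit of gam ξ under units -/
noncomputable def Orb (q : Ideal (𝓞 K)) (hq : q ≠ ⊥) (ξ : 𝓞 K) :
    Finset ((𝓞 K ⧸ q) × ({w : InfinitePlace K // IsReal w} → SignType)) :=
  have : Finite (𝓞 K ⧸ q) := Ideal.finiteQuotientOfFreeOfNeBot q hq
  (Set.toFinite (Set.range (fun u : (𝓞 K)ˣ => gam q ((u : 𝓞 K) * ξ)))).toFinset

theorem mem_Orb (q : Ideal (𝓞 K)) (hq : q ≠ ⊥) (ξ : 𝓞 K) (m) : m ∈ Orb q hq ξ ↔ ∃ u : (𝓞 K)ˣ, gam q ((u : 𝓞 K) * ξ) = m := by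
  simp [Orb]

theorem UInv_Orb (q : Ideal (𝓞 K)) (hq : q ≠ ⊥) (ξ : 𝓞 K) : UInv q (Orb q hq ξ) := by
  intro u m hm
  obtain ⟨v, rfl⟩ := (mem_Orb _ _ _ _).1 hm
  rw [mem_Orb]
  exact ⟨u * v, by rw [← gam_mul]; congr 1; push_cast; ring⟩

theorem sign_Orb (q : Ideal (𝓞 K)) (hq : q ≠ ⊥) (ξ : 𝓞 K) (hξ : ξ ≠ 0) : ∀ m ∈ Orb q hq ξ, ∀ w, m.2 w ≠ 0 := by
  intro m hm
  obtain ⟨v, rfl⟩ := (mem_Orb _ _ _ _).1 hm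
  exact (mem_SgS _).1 (sg_ne_zero (mul_ne_zero v.ne_zero hξ))

theorem Orb_pos (q : Ideal (𝓞 K)) (hq : q ≠ ⊥) (ξ : 𝓞 K) : 0 < (Orb q hq ξ).card :=
  Finset.card_pos.2 ⟨_, (mem_Orb _ _ _ _).2 ⟨1, rfl⟩⟩

theorem ray_mem_KK (q a c : Ideal (𝓞 K)) (hq : q ≠ ⊥) (ξ : 𝓞 K) (hc : a * c = Ideal.span {ξ})
    (hnd : q ≠ ⊤ ∨ Nonempty (K →+* ℝ)) (p : Ideal (𝓞 K)) (hp : p ≠ ⊥) (h : SameRayClass K q p a) :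
    p ∈ KK q c (Orb q hq ξ) := by
  obtain ⟨α, β, hα, hβ, hα', hβ', he⟩ := h
  have hα0 : α ≠ 0 := by
    rintro rfl
    rcases hnd with h | ⟨⟨φ⟩⟩
    · apply h
      rw [Ideal.eq_top_iff_one]
      simpa using hα
    · simpa using hα' φ
  have h1 : Ideal.span {α} * (p * c) = Ideal.span {β * ξ} := by
    rw [← mul_assoc, he, mul_assoc, hc, Ideal.span_singleton_mul_span_singleton]
  have h2 : β * ξ ∈ Ideal.span {α} := by
    have : Ideal.span {β * ξ} ≤ Ideal.span {α} := h1 ▸ Ideal.mul_le_left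
    exact (Ideal.span_singleton_le_iff_mem _).1 this
  obtain ⟨η, hη⟩ := Ideal.mem_span_singleton'.1 h2
  refine ⟨hp, η, ?_, ?_⟩
  · apply mul_left_cancel₀ (a := Ideal.span {α})
    · rwa [Ne, Ideal.zero_eq_bot, Ideal.span_singleton_eq_bot]
    · rw [h1, ← hη, Ideal.span_singleton_mul_span_singleton, mul_comm]
  · rw [mem_Orb]
    refine ⟨1, ?_⟩
    have e : ∀ γ : 𝓞 K, γ - 1 ∈ q → (∀ φ : K →+* ℝ, 0 < φ (algebraMap (𝓞 K) K γ)) → gam q γ = 1 := by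
      intro γ h1 h2
      ext1
      · exact (Ideal.Quotient.mk_eq_mk_iff_sub_mem _ _).2 h1
      · exact (totpos_iff γ).1 h2
    have h3 := congrArg (gam q) hη
    rw [gam_mul, gam_mul, e α hα hα', e β hβ hβ', mul_one, one_mul] at h3
    simp [h3]

theorem same_of_gam (q b b' c : Ideal (𝓞 K)) (β β' : 𝓞 K) (hc : c ≠ ⊥) (hβ0 : β ≠ 0) (hβ : b * c = Ideal.span {β})
    (hβ' : b' * c = Ideal.span {β'}) (hcop : IsCoprime (Ideal.span {β}) q) (hg : gam q β = gam q β') :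
    SameRayClass K q b b' := by
  have hs : ∃ s : 𝓞 K, s ≠ 0 ∧ Ideal.Quotient.mk q (s * β) = 1 := by
    by_cases hqt : q = ⊤
    · have : Subsingleton (𝓞 K ⧸ q) := Ideal.Quotient.subsingleton_iff.2 hqt
      exact ⟨1, one_ne_zero, Subsingleton.elim _ _⟩
    · have : Nontrivial (𝓞 K ⧸ q) := Ideal.Quotient.nontrivial_iff.2 hqt
      obtain ⟨y, hy⟩ := (Prod.isUnit_iff.1 (isUnit_gam q hβ0 hcop)).1.exists_left_inv
      obtain ⟨s, rfl⟩ := Ideal.Quotient.mk_surjective y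
      refine ⟨s, ?_, by rw [map_mul]; exact hy⟩
      rintro rfl
      rw [map_zero, zero_mul] at hy
      exact zero_ne_one hy
  obtain ⟨s, hs0, hs⟩ := hs
  have hq1 : Ideal.Quotient.mk q β = Ideal.Quotient.mk q β' := congrArg Prod.fst hg
  have hq2 : sg β = sg β' := congrArg Prod.snd hg
  have hsg : ∀ γ : 𝓞 K, γ ≠ 0 → sg γ * sg γ = 1 := by
    intro γ h
    ext1 w
    have := (mem_SgS _).1 (sg_ne_zero h) w
    simp only [Pi.mul_apply, Pi.one_apply]
    revert this
    generalize sg γ w = t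
    revert t; decide
  refine ⟨s * s * β * β', s * s * β * β, ?_, ?_, ?_, ?_, ?_⟩
  · rw [← Ideal.Quotient.mk_eq_mk_iff_sub_mem, map_mul, ← hq1, ← map_mul]
    rw [show s * s * β * β = (s * β) * (s * β) by ring, map_mul, hs, one_mul, map_one]
  · rw [← Ideal.Quotient.mk_eq_mk_iff_sub_mem]
    rw [show s * s * β * β = (s * β) * (s * β) by ring, map_mul, hs, one_mul, map_one]
  · rw [totpos_iff, sg_mul, sg_mul, sg_mul, ← hq2, hsg s hs0, one_mul, hsg β hβ0]
  · rw [totpos_iff, sg_mul, sg_mul, sg_mul, hsg s hs0, one_mul, hsg β hβ0]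
  · apply mul_right_cancel₀ (b := c) hc
    rw [mul_assoc _ b c, mul_assoc _ b' c, hβ, hβ', Ideal.span_singleton_mul_span_singleton, Ideal.span_singleton_mul_span_singleton]
    congr 2
    ring

theorem ray_card (q : Ideal (𝓞 K)) (hq : q ≠ ⊥) (ξ : 𝓞 K) (hξ0 : ξ ≠ 0) (hξ : IsCoprime (Ideal.span {ξ}) q) :
    0 < rayClassNumber K q ∧
    rayClassNumber K q * (Orb q hq ξ).card ≤ classNumber K * (Nat.card (𝓞 K ⧸ q)ˣ * (SgS K).card) := by
  have : Finite (𝓞 K ⧸ q) := Ideal.finiteQuotientOfFreeOfNeBot q hq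
  unfold rayClassNumber
  set R := Quot fun a b : {I : Ideal (𝓞 K) // I ≠ ⊥ ∧ IsCoprime I q} => SameRayClass K q a.1 b.1 with hR
  let cl : {I : Ideal (𝓞 K) // I ≠ ⊥ ∧ IsCoprime I q} → ClassGroup (𝓞 K) := fun I =>
    ClassGroup.mk0 ⟨I.1, mem_nonZeroDivisors_of_ne_zero I.2.1⟩
  have hne : Nonempty R := ⟨Quot.mk _ ⟨⊤, by simp, by rw [Ideal.isCoprime_iff_sup_eq]; simp⟩⟩
  have hcD : ∀ D : ClassGroup (𝓞 K), ∃ c : Ideal (𝓞 K), c ≠ ⊥ ∧ ((∃ I, cl I = D) → IsCoprime c q ∧ ∀ I, cl I = D → (I.1 * c).IsPrincipal) := by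
    intro D
    by_cases h : ∃ I, cl I = D
    · obtain ⟨I, hI⟩ := h
      obtain ⟨ξ', c, h0, hc0, hcop, he⟩ := exists_cofactor q I.1 hq I.2.1
      refine ⟨c, hc0, fun _ => ⟨hcop, fun I' hI' => ?_⟩⟩
      have h1 : ClassGroup.mk0 (⟨I.1 * c, mem_nonZeroDivisors_of_ne_zero (mul_ne_zero I.2.1 hc0)⟩ : (Ideal (𝓞 K))⁰) = 1 := by
        rw [ClassGroup.mk0_eq_one_iff, he]
        exact ⟨ξ', rfl⟩
      rw [← ClassGroup.mk0_eq_one_iff (mem_nonZeroDivisors_of_ne_zero (mul_ne_zero I'.2.1 hc0)), ← h1]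
      have e : ∀ J : {I : Ideal (𝓞 K) // I ≠ ⊥ ∧ IsCoprime I q}, ClassGroup.mk0 (⟨J.1 * c, mem_nonZeroDivisors_of_ne_zero (mul_ne_zero J.2.1 hc0)⟩ : (Ideal (𝓞 K))⁰)
        = cl J * ClassGroup.mk0 ⟨c, mem_nonZeroDivisors_of_ne_zero hc0⟩ := fun J => by
          rw [← map_mul]; rfl
      rw [e, e, hI, hI']
    · exact ⟨⊤, by simp, fun h' => absurd h' h⟩
  choose cD hcD0 hcD using hcD
  have hgen : ∀ r : R, ∃ β : 𝓞 K, r.out.1 * cD (cl r.out) = Ideal.span {β} := fun r => by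
    obtain ⟨β, hβ⟩ := (hcD _ ⟨r.out, rfl⟩).2 r.out rfl
    exact ⟨β, hβ⟩
  choose β hβ using hgen
  have hβ0 : ∀ r, β r ≠ 0 := by
    intro r h
    have := hβ r
    rw [h, Ideal.span_singleton_eq_bot.2 rfl] at this
    exact mul_ne_zero r.out.2.1 (hcD0 _) this
  have hβc : ∀ r, IsCoprime (Ideal.span {β r}) q := fun r => by
    rw [← hβ r]
    exact r.out.2.2.mul_left (hcD _ ⟨r.out, rfl⟩).1
  let f : R × Orb q hq ξ → ClassGroup (𝓞 K) × ((𝓞 K ⧸ q)ˣ × SgS K) := fun x =>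
    have hm : IsUnit (gam q (β x.1) * x.2.1) := (isUnit_gam q (hβ0 x.1) (hβc x.1)).mul (by
      obtain ⟨u, hu⟩ := (mem_Orb _ _ _ _).1 x.2.2
      rw [← hu]
      refine isUnit_gam q (mul_ne_zero u.ne_zero hξ0) ?_
      rwa [Ideal.span_singleton_mul_left_unit u.isUnit])
    (cl x.1.out, (Prod.isUnit_iff.1 hm).1.unit, ⟨(gam q (β x.1) * x.2.1).2, by
      rw [mem_SgS]; exact fun w => ((Pi.isUnit_iff.1 (Prod.isUnit_iff.1 hm).2) w).ne_zero⟩)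
  have hf : Function.Injective f := by
    rintro ⟨r, m, hm⟩ ⟨r', m', hm'⟩ he
    have e1 : cl r.out = cl r'.out := congrArg Prod.fst he
    have e2 : gam q (β r) * m = gam q (β r') * m' := by
      ext1
      · exact congrArg (fun y => (y.2.1 : 𝓞 K ⧸ q)) he
      · exact congrArg (fun y => (y.2.2 : {w : InfinitePlace K // IsReal w} → SignType)) he
    obtain ⟨u, hu⟩ := (mem_Orb _ _ _ _).1 hm
    obtain ⟨u', hu'⟩ := (mem_Orb _ _ _ _).1 hm'
    have e3 : gam q (u * β r) = gam q (u' * β r') := by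
      rw [← hu, ← hu', gam_mul, gam_mul, ← mul_assoc, ← mul_assoc] at e2
      have e4 := (isUnit_gam q hξ0 hξ).mul_right_cancel e2
      rw [gam_mul, gam_mul, mul_comm, e4, mul_comm]
    have hsame : SameRayClass K q r.out.1 r'.out.1 := by
      refine same_of_gam q _ _ (cD (cl r.out)) (u * β r) (u' * β r') (hcD0 _) (mul_ne_zero u.ne_zero (hβ0 r)) ?_ ?_ ?_ e3
      · rw [hβ, Ideal.span_singleton_mul_left_unit u.isUnit]
      · rw [e1, hβ, Ideal.span_singleton_mul_left_unit u'.isUnit]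
      · rw [Ideal.span_singleton_mul_left_unit u.isUnit]; exact hβc r
    have hrr : r = r' := by
      rw [← Quot.out_eq r, ← Quot.out_eq r']
      exact Quot.sound hsame
    subst hrr
    have := (isUnit_gam q (hβ0 r) (hβc r)).mul_left_cancel e2
    subst this
    rfl
  have hle := Nat.card_le_card_of_injective f hf
  have hfin : Finite (R × Orb q hq ξ) := Finite.of_injective f hf
  have hO : Nonempty (Orb q hq ξ) := (Finset.card_pos.1 (Orb_pos q hq ξ)).to_subtype
  have hRfin : Finite R := Finite.prod_left (Orb q hq ξ)
  refine ⟨Nat.card_pos, ?_⟩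
  simp only [Nat.card_prod] at hle
  have hcn : classNumber K = Nat.card (ClassGroup (𝓞 K)) := by
    rw [classNumber, Nat.card_eq_fintype_card]
  rw [hcn]
  simpa using hle

end clsJ
end BT


namespace BT
section clsK
open NumberField Module
open scoped Classical nonZeroDivisors

variable {K : Type*} [Field K] [NumberField K]

theorem one_lt_absNorm {p : Ideal (𝓞 K)} (hp : p.IsPrime) (hp0 : p ≠ ⊥) : (1:ℝ) < Ideal.absNorm p := by
  have h1 := absNorm_pos hp0
  refine lt_of_le_of_ne h1 (fun h => hp.ne_top ?_)
  rw [← Ideal.absNorm_eq_one_iff]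
  exact_mod_cast h.symm

theorem phi_le (q : Ideal (𝓞 K)) (hq : q ≠ ⊥) (Q : Finset (Ideal (𝓞 K)))
    (hQ : ∀ p ∈ Q, p.IsPrime ∧ p ≠ ⊥ ∧ p ∣ q) :
    (Nat.card (𝓞 K ⧸ q)ˣ : ℝ) ≤ Ideal.absNorm q * ∏ p ∈ Q, (1 - (Ideal.absNorm p : ℝ)⁻¹) := by
  have : Finite (𝓞 K ⧸ q) := Ideal.finiteQuotientOfFreeOfNeBot q hq
  letI : Fintype (𝓞 K ⧸ q) := Fintype.ofFinite _
  have hfp : ∀ p : Q, Finite (𝓞 K ⧸ p.1) := fun p => Ideal.finiteQuotientOfFreeOfNeBot p.1 (hQ p p.2).2.1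
  letI : ∀ p : Q, Fintype (𝓞 K ⧸ p.1) := fun p => Fintype.ofFinite _
  have hmax : ∀ p : Q, p.1.IsMaximal := fun p => (hQ p p.2).1.isMaximal (hQ p p.2).2.1
  let f : (𝓞 K ⧸ q) →+* (∀ p : Q, 𝓞 K ⧸ p.1) := Pi.ringHom (fun p => Ideal.Quotient.factor (Ideal.le_of_dvd (hQ p p.2).2.2))
  have hf : Function.Surjective f := by
    intro y
    obtain ⟨r, hr⟩ := Ideal.pi_quotient_surjective (I := fun p : Q => p.1) (by
      intro p p' hpp
      have := hmax p
      have := hmax p'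
      exact Ideal.isCoprime_of_isMaximal (fun h => hpp (Subtype.ext h))) y
    exact ⟨Ideal.Quotient.mk q r, funext hr⟩
  set k : ℕ := (Finset.univ.filter (fun g => f g = 0)).card with hk
  have hfib : ∀ y, (Finset.univ.filter (fun g => f g = y)).card = k := fun y =>
    AddMonoidHom.card_fiber_eq_of_mem_range f (hf y) (hf 0)
  have hc : ∀ p : Q, Fintype.card (𝓞 K ⧸ p.1) = Ideal.absNorm p.1 := fun p => by
    rw [Ideal.absNorm_apply, Submodule.cardQuot_apply, Nat.card_eq_fintype_card]
  have h1 : Ideal.absNorm q = (∏ p : Q, Ideal.absNorm p.1) * k := by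
    rw [Ideal.absNorm_apply, Submodule.cardQuot_apply, Nat.card_eq_fintype_card, ← Finset.card_univ]
    rw [Finset.card_eq_sum_card_fiberwise (f := f) (t := Finset.univ) (fun _ _ => Finset.mem_coe.2 (Finset.mem_univ _))]
    simp_rw [hfib]
    rw [Finset.sum_const, Finset.card_univ, Fintype.card_pi]
    simp_rw [hc]
    simp
  have h2 : Nat.card (𝓞 K ⧸ q)ˣ ≤ (∏ p : Q, (Ideal.absNorm p.1 - 1)) * k := by
    have e1 : Nat.card (𝓞 K ⧸ q)ˣ ≤ (Finset.univ.filter (fun g : 𝓞 K ⧸ q => ∀ p, f g p ≠ 0)).card := by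
      rw [Nat.card_eq_fintype_card, ← Finset.card_univ]
      refine Finset.card_le_card_of_injOn (fun u => (u : 𝓞 K ⧸ q)) ?_ (fun u _ v _ h => Units.ext h)
      intro u _
      simp only [Finset.coe_filter, Finset.mem_univ, true_and, Set.mem_ofPred_eq]
      intro p
      have := hmax p
      have : Nontrivial (𝓞 K ⧸ p.1) := Ideal.Quotient.nontrivial_iff.2 this.ne_top
      exact ((u.isUnit.map f).map (Pi.evalRingHom _ p)).ne_zero
    refine e1.trans ?_
    rw [Finset.card_eq_sum_card_fiberwise (f := f) (t := Fintype.piFinset (fun p : Q => (Finset.univ.erase (0 : 𝓞 K ⧸ p.1))))]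
    · refine (Finset.sum_le_card_nsmul _ _ k ?_).trans ?_
      · intro y _
        rw [← hfib y]
        exact Finset.card_le_card (Finset.filter_subset_filter _ (Finset.filter_subset _ _))
      · rw [Fintype.card_piFinset, smul_eq_mul]
        simp_rw [Finset.card_erase_of_mem (Finset.mem_univ _), Finset.card_univ, hc]
        exact le_rfl
    · intro g hg
      rw [Finset.mem_coe, Fintype.mem_piFinset]
      intro p
      simp only [Finset.coe_filter, Finset.mem_univ, true_and, Set.mem_ofPred_eq] at hg
      rw [Finset.mem_erase]
      exact ⟨hg p, Finset.mem_univ _⟩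
  have h3 : (Nat.card (𝓞 K ⧸ q)ˣ : ℝ) ≤ (∏ p : Q, ((Ideal.absNorm p.1 : ℝ) - 1)) * k := by
    have : ((∏ p : Q, (Ideal.absNorm p.1 - 1) : ℕ) : ℝ) = ∏ p : Q, ((Ideal.absNorm p.1 : ℝ) - 1) := by
      rw [Nat.cast_prod]
      refine Finset.prod_congr rfl fun p _ => ?_
      rw [Nat.cast_sub, Nat.cast_one]
      exact_mod_cast absNorm_pos (hQ p p.2).2.1
    rw [← this]; exact_mod_cast h2
  refine h3.trans (le_of_eq ?_)
  rw [h1, ← Finset.prod_coe_sort Q (fun p => 1 - (Ideal.absNorm p : ℝ)⁻¹)]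
  push_cast
  rw [mul_right_comm, ← Finset.prod_mul_distrib]
  congr 1
  refine Finset.prod_congr rfl fun p _ => ?_
  have := absNorm_pos (hQ p p.2).2.1
  field_simp

/-- prime ideals dividing m -/
noncomputable def pf (m : Ideal (𝓞 K)) : Finset (Ideal (𝓞 K)) := (UniqueFactorizationMonoid.normalizedFactors m).toFinset

theorem pf_spec {m p : Ideal (𝓞 K)} (h : p ∈ pf m) : p.IsPrime ∧ p ≠ ⊥ ∧ p ∣ m := by
  rw [pf, Multiset.mem_toFinset] at h
  have h1 := UniqueFactorizationMonoid.prime_of_normalized_factor p h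
  exact ⟨Ideal.isPrime_of_prime h1, h1.ne_zero, UniqueFactorizationMonoid.dvd_of_mem_normalizedFactors h⟩

theorem absNorm_fac {m : Ideal (𝓞 K)} (hm : m ≠ ⊥) : (Ideal.absNorm m : ℝ) =
    ∏ p ∈ pf m, (Ideal.absNorm p : ℝ) ^ (UniqueFactorizationMonoid.normalizedFactors m).count p := by
  conv_lhs => rw [← prod_normalizedFactors_eq_self hm]
  rw [map_multiset_prod, Finset.prod_multiset_map_count]
  push_cast
  rfl

theorem fibre_le (M : Finset (Ideal (𝓞 K))) (d : Finset (Ideal (𝓞 K))) (hM : ∀ m ∈ M, m ≠ ⊥ ∧ pf m = d)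
    (hd : ∀ p ∈ d, (1:ℝ) < Ideal.absNorm p) :
    ∑ m ∈ M, (Ideal.absNorm m : ℝ)⁻¹ ≤ ∏ p ∈ d, ((Ideal.absNorm p : ℝ) - 1)⁻¹ := by
  set L : ℕ := M.sup (fun m => (UniqueFactorizationMonoid.normalizedFactors m).card) with hL
  let φ : Ideal (𝓞 K) → (d → ℕ) := fun m p => (UniqueFactorizationMonoid.normalizedFactors m).count p.1
  let G : (d → ℕ) → ℝ := fun e => ∏ p : d, ((Ideal.absNorm p.1 : ℝ)⁻¹) ^ e p
  have h1 : ∀ m ∈ M, (Ideal.absNorm m : ℝ)⁻¹ = G (φ m) := by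
    intro m hm
    rw [absNorm_fac (hM m hm).1, (hM m hm).2, ← Finset.prod_inv_distrib, ← Finset.prod_coe_sort d]
    exact Finset.prod_congr rfl fun p _ => by rw [inv_pow]
  have hinj : Set.InjOn φ M := by
    intro m hm m' hm' h
    rw [← prod_normalizedFactors_eq_self (hM m hm).1, ← prod_normalizedFactors_eq_self (hM m' hm').1]
    congr 1
    ext p
    by_cases hp : p ∈ d
    · exact congrFun h ⟨p, hp⟩
    · rw [Multiset.count_eq_zero_of_notMem, Multiset.count_eq_zero_of_notMem]
      · intro h'; apply hp; rw [← (hM m' hm').2]; exact Multiset.mem_toFinset.2 h'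
      · intro h'; apply hp; rw [← (hM m hm).2]; exact Multiset.mem_toFinset.2 h'
  rw [Finset.sum_congr rfl h1, ← Finset.sum_image (f := G) hinj]
  have hG : ∀ e, 0 ≤ G e := fun e => Finset.prod_nonneg fun p _ => by positivity
  calc ∑ e ∈ M.image φ, G e ≤ ∑ e ∈ Fintype.piFinset (fun _ : d => Finset.Icc 1 L), G e := by
        refine Finset.sum_le_sum_of_subset_of_nonneg ?_ (fun _ _ _ => hG _)
        intro e he
        obtain ⟨m, hm, rfl⟩ := Finset.mem_image.1 he
        rw [Fintype.mem_piFinset]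
        intro p
        rw [Finset.mem_Icc]
        constructor
        · rw [Nat.one_le_iff_ne_zero]
          have hp : p.1 ∈ pf m := by rw [(hM m hm).2]; exact p.2
          exact Multiset.count_ne_zero.2 (Multiset.mem_toFinset.1 hp)
        · exact (Multiset.count_le_card _ _).trans (Finset.le_sup (f := fun m => (UniqueFactorizationMonoid.normalizedFactors m).card) hm)
    _ = ∏ p : d, ∑ k ∈ Finset.Icc 1 L, ((Ideal.absNorm p.1 : ℝ)⁻¹) ^ k := by
        rw [Finset.prod_univ_sum]
    _ ≤ ∏ p : d, ((Ideal.absNorm p.1 : ℝ) - 1)⁻¹ := by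
        refine Finset.prod_le_prod (fun _ _ => Finset.sum_nonneg fun _ _ => by positivity) (fun p _ => ?_)
        have hp := hd p p.2
        set t : ℝ := (Ideal.absNorm p.1 : ℝ)
        have hpos : 0 < t - 1 := by linarith
        have hsum : ∀ L : ℕ, (∑ k ∈ Finset.Icc 1 L, (t⁻¹) ^ k) * (t - 1) = 1 - (t⁻¹) ^ L := by
          intro L
          induction L with
          | zero => simp
          | succ L ih =>
            rw [Finset.sum_Icc_succ_top (by omega), add_mul, ih, pow_succ]
            field_simp
            ring
        rw [← one_div (t - 1), le_div_iff₀ hpos, hsum]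
        have : 0 ≤ (t⁻¹) ^ L := by positivity
        linarith
    _ = _ := Finset.prod_coe_sort d (fun p => ((Ideal.absNorm p : ℝ) - 1)⁻¹)

theorem selberg_lower (q : Ideal (𝓞 K)) (z : ℝ) (hz : 1 ≤ z) :
    (∑ m ∈ Wn K z, (Ideal.absNorm m : ℝ)⁻¹) *
      ∏ p ∈ (Wn K z).filter (fun p => p.IsPrime ∧ p ∣ q), (1 - (Ideal.absNorm p : ℝ)⁻¹) ≤
    selS ((Wn K z).filter (fun p => p.IsPrime ∧ ¬ p ∣ q)) (fun p => (Ideal.absNorm p : ℝ)) z := by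
  have hz0 : 0 ≤ z := by linarith
  set P := (Wn K z).filter (fun p => p.IsPrime ∧ ¬ p ∣ q) with hP
  set Q := (Wn K z).filter (fun p => p.IsPrime ∧ p ∣ q) with hQ
  set N : Ideal (𝓞 K) → ℝ := fun p => (Ideal.absNorm p : ℝ) with hN
  have hA : ∀ p ∈ P ∪ Q, p.IsPrime ∧ p ≠ ⊥ ∧ 1 < N p := by
    intro p hp
    have : p.IsPrime ∧ p ≠ ⊥ := by
      rw [Finset.mem_union, hP, hQ, Finset.mem_filter, Finset.mem_filter, mem_Wn hz0] at hp
      tauto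
    exact ⟨this.1, this.2, one_lt_absNorm this.1 this.2⟩
  have hpfz : ∀ m ∈ Wn K z, pf m ⊆ P ∪ Q ∧ ∏ p ∈ pf m, N p ≤ z := by
    intro m hm
    rw [mem_Wn hz0] at hm
    constructor
    · intro p hp
      have h1 := pf_spec hp
      have h2 : (Ideal.absNorm p : ℝ) ≤ z := by
        refine le_trans ?_ hm.2
        have := Nat.le_of_dvd (by exact_mod_cast absNorm_pos hm.1) (map_dvd Ideal.absNorm h1.2.2)
        exact_mod_cast this
      rw [Finset.mem_union, hP, hQ, Finset.mem_filter, Finset.mem_filter, mem_Wn hz0]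
      tauto
    · refine le_trans ?_ hm.2
      rw [absNorm_fac hm.1]
      refine Finset.prod_le_prod (fun _ _ => by positivity) (fun p hp => ?_)
      have h1 := pf_spec hp
      refine le_self_pow₀ (absNorm_pos h1.2.1) (Multiset.count_ne_zero.2 (Multiset.mem_toFinset.1 hp))
  have s1 : ∑ m ∈ Wn K z, (Ideal.absNorm m : ℝ)⁻¹ ≤ selS (P ∪ Q) N z := by
    rw [selS, ← Finset.sum_fiberwise_of_maps_to (t := (P ∪ Q).powerset.filter (fun d => ∏ p ∈ d, N p ≤ z)) (g := pf)]
    · refine Finset.sum_le_sum fun d hd => ?_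
      rw [Finset.mem_filter, Finset.mem_powerset] at hd
      refine fibre_le _ d ?_ (fun p hp => (hA p (hd.1 hp)).2.2)
      intro m hm
      rw [Finset.mem_filter, mem_Wn hz0] at hm
      exact ⟨hm.1.1, hm.2⟩
    · intro m hm
      rw [Finset.mem_filter, Finset.mem_powerset]
      exact hpfz m hm
  have hQN : ∀ p ∈ Q, 1 < N p := fun p hp => (hA p (Finset.mem_union_right _ hp)).2.2
  have hPN : ∀ p ∈ P, 1 < N p := fun p hp => (hA p (Finset.mem_union_left _ hp)).2.2
  have s2 : selS (P ∪ Q) N z ≤ selS P N z * ∏ p ∈ Q, (1 + (N p - 1)⁻¹) := by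
    have hdisj : Disjoint P Q := by
      rw [Finset.disjoint_left]
      intro p h1 h2
      rw [hP, Finset.mem_filter] at h1
      rw [hQ, Finset.mem_filter] at h2
      exact h1.2.2 h2.2.2
    rw [Finset.prod_one_add, selS, selS, Finset.sum_mul_sum, ← Finset.sum_product']
    let g : Finset (Ideal (𝓞 K)) → Finset (Ideal (𝓞 K)) × Finset (Ideal (𝓞 K)) := fun d => (d ∩ P, d ∩ Q)
    let F : Finset (Ideal (𝓞 K)) × Finset (Ideal (𝓞 K)) → ℝ := fun x => (∏ p ∈ x.1, (N p - 1)⁻¹) * ∏ p ∈ x.2, (N p - 1)⁻¹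
    have hdd : ∀ d, d ⊆ P ∪ Q → (d ∩ P) ∪ (d ∩ Q) = d := by
      intro d hd
      rw [← Finset.inter_union_distrib_left]
      exact Finset.inter_eq_left.2 hd
    have h1 : ∀ d ∈ (P ∪ Q).powerset.filter (fun d => ∏ p ∈ d, N p ≤ z), ∏ p ∈ d, (N p - 1)⁻¹ = F (g d) := by
      intro d hd
      rw [Finset.mem_filter, Finset.mem_powerset] at hd
      simp only [F, g]
      rw [← Finset.prod_union (hdisj.mono Finset.inter_subset_right Finset.inter_subset_right), hdd d hd.1]
    have hginj : Set.InjOn g ((P ∪ Q).powerset.filter (fun d => ∏ p ∈ d, N p ≤ z)) := by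
      intro d hd e he h
      rw [Finset.mem_coe, Finset.mem_filter, Finset.mem_powerset] at hd he
      rw [← hdd d hd.1, ← hdd e he.1, show d ∩ P = e ∩ P from congrArg Prod.fst h, show d ∩ Q = e ∩ Q from congrArg Prod.snd h]
    rw [Finset.sum_congr rfl h1, ← Finset.sum_image (f := F) hginj]
    refine Finset.sum_le_sum_of_subset_of_nonneg ?_ ?_
    · intro x hx
      obtain ⟨d, hd, rfl⟩ := Finset.mem_image.1 hx
      rw [Finset.mem_filter, Finset.mem_powerset] at hd
      rw [Finset.mem_product, Finset.mem_filter, Finset.mem_powerset, Finset.mem_powerset]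
      refine ⟨⟨Finset.inter_subset_right, le_trans ?_ hd.2⟩, Finset.inter_subset_right⟩
      exact prod_mono_of Finset.inter_subset_left (fun p hp => (hA p (hd.1 hp)).2.2)
    · intro x hx _
      rw [Finset.mem_product, Finset.mem_filter, Finset.mem_powerset, Finset.mem_powerset] at hx
      refine mul_nonneg (Finset.prod_nonneg fun p hp => ?_) (Finset.prod_nonneg fun p hp => ?_)
      · exact inv_nonneg.2 (by linarith [hPN p (hx.1.1 hp)])
      · exact inv_nonneg.2 (by linarith [hQN p (hx.2 hp)])
  have hpr : (∏ p ∈ Q, (1 + (N p - 1)⁻¹)) * ∏ p ∈ Q, (1 - (N p)⁻¹) = 1 := by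
    rw [← Finset.prod_mul_distrib]
    refine Finset.prod_eq_one fun p hp => ?_
    have h1 := hQN p hp
    have h2 : N p - 1 ≠ 0 := by linarith
    have h3 : N p ≠ 0 := by linarith
    field_simp
    ring
  have hnn : 0 ≤ ∏ p ∈ Q, (1 - (N p)⁻¹) := Finset.prod_nonneg fun p hp => by
    have := inv_le_one_of_one_le₀ (hQN p hp).le
    linarith
  calc _ ≤ (selS P N z * ∏ p ∈ Q, (1 + (N p - 1)⁻¹)) * ∏ p ∈ Q, (1 - (N p)⁻¹) :=
        mul_le_mul_of_nonneg_right (s1.trans s2) hnn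
    _ = _ := by rw [mul_assoc, hpr, mul_one]

end clsK
end BT


namespace BT
section clsL
open NumberField NumberField.mixedEmbedding NumberField.InfinitePlace NumberField.Units Module MeasureTheory
open scoped Classical nonZeroDivisors

variable {K : Type*} [Field K] [NumberField K]

theorem prod_dvd_iff' {d : Finset (Ideal (𝓞 K))} (hd : ∀ p ∈ d, p.IsPrime ∧ p ≠ ⊥) (b : Ideal (𝓞 K)) :
    ∏ p ∈ d, p ∣ b ↔ ∀ p ∈ d, p ∣ b := by
  constructor
  · intro h p hp
    exact (Finset.dvd_prod_of_mem (fun p => p) hp).trans h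
  · intro h
    exact Finset.prod_primes_dvd b (fun p hp => Ideal.prime_of_isPrime (hd p hp).2 (hd p hp).1) h

theorem prod_coprime' {d : Finset (Ideal (𝓞 K))} {q : Ideal (𝓞 K)} (hd : ∀ p ∈ d, p.IsPrime ∧ p ≠ ⊥ ∧ ¬ p ∣ q) :
    IsCoprime (∏ p ∈ d, p) q := by
  refine IsCoprime.prod_left (fun p hp => ?_)
  have hm := (hd p hp).1.isMaximal (hd p hp).2.1
  rw [Ideal.isCoprime_iff_sup_eq]
  refine hm.1.2 _ (lt_of_le_of_ne le_sup_left fun h => (hd p hp).2.2 ?_)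
  rw [Ideal.dvd_iff_le, h]
  exact le_sup_right

theorem prod_ne_bot' {d : Finset (Ideal (𝓞 K))} (hd : ∀ p ∈ d, p ≠ ⊥) : ∏ p ∈ d, p ≠ ⊥ :=
  Finset.prod_ne_zero_iff.2 hd

theorem absNorm_prod' (d : Finset (Ideal (𝓞 K))) :
    (Ideal.absNorm (∏ p ∈ d, p) : ℝ) = ∏ p ∈ d, (Ideal.absNorm p : ℝ) := by
  rw [map_prod, Nat.cast_prod]

theorem pf_prod {d : Finset (Ideal (𝓞 K))} (hd : ∀ p ∈ d, p.IsPrime ∧ p ≠ ⊥) (p : Ideal (𝓞 K))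
    (hp : p.IsPrime ∧ p ≠ ⊥) : p ∣ ∏ p ∈ d, p ↔ p ∈ d := by
  constructor
  · intro h
    obtain ⟨r, hr, h2⟩ := (Ideal.prime_of_isPrime hp.2 hp.1).exists_mem_finset_dvd h
    have h3 : r ≤ p := Ideal.dvd_iff_le.1 h2
    have := ((hd r hr).1.isMaximal (hd r hr).2).eq_of_le hp.1.ne_top h3
    rwa [← this]
  · exact fun h => Finset.dvd_prod_of_mem (fun p => p) h

theorem D_sum_le (P : Finset (Ideal (𝓞 K))) (hP : ∀ p ∈ P, p.IsPrime ∧ p ≠ ⊥) (z : ℝ) (hz : 1 ≤ z) :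
    ∑ d ∈ P.powerset with ∏ p ∈ d, (Ideal.absNorm p : ℝ) ≤ z, (∏ p ∈ d, (Ideal.absNorm p : ℝ))⁻¹ ≤
      ∑ m ∈ Wn K z, (Ideal.absNorm m : ℝ)⁻¹ := by
  have hinj : Set.InjOn (fun d : Finset (Ideal (𝓞 K)) => ∏ p ∈ d, p)
      (P.powerset.filter (fun d => ∏ p ∈ d, (Ideal.absNorm p : ℝ) ≤ z)) := by
    intro d hd e he h
    rw [Finset.mem_coe, Finset.mem_filter, Finset.mem_powerset] at hd he
    have h' : ∏ p ∈ d, p = ∏ p ∈ e, p := h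
    ext p
    constructor
    · intro hp
      rw [← pf_prod (fun p hp => hP p (he.1 hp)) p (hP p (hd.1 hp)), ← h',
        pf_prod (fun p hp => hP p (hd.1 hp)) p (hP p (hd.1 hp))]
      exact hp
    · intro hp
      rw [← pf_prod (fun p hp => hP p (hd.1 hp)) p (hP p (he.1 hp)), h',
        pf_prod (fun p hp => hP p (he.1 hp)) p (hP p (he.1 hp))]
      exact hp
  have : ∀ d ∈ P.powerset.filter (fun d => ∏ p ∈ d, (Ideal.absNorm p : ℝ) ≤ z),
      (∏ p ∈ d, (Ideal.absNorm p : ℝ))⁻¹ = (fun m : Ideal (𝓞 K) => (Ideal.absNorm m : ℝ)⁻¹) (∏ p ∈ d, p) := by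
    intro d _
    simp only []
    rw [absNorm_prod']
  rw [Finset.sum_congr rfl this, ← Finset.sum_image (f := fun m : Ideal (𝓞 K) => (Ideal.absNorm m : ℝ)⁻¹) hinj]
  refine Finset.sum_le_sum_of_subset_of_nonneg ?_ (fun _ _ _ => by positivity)
  intro m hm
  obtain ⟨d, hd, rfl⟩ := Finset.mem_image.1 hm
  rw [Finset.mem_filter, Finset.mem_powerset] at hd
  rw [mem_Wn (by linarith), absNorm_prod']
  exact ⟨prod_ne_bot' fun p hp => (hP p (hd.1 hp)).2, hd.2⟩

theorem expand_sq {ι β : Type*} (B : Finset β) (w : β → ℝ) (A : Finset ι) (lam : ι → ℝ) (R : ι → β → Prop)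
    [∀ d b, Decidable (R d b)] :
    ∑ b ∈ B, w b * (∑ d ∈ A with R d b, lam d) ^ 2 =
      ∑ d₁ ∈ A, ∑ d₂ ∈ A, lam d₁ * lam d₂ * ∑ b ∈ B with (R d₁ b ∧ R d₂ b), w b := by
  have h1 : ∀ b ∈ B, w b * (∑ d ∈ A with R d b, lam d) ^ 2 =
      ∑ d₁ ∈ A, ∑ d₂ ∈ A, if R d₁ b ∧ R d₂ b then lam d₁ * lam d₂ * w b else 0 := by
    intro b _
    rw [sq, Finset.sum_filter, Finset.sum_mul_sum, Finset.mul_sum]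
    refine Finset.sum_congr rfl fun d₁ _ => ?_
    rw [Finset.mul_sum]
    refine Finset.sum_congr rfl fun d₂ _ => ?_
    by_cases h : R d₁ b <;> by_cases h' : R d₂ b <;> simp [h, h']
    ring
  rw [Finset.sum_congr rfl h1, Finset.sum_comm]
  refine Finset.sum_congr rfl fun d₁ _ => ?_
  rw [Finset.sum_comm]
  refine Finset.sum_congr rfl fun d₂ _ => ?_
  rw [Finset.mul_sum, Finset.sum_filter]

variable (K) in
set_option maxHeartbeats 1600000 in
theorem sieve_raw : ∃ C : ℝ, 0 ≤ C ∧ ∀ (q c : Ideal (𝓞 K))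
    (Ω : Finset ((𝓞 K ⧸ q) × ({w : InfinitePlace K // IsReal w} → SignType))), q ≠ ⊥ → c ≠ ⊥ →
    IsCoprime c q → UInv q Ω → (∀ m ∈ Ω, ∀ w, m.2 w ≠ 0) → ∀ x ε z : ℝ, 0 < ε → ε ≤ 1 → 1 ≤ z →
    z ^ 2 * Ideal.absNorm q ≤ x →
    ∃ lam : Finset (Ideal (𝓞 K)) → ℝ, lam ∅ = 1 ∧
    (torsionOrder K : ℝ) * ∑ b ∈ Bf q c Ω (3 * x), wcut ε (Real.log (Ideal.absNorm b / x)) *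
      (∑ d ∈ ((Wn K z).filter (fun p => p.IsPrime ∧ ¬ p ∣ q)).powerset with (∀ p ∈ d, p ∣ b), lam d) ^ 2 ≤
    Ω.card * (x / Ideal.absNorm q * ((∫ v, Gw (K := K) ε 1 v) / V0 K)) *
      (selS ((Wn K z).filter (fun p => p.IsPrime ∧ ¬ p ∣ q)) (fun p => (Ideal.absNorm p : ℝ)) z)⁻¹ +
    C * Ω.card * (ε⁻¹) ^ 2 * (x / Ideal.absNorm q) *
      (z ^ 2 / (x / Ideal.absNorm q)) ^ ((finrank ℚ K : ℝ)⁻¹) * (∑ m ∈ Wn K z, (Ideal.absNorm m : ℝ)⁻¹) ^ 3 := by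
  obtain ⟨C, hC, h⟩ := class_smooth K
  refine ⟨C, hC, fun q c Ω hq hc hcop hU hσ x ε z h0 h1 hz hx => ?_⟩
  set P := (Wn K z).filter (fun p => p.IsPrime ∧ ¬ p ∣ q) with hP
  have hP' : ∀ p ∈ P, p.IsPrime ∧ p ≠ ⊥ ∧ ¬ p ∣ q := by
    intro p hp
    rw [hP, Finset.mem_filter, mem_Wn (by linarith)] at hp
    exact ⟨hp.2.1, hp.1.1, hp.2.2⟩
  have hPN : ∀ p ∈ P, (1:ℝ) < Ideal.absNorm p := fun p hp => one_lt_absNorm (hP' p hp).1 (hP' p hp).2.1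
  obtain ⟨lam, hl1, hl2, hl3, hl4⟩ := selberg_weights P (fun p => (Ideal.absNorm p : ℝ)) hPN z hz
  refine ⟨lam, hl1, ?_⟩
  obtain ⟨n, hn⟩ : ∃ n : ℝ, n = (finrank ℚ K : ℝ)⁻¹ := ⟨_, rfl⟩
  have hn0 : 0 ≤ n := by rw [hn]; positivity
  obtain ⟨t, ht⟩ : ∃ t : ℝ, t = (torsionOrder K : ℝ) := ⟨_, rfl⟩
  obtain ⟨I, hI⟩ : ∃ I : ℝ, I = (∫ v, Gw (K := K) ε 1 v) / V0 K := ⟨_, rfl⟩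
  obtain ⟨O, hO⟩ : ∃ O : ℝ, O = (Ω.card : ℝ) := ⟨_, rfl⟩
  have hO0 : 0 ≤ O := by rw [hO]; positivity
  obtain ⟨Q, hQ⟩ : ∃ Q : ℝ, Q = (Ideal.absNorm q : ℝ) := ⟨_, rfl⟩
  have hQ1 : 1 ≤ Q := by rw [hQ]; exact absNorm_pos hq
  have h' := h ε h0 h1 q c
  simp only [← hn, ← ht, ← hI] at h' ⊢
  rw [← hO, ← hQ]
  rw [← hQ] at hx
  have hxp : 0 < x := by nlinarith
  rw [expand_sq (Bf q c Ω (3 * x)) (fun b => wcut ε (Real.log (Ideal.absNorm b / x))) P.powerset lam (fun d b => ∀ p ∈ d, p ∣ b)]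
  set Wd : Finset (Ideal (𝓞 K)) → Finset (Ideal (𝓞 K)) → ℝ := fun d₁ d₂ =>
    ∑ b ∈ Bf q c Ω (3 * x) with ((∀ p ∈ d₁, p ∣ b) ∧ (∀ p ∈ d₂, p ∣ b)), wcut ε (Real.log (Ideal.absNorm b / x)) with hW
  have key : ∀ d₁ ∈ P.powerset, ∀ d₂ ∈ P.powerset, ∏ p ∈ d₁, (Ideal.absNorm p : ℝ) ≤ z → ∏ p ∈ d₂, (Ideal.absNorm p : ℝ) ≤ z →
      |t * Wd d₁ d₂ - O * (x / Q * I) * (∏ p ∈ d₁ ∪ d₂, (Ideal.absNorm p : ℝ))⁻¹| ≤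
      C * O * (ε⁻¹) ^ 2 * (x / Q) * (z ^ 2 / (x / Q)) ^ n * (∏ p ∈ d₁ ∪ d₂, (Ideal.absNorm p : ℝ))⁻¹ := by
    intro d₁ hd₁ d₂ hd₂ hz₁ hz₂
    rw [Finset.mem_powerset] at hd₁ hd₂
    have hu : d₁ ∪ d₂ ⊆ P := Finset.union_subset hd₁ hd₂
    have hp1 : ∀ p ∈ d₁ ∪ d₂, (1:ℝ) < Ideal.absNorm p := fun p hp => hPN p (hu hp)
    have hM1 : 1 ≤ ∏ p ∈ d₁ ∪ d₂, (Ideal.absNorm p : ℝ) := one_le_prod_of hp1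
    have hMz : ∏ p ∈ d₁ ∪ d₂, (Ideal.absNorm p : ℝ) ≤ z ^ 2 := by
      rw [← Finset.sdiff_union_self_eq_union, Finset.prod_union Finset.sdiff_disjoint, sq]
      refine mul_le_mul ((prod_mono_of Finset.sdiff_subset (fun p hp => hPN p (hd₁ hp))).trans hz₁) hz₂ ?_ (by linarith)
      exact Finset.prod_nonneg fun _ _ => by positivity
    obtain ⟨M, hM⟩ : ∃ M : ℝ, M = ∏ p ∈ d₁ ∪ d₂, (Ideal.absNorm p : ℝ) := ⟨_, rfl⟩
    have := h' (∏ p ∈ d₁ ∪ d₂, p) Ω hq hc (prod_ne_bot' fun p hp => (hP' p (hu hp)).2.1)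
      (hcop.mul_left (prod_coprime' fun p hp => hP' p (hu hp))) hU hσ x (by
        rw [absNorm_prod', ← hQ]
        exact le_trans (mul_le_mul_of_nonneg_right hMz (by linarith)) hx)
    rw [absNorm_prod', ← hO, ← hQ, ← hM] at this
    rw [← hM] at hM1 hMz ⊢
    have hfil : (Bf q c Ω (3 * x)).filter (fun b => ∏ p ∈ d₁ ∪ d₂, p ∣ b) =
        (Bf q c Ω (3 * x)).filter (fun b => (∀ p ∈ d₁, p ∣ b) ∧ (∀ p ∈ d₂, p ∣ b)) := by
      refine Finset.filter_congr fun b _ => ?_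
      rw [prod_dvd_iff' fun p hp => ⟨(hP' p (hu hp)).1, (hP' p (hu hp)).2.1⟩]
      simp only [Finset.mem_union]
      constructor
      · exact fun h => ⟨fun p hp => h p (Or.inl hp), fun p hp => h p (Or.inr hp)⟩
      · rintro ⟨h1, h2⟩ p (hp | hp)
        exacts [h1 p hp, h2 p hp]
    rw [hfil] at this
    have e1 : O * (x / (M * Q) * I) = O * (x / Q * I) * M⁻¹ := by field_simp
    rw [e1] at this
    refine this.trans ?_
    have e2 : C * O * ε⁻¹ ^ 2 * (x / Q) * (z ^ 2 / (x / Q)) ^ n * M⁻¹ =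
      C * O * ε⁻¹ ^ 2 * (x / (M * Q)) * (z ^ 2 / (x / Q)) ^ n := by field_simp
    rw [e2]
    have hMp : 0 < M := by linarith
    refine mul_le_mul_of_nonneg_left (Real.rpow_le_rpow (by positivity) ?_ hn0) (by positivity)
    have e3 : z ^ 2 / (x / Q) = z ^ 2 * Q / x := by field_simp
    rw [e3]
    gcongr
  have hz1 : ∀ d, lam d ≠ 0 → ∏ p ∈ d, (Ideal.absNorm p : ℝ) ≤ z := fun d hd => (hl2 d hd).2
  obtain ⟨A, hA⟩ : ∃ A : ℝ, A = C * O * (ε⁻¹) ^ 2 * (x / Q) * (z ^ 2 / (x / Q)) ^ n := ⟨_, rfl⟩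
  have hA0 : 0 ≤ A := by rw [hA]; positivity
  obtain ⟨Bc, hB⟩ : ∃ A : ℝ, A = O * (x / Q * I) := ⟨_, rfl⟩
  simp only [← hA, ← hB] at key ⊢
  have step : t * ∑ d₁ ∈ P.powerset, ∑ d₂ ∈ P.powerset, lam d₁ * lam d₂ * Wd d₁ d₂ ≤
      Bc * (∑ d₁ ∈ P.powerset, ∑ d₂ ∈ P.powerset, lam d₁ * lam d₂ * (∏ p ∈ d₁ ∪ d₂, (Ideal.absNorm p : ℝ))⁻¹) +
      A * ∑ d₁ ∈ P.powerset with ∏ p ∈ d₁, (Ideal.absNorm p : ℝ) ≤ z, ∑ d₂ ∈ P.powerset with ∏ p ∈ d₂, (Ideal.absNorm p : ℝ) ≤ z,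
      (∏ p ∈ d₁ ∪ d₂, (Ideal.absNorm p : ℝ))⁻¹ := by
    simp only [Finset.sum_filter]
    rw [Finset.mul_sum, Finset.mul_sum, Finset.mul_sum, ← Finset.sum_add_distrib]
    refine Finset.sum_le_sum fun d₁ hd₁ => ?_
    by_cases c1 : ∏ p ∈ d₁, (Ideal.absNorm p : ℝ) ≤ z
    · rw [if_pos c1, Finset.mul_sum, Finset.mul_sum, Finset.mul_sum, ← Finset.sum_add_distrib]
      refine Finset.sum_le_sum fun d₂ hd₂ => ?_
      by_cases c2 : ∏ p ∈ d₂, (Ideal.absNorm p : ℝ) ≤ z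
      · rw [if_pos c2]
        have hk := key d₁ hd₁ d₂ hd₂ c1 c2
        have hll : |lam d₁ * lam d₂| ≤ 1 := by
          rw [abs_mul]; exact mul_le_one₀ (hl3 _) (abs_nonneg _) (hl3 _)
        have := mul_le_mul hll hk (abs_nonneg _) zero_le_one
        rw [← abs_mul, one_mul] at this
        have := (le_abs_self _).trans this
        linarith
      · have : lam d₂ = 0 := by by_contra hne; exact c2 (hz1 _ hne)
        simp [this, c2]
    · have : lam d₁ = 0 := by by_contra hne; exact c1 (hz1 _ hne)
      simp [this, c1]
  refine step.trans ?_
  rw [hl4]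
  refine add_le_add le_rfl (mul_le_mul_of_nonneg_left ?_ hA0)
  refine (pair_sum_le_cube P (fun p => (Ideal.absNorm p : ℝ)) hPN z).trans ?_
  refine pow_le_pow_left₀ (Finset.sum_nonneg fun _ _ => inv_nonneg.2 (Finset.prod_nonneg fun _ _ => by positivity)) ?_ 3
  exact D_sum_le P (fun p hp => ⟨(hP' p hp).1, (hP' p hp).2.1⟩) z hz

end clsL
end BT


namespace BT
section clsM
open NumberField NumberField.mixedEmbedding NumberField.InfinitePlace NumberField.Units Module MeasureTheory
open scoped Classical nonZeroDivisors

variable {K : Type*} [Field K] [NumberField K]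

theorem prime_split (q c : Ideal (𝓞 K))
    (Ω : Finset ((𝓞 K ⧸ q) × ({w : InfinitePlace K // IsReal w} → SignType))) (x ε z : ℝ) (h0 : 0 < ε)
    (hz : 1 ≤ z) (hx : 0 < x) (hzx : z ≤ 3 * ε * x) (lam : Finset (Ideal (𝓞 K)) → ℝ) (hl : lam ∅ = 1) :
    (((Bf q c Ω x).filter (fun p => p.IsPrime)).card : ℝ) ≤ (Bf q c Ω (3 * ε * x)).card +
     ∑ b ∈ Bf q c Ω (3 * x), wcut ε (Real.log (Ideal.absNorm b / x)) *
      (∑ d ∈ ((Wn K z).filter (fun p => p.IsPrime ∧ ¬ p ∣ q)).powerset with (∀ p ∈ d, p ∣ b), lam d) ^ 2 := by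
  set g : Ideal (𝓞 K) → ℝ := fun b => wcut ε (Real.log (Ideal.absNorm b / x)) *
      (∑ d ∈ ((Wn K z).filter (fun p => p.IsPrime ∧ ¬ p ∣ q)).powerset with (∀ p ∈ d, p ∣ b), lam d) ^ 2 with hg
  have hg0 : ∀ b, 0 ≤ g b := fun b => mul_nonneg (wcut_nonneg _ _) (sq_nonneg _)
  set A := (Bf q c Ω x).filter (fun p => p.IsPrime ∧ 3 * ε * x < Ideal.absNorm p) with hA
  have h1 : (Bf q c Ω x).filter (fun p => p.IsPrime) ⊆ Bf q c Ω (3 * ε * x) ∪ A := by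
    intro p hp
    rw [Finset.mem_filter] at hp
    rw [Finset.mem_union]
    by_cases h : 3 * ε * x < Ideal.absNorm p
    · right; rw [hA, Finset.mem_filter]; exact ⟨hp.1, hp.2, h⟩
    · left
      rw [mem_Bf q c Ω (by positivity)]
      exact ⟨((mem_Bf q c Ω hx.le p).1 hp.1).1, not_lt.1 h⟩
  have h2 : (A.card : ℝ) ≤ ∑ b ∈ Bf q c Ω (3 * x), g b := by
    have h3 : ∀ p ∈ A, g p = 1 := by
      intro p hp
      rw [hA, Finset.mem_filter, mem_Bf q c Ω hx.le] at hp
      obtain ⟨⟨hpK, hpx⟩, hpp, hpl⟩ := hp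
      have hp0 : p ≠ ⊥ := hpK.1
      have hNp := one_lt_absNorm hpp hp0
      have hw : wcut ε (Real.log (Ideal.absNorm p / x)) = 1 := by
        refine wcut_eq_one h0 ?_ ?_
        · have e3 : Real.log 3 ≥ 1 := by
            rw [ge_iff_le, Real.le_log_iff_exp_le (by norm_num)]
            linarith [Real.exp_one_lt_d9]
          have : Real.log (3 * ε) ≤ Real.log (Ideal.absNorm p / x) := by
            refine Real.log_le_log (by positivity) ?_
            rw [le_div_iff₀ hx]; exact hpl.le
          rw [Real.log_mul (by norm_num) h0.ne'] at this
          linarith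
        · refine Real.log_nonpos (by positivity) ?_
          rw [div_le_one hx]; exact hpx
      have hs : (((Wn K z).filter (fun p => p.IsPrime ∧ ¬ p ∣ q)).powerset.filter (fun d => ∀ r ∈ d, r ∣ p)) = {∅} := by
        ext d
        rw [Finset.mem_filter, Finset.mem_powerset, Finset.mem_singleton]
        constructor
        · rintro ⟨hd1, hd2⟩
          rw [Finset.eq_empty_iff_forall_notMem]
          intro r hr
          have hr1 := hd1 hr
          rw [Finset.mem_filter, mem_Wn (by linarith)] at hr1
          have hle : p ≤ r := Ideal.dvd_iff_le.1 (hd2 r hr)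
          have := (hpp.isMaximal hp0).eq_of_le hr1.2.1.ne_top hle
          rw [← this] at hr1
          linarith [hr1.1.2]
        · rintro rfl
          simp
      simp only [hg]
      rw [hw, hs, Finset.sum_singleton, hl]
      norm_num
    calc (A.card : ℝ) = ∑ p ∈ A, g p := by rw [Finset.sum_congr rfl h3]; simp
      _ ≤ _ := by
        refine Finset.sum_le_sum_of_subset_of_nonneg ?_ (fun b _ _ => hg0 b)
        intro p hp
        rw [hA, Finset.mem_filter, mem_Bf q c Ω hx.le] at hp
        rw [mem_Bf q c Ω (by positivity)]
        exact ⟨hp.1.1, by linarith [hp.1.2]⟩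
  have h4 := (Finset.card_le_card h1).trans (Finset.card_union_le _ _)
  have h5 : (((Bf q c Ω x).filter (fun p => p.IsPrime)).card : ℝ) ≤ (Bf q c Ω (3 * ε * x)).card + A.card := by
    exact_mod_cast h4
  linarith

theorem phi_pos (q : Ideal (𝓞 K)) (hq : q ≠ ⊥) : (1:ℝ) ≤ Nat.card (𝓞 K ⧸ q)ˣ := by
  have : Finite (𝓞 K ⧸ q) := Ideal.finiteQuotientOfFreeOfNeBot q hq
  exact_mod_cast Nat.card_pos (α := (𝓞 K ⧸ q)ˣ)

/-- normalising quantity -/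
noncomputable def TT (q : Ideal (𝓞 K))
    (Ω : Finset ((𝓞 K ⧸ q) × ({w : InfinitePlace K // IsReal w} → SignType))) (x : ℝ) : ℝ :=
  Ω.card * x / (classNumber K * ((Nat.card (𝓞 K ⧸ q)ˣ : ℝ) * (SgS K).card))

theorem TT_cmp (q : Ideal (𝓞 K)) (hq : q ≠ ⊥)
    (Ω : Finset ((𝓞 K ⧸ q) × ({w : InfinitePlace K // IsReal w} → SignType))) (x : ℝ) (hx : 0 ≤ x) :
    Ω.card * (x / Ideal.absNorm q) ≤ (classNumber K * (SgS K).card) * TT q Ω x := by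
  have h1 := phi_le q hq ∅ (by simp)
  rw [Finset.prod_empty, mul_one] at h1
  have h2 := phi_pos q hq
  have hh : (0:ℝ) < classNumber K := by exact_mod_cast Fintype.card_pos (α := ClassGroup (𝓞 K))
  have hE : (0:ℝ) < (SgS K).card := by exact_mod_cast SgS_pos
  unfold TT
  generalize (classNumber K : ℝ) = h at *
  generalize ((SgS K).card : ℝ) = E at *
  generalize (Nat.card (𝓞 K ⧸ q)ˣ : ℝ) = f at *
  generalize (Ideal.absNorm q : ℝ) = Q at *
  have hO : (0:ℝ) ≤ Ω.card := by positivity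
  generalize (Ω.card : ℝ) = O at *
  have : h * E * (O * x / (h * (f * E))) = O * (x / f) := by field_simp
  rw [this]
  gcongr

variable (K) in
theorem trivial_bd : ∃ C : ℝ, 0 ≤ C ∧ ∀ (q c : Ideal (𝓞 K))
    (Ω : Finset ((𝓞 K ⧸ q) × ({w : InfinitePlace K // IsReal w} → SignType))), q ≠ ⊥ → c ≠ ⊥ →
    IsCoprime c q → UInv q Ω → ∀ x : ℝ, Ideal.absNorm q ≤ x →
    (((Bf q c Ω x).filter (fun p => p.IsPrime)).card : ℝ) ≤ C * TT q Ω x := by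
  obtain ⟨C, hC, h⟩ := class_count K
  refine ⟨C * (classNumber K * (SgS K).card), by positivity, fun q c Ω hq hc hcop hU x hx => ?_⟩
  have h1 := h q c Ω hq hc hcop hU x hx
  have h2 := TT_cmp q hq Ω x (by linarith [absNorm_pos hq])
  have h3 : (((Bf q c Ω x).filter (fun p => p.IsPrime)).card : ℝ) ≤ (Bf q c Ω x).card := by
    exact_mod_cast Finset.card_le_card (Finset.filter_subset _ _)
  have h4 := mul_le_mul_of_nonneg_left h2 hC
  calc _ ≤ _ := h3.trans h1
    _ ≤ _ := by rw [mul_assoc C, mul_assoc C]; exact h4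

theorem main_alg {J V t h E O x Q S G f kap lz C2 ε I : ℝ} (hV : 0 < V) (hJ : 0 < J) (ht : 0 < t)
    (hh : 0 < h) (hE : 0 < E) (hO : 0 ≤ O) (hx : 0 < x) (hQ : 0 < Q) (hG : 0 ≤ G) (hf : 0 < f)
    (hε : 0 < ε) (hk : kap = h * E * (J / V) / t) (hI : I ≤ (1 + 2 * ε) * J)
    (hfQ : f ≤ Q * G) (hS : (kap * lz - C2) * G ≤ S) (hC : C2 / kap < lz) :
    O * (x / Q * (I / V)) * S⁻¹ ≤ t * (O * x / (h * (f * E)) * ((1 + 2 * ε) / (lz - C2 / kap))) := by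
  have hkp : 0 < kap := by rw [hk]; positivity
  have hGp : 0 < G := by
    rcases hG.lt_or_eq with h | h
    · exact h
    · rw [← h] at hfQ; linarith
  have hd : 0 < lz - C2 / kap := by linarith
  have e1 : kap * lz - C2 = kap * (lz - C2 / kap) := by field_simp
  rw [e1] at hS
  set D := lz - C2 / kap with hD
  have hSp : 0 < kap * D * G := by positivity
  have s1 : S⁻¹ ≤ (kap * D * G)⁻¹ := inv_anti₀ hSp hS
  calc O * (x / Q * (I / V)) * S⁻¹ ≤ O * (x / Q * (((1 + 2 * ε) * J) / V)) * (kap * D * G)⁻¹ := by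
        refine mul_le_mul ?_ s1 (inv_nonneg.2 (hSp.le.trans hS)) (by positivity)
        gcongr
    _ = t * (O * x / (h * E) * ((1 + 2 * ε) / D)) * (Q * G)⁻¹ := by
        rw [hk]; field_simp
    _ ≤ t * (O * x / (h * E) * ((1 + 2 * ε) / D)) * f⁻¹ := by
        refine mul_le_mul_of_nonneg_left (inv_anti₀ hf hfQ) (by positivity)
    _ = _ := by field_simp

variable (K) in
set_option maxHeartbeats 1600000 in
theorem sieve_two : ∃ C : ℝ, 0 ≤ C ∧ ∀ (q c : Ideal (𝓞 K))
    (Ω : Finset ((𝓞 K ⧸ q) × ({w : InfinitePlace K // IsReal w} → SignType))), q ≠ ⊥ → c ≠ ⊥ →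
    IsCoprime c q → UInv q Ω → (∀ m ∈ Ω, ∀ w, m.2 w ≠ 0) → ∀ x ε z : ℝ, 0 < ε → ε ≤ 1 → 1 ≤ z →
    z ^ 2 * Ideal.absNorm q ≤ x → z ≤ 3 * ε * x → Ideal.absNorm q ≤ 3 * ε * x → C < Real.log z →
    (((Bf q c Ω x).filter (fun p => p.IsPrime)).card : ℝ) ≤ TT q Ω x *
      ((1 + 2 * ε) / (Real.log z - C) + C * ε + C * ((ε⁻¹) ^ 2 *
      (z ^ 2 / (x / Ideal.absNorm q)) ^ ((finrank ℚ K : ℝ)⁻¹) * (2 + Real.log z) ^ 3)) := by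
  obtain ⟨C1, hC1, h1⟩ := sieve_raw K
  obtain ⟨C2, hC2, h2⟩ := recip_sum K
  obtain ⟨C3, hC3, h3⟩ := class_count K
  have hh : (0:ℝ) < classNumber K := by exact_mod_cast Fintype.card_pos (α := ClassGroup (𝓞 K))
  have hE : (0:ℝ) < (SgS K).card := by exact_mod_cast SgS_pos
  have ht : (1:ℝ) ≤ torsionOrder K := by exact_mod_cast (torsionOrder_pos K)
  have hkd : kap K = classNumber K * (SgS K).card * (Jv K / V0 K) / torsionOrder K := rfl
  have hJ := Jv_pos K
  have hV := V0_pos K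
  have hk := kap_pos (K := K)
  obtain ⟨k, hk'⟩ : ∃ k, k = kap K := ⟨_, rfl⟩
  obtain ⟨h, hh'⟩ : ∃ k : ℝ, k = classNumber K := ⟨_, rfl⟩
  obtain ⟨E, hE'⟩ : ∃ k : ℝ, k = (SgS K).card := ⟨_, rfl⟩
  obtain ⟨t, ht'⟩ : ∃ k : ℝ, k = torsionOrder K := ⟨_, rfl⟩
  rw [← hk', ← hh', ← hE', ← ht'] at hkd
  rw [← hh'] at hh
  rw [← hE'] at hE
  rw [← ht'] at ht
  simp only [← hk'] at h2 hk
  simp only [← ht'] at h1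
  set C := max (C2 / k) (max (C3 * 3 * (h * E)) (C1 * (h * E) * C2 ^ 3)) with hC
  refine ⟨C, le_trans (by positivity) (le_max_left _ _), ?_⟩
  have hCa : C2 / k ≤ C := le_max_left _ _
  have hCb : C3 * 3 * (h * E) ≤ C := (le_max_left _ _).trans (le_max_right _ _)
  have hCc : C1 * (h * E) * C2 ^ 3 ≤ C := (le_max_right _ _).trans (le_max_right _ _)
  clear_value C
  intro q c Ω hq hc hcop hU hσ x ε z h0 hε1 hz hzq hzx hqx hlz
  obtain ⟨lam, hl, hr⟩ := h1 q c Ω hq hc hcop hU hσ x ε z h0 hε1 hz hzq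
  have hQ := absNorm_pos hq
  have hxp : 0 < x := by nlinarith [sq_nonneg z]
  have hsp := prime_split q c Ω x ε z h0 hz hxp hzx lam hl
  have hcnt := h3 q c Ω hq hc hcop hU _ hqx
  have hcmp := TT_cmp q hq Ω x hxp.le
  have hsel := selberg_lower q z hz
  have hz2 := h2 z hz
  have hI := (integral_Gw_bounds (K := K) h0 hε1 1 (by simp)).2
  have hQset : ∀ p ∈ (Wn K z).filter (fun p => p.IsPrime ∧ p ∣ q), p.IsPrime ∧ p ≠ ⊥ ∧ p ∣ q := by
    intro p hp
    rw [Finset.mem_filter, mem_Wn (by linarith)] at hp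
    exact ⟨hp.2.1, hp.1.1, hp.2.2⟩
  have hphi := phi_le q hq _ hQset
  have hf := phi_pos q hq
  have hTT : TT q Ω x = Ω.card * x / (h * ((Nat.card (𝓞 K ⧸ q)ˣ : ℝ) * E)) := by rw [hh', hE']; rfl
  rw [← hh', ← hE'] at hcmp
  have hG0 : 0 ≤ ∏ p ∈ (Wn K z).filter (fun p => p.IsPrime ∧ p ∣ q), (1 - (Ideal.absNorm p : ℝ)⁻¹) :=
    Finset.prod_nonneg fun p hp => by
      have := inv_le_one_of_one_le₀ (absNorm_pos (hQset p hp).2.1)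
      linarith
  generalize (∏ p ∈ (Wn K z).filter (fun p => p.IsPrime ∧ p ∣ q), (1 - (Ideal.absNorm p : ℝ)⁻¹)) = G at *
  generalize selS ((Wn K z).filter (fun p => p.IsPrime ∧ ¬ p ∣ q)) (fun p => (Ideal.absNorm p : ℝ)) z = S at *
  have hsn : 0 ≤ ∑ m ∈ Wn K z, (Ideal.absNorm m : ℝ)⁻¹ := Finset.sum_nonneg fun _ _ => by positivity
  generalize (∑ m ∈ Wn K z, (Ideal.absNorm m : ℝ)⁻¹) = Z at *
  have hO : (0:ℝ) ≤ Ω.card := by positivity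
  have hn0 : (0:ℝ) ≤ (finrank ℚ K : ℝ)⁻¹ := by positivity
  generalize (finrank ℚ K : ℝ)⁻¹ = n at *
  generalize (∫ v, Gw (K := K) ε 1 v) = I at *
  generalize (Nat.card (𝓞 K ⧸ q)ˣ : ℝ) = f at *
  generalize (Ideal.absNorm q : ℝ) = Q at *
  generalize (∑ b ∈ Bf q c Ω (3 * x), wcut ε (Real.log (Ideal.absNorm b / x)) *
      (∑ d ∈ ((Wn K z).filter (fun p => p.IsPrime ∧ ¬ p ∣ q)).powerset with (∀ p ∈ d, p ∣ b), lam d) ^ 2) = U at *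
  generalize (Ω.card : ℝ) = O at *
  have hl0 : 0 ≤ Real.log z := Real.log_nonneg hz
  have hT0 : 0 ≤ TT q Ω x := by rw [hTT]; positivity
  have hmain := main_alg (x := x) (Q := Q) (O := O) (lz := Real.log z) hV hJ (by linarith) hh hE hO hxp (by linarith) hG0 (by linarith) h0 hkd hI hphi
    ((mul_le_mul_of_nonneg_right hz2.1 hG0).trans hsel) (lt_of_le_of_lt hCa hlz)
  rw [← hTT] at hmain
  generalize TT q Ω x = T at *
  have b1 : T * ((1 + 2 * ε) / (Real.log z - C2 / k)) ≤ T * ((1 + 2 * ε) / (Real.log z - C)) := by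
    refine mul_le_mul_of_nonneg_left (div_le_div_of_nonneg_left (by positivity) (by linarith) (by linarith)) hT0
  have b2 : C3 * O * (3 * ε * x / Q) ≤ T * (C * ε) := by
    have : C3 * O * (3 * ε * x / Q) = (C3 * 3 * ε) * (O * (x / Q)) := by ring
    rw [this]
    refine (mul_le_mul_of_nonneg_left hcmp (by positivity)).trans ?_
    have : C3 * 3 * ε * (h * E * T) = (T * ε) * (C3 * 3 * (h * E)) := by ring
    rw [this]
    refine (mul_le_mul_of_nonneg_left hCb (by positivity)).trans (le_of_eq (by ring))
  have hR0 : 0 ≤ (z ^ 2 / (x / Q)) ^ n := by positivity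
  generalize (z ^ 2 / (x / Q)) ^ n = R at *
  have b3 : C1 * O * ε⁻¹ ^ 2 * (x / Q) * R * Z ^ 3 ≤ T * (C * (ε⁻¹ ^ 2 * R * (2 + Real.log z) ^ 3)) := by
    have e1 : C1 * O * ε⁻¹ ^ 2 * (x / Q) * R * Z ^ 3 = (C1 * ε⁻¹ ^ 2 * R * Z ^ 3) * (O * (x / Q)) := by ring
    rw [e1]
    calc _ ≤ (C1 * ε⁻¹ ^ 2 * R * (C2 * (2 + Real.log z)) ^ 3) * (h * E * T) := by
          refine mul_le_mul ?_ hcmp (by positivity) (by positivity)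
          refine mul_le_mul_of_nonneg_left (pow_le_pow_left₀ hsn hz2.2 3) (by positivity)
      _ = (C1 * (h * E) * C2 ^ 3) * (T * (ε⁻¹ ^ 2 * R * (2 + Real.log z) ^ 3)) := by ring
      _ ≤ C * (T * (ε⁻¹ ^ 2 * R * (2 + Real.log z) ^ 3)) := by
          refine mul_le_mul_of_nonneg_right hCc (by positivity)
      _ = _ := by ring
  have b3n : 0 ≤ T * (C * (ε⁻¹ ^ 2 * R * (2 + Real.log z) ^ 3)) := le_trans (by positivity) b3
  have b4 : U ≤ T * ((1 + 2 * ε) / (Real.log z - C)) + T * (C * (ε⁻¹ ^ 2 * R * (2 + Real.log z) ^ 3)) := by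
    have : t * U ≤ t * (T * ((1 + 2 * ε) / (Real.log z - C)) + T * (C * (ε⁻¹ ^ 2 * R * (2 + Real.log z) ^ 3))) := by
      have := mul_le_mul_of_nonneg_left b1 (show 0 ≤ t by linarith)
      have := le_mul_of_one_le_left b3n ht
      linarith
    exact le_of_mul_le_mul_left this (by linarith)
  have := hsp.trans (add_le_add (hcnt.trans b2) b4)
  refine this.trans (le_of_eq (by ring))

end clsM
end BT


namespace BT

theorem log_log_three_pos : 0 < Real.log (Real.log 3) := by
  refine Real.log_pos ?_
  rw [Real.lt_log_iff_exp_lt (by norm_num)]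
  linarith [Real.exp_one_lt_d9]

theorem exists_L0 (A D : ℝ) : ∃ L0 : ℝ, 4 ≤ L0 ∧ ∀ L, L0 ≤ L → A * Real.log L + D ≤ L / 2 := by
  have h1 : (fun L : ℝ => A * Real.log L + D) =o[Filter.atTop] (id : ℝ → ℝ) := by
    refine Asymptotics.IsLittleO.add (Real.isLittleO_log_id_atTop.const_mul_left A) ?_
    exact Asymptotics.isLittleO_const_id_atTop D
  have h2 := h1.def (c := 1/2) (by norm_num)
  obtain ⟨L0, h3⟩ := Filter.eventually_atTop.1 h2
  refine ⟨max 4 L0, le_max_left _ _, fun L hL => ?_⟩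
  have h4 := h3 L ((le_max_right _ _).trans hL)
  have h5 : 4 ≤ L := (le_max_left _ _).trans hL
  rw [Real.norm_eq_abs, id, Real.norm_of_nonneg (by linarith)] at h4
  linarith [le_abs_self (A * Real.log L + D)]

set_option maxHeartbeats 1600000 in
theorem analytic (C1 C2 m : ℝ) (hC1 : 0 ≤ C1) (hC2 : 0 ≤ C2) (hm : 1 ≤ m) : ∃ C : ℝ, 0 < C ∧
    ∀ X N T : ℝ, 1 < X → 0 ≤ T → N ≤ C1 * T →
    (∀ ε z : ℝ, 0 < ε → ε ≤ 1 → 1 ≤ z → z ^ 2 ≤ X → z ≤ 3 * ε * X → 1 ≤ 3 * ε * X → C2 < Real.log z →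
      N ≤ T * ((1 + 2 * ε) / (Real.log z - C2) + C2 * ε + C2 * ((ε⁻¹) ^ 2 * (z ^ 2 / X) ^ (m⁻¹) * (2 + Real.log z) ^ 3))) →
    N ≤ T * (2 / Real.log X * (1 + C * Real.log (Real.log (3 * X)) / Real.log X)) := by
  obtain ⟨L0, hL4, hL0⟩ := exists_L0 (9 * m) (2 * C2 + 1)
  have hc0 := log_log_three_pos
  obtain ⟨c0, hc⟩ : ∃ c, c = Real.log (Real.log 3) := ⟨_, rfl⟩
  rw [← hc] at hc0
  refine ⟨C1 * L0 ^ 2 / c0 + (18 * m + 5 * C2 + 1), by positivity, ?_⟩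
  intro X N T hX hT hN1 hN2
  have hLpos : 0 < Real.log X := Real.log_pos hX
  have hl3 : 0 < Real.log 3 := Real.log_pos (by norm_num)
  have h3X : Real.log (3 * X) = Real.log 3 + Real.log X := Real.log_mul (by norm_num) (by linarith)
  have hell0 : c0 ≤ Real.log (Real.log (3 * X)) := by
    rw [hc]; exact Real.log_le_log hl3 (by rw [h3X]; linarith)
  have hell1 : Real.log (Real.log X) ≤ Real.log (Real.log (3 * X)) :=
    Real.log_le_log hLpos (by rw [h3X]; linarith)
  have hXe : X = Real.exp (Real.log X) := (Real.exp_log (by linarith)).symm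
  obtain ⟨l, hl⟩ : ∃ l, l = Real.log (Real.log (3 * X)) := ⟨_, rfl⟩
  obtain ⟨L, hL⟩ : ∃ L, L = Real.log X := ⟨_, rfl⟩
  rw [← hl] at hell0 hell1 ⊢
  rw [← hL] at hLpos h3X hell1 hXe ⊢
  have hl0 : 0 < l := by linarith
  by_cases hcase : L < L0
  · refine hN1.trans ?_
    rw [mul_comm C1]
    refine mul_le_mul_of_nonneg_left ?_ hT
    have e1 : C1 ≤ C1 * L0 ^ 2 / c0 * l / L / L := by
      rw [le_div_iff₀ hLpos, le_div_iff₀ hLpos, div_mul_eq_mul_div, le_div_iff₀ hc0]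
      have : L * L ≤ L0 ^ 2 := by nlinarith
      calc C1 * L * L * c0 = C1 * ((L * L) * c0) := by ring
        _ ≤ C1 * (L0 ^ 2 * l) := by gcongr
        _ = _ := by ring
    have e2 : 2 / L * (1 + (C1 * L0 ^ 2 / c0 + (18 * m + 5 * C2 + 1)) * l / L) =
      C1 * L0 ^ 2 / c0 * l / L / L + (2 / L + C1 * L0 ^ 2 / c0 * l / L / L + 2 * (18 * m + 5 * C2 + 1) * l / L / L) := by
      field_simp; ring
    have : 0 ≤ (2 / L + C1 * L0 ^ 2 / c0 * l / L / L + 2 * (18 * m + 5 * C2 + 1) * l / L / L) := by positivity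
    rw [e2]; linarith
  · rw [not_lt] at hcase
    have hb := hL0 L hcase
    have hL4' : 4 ≤ L := hL4.trans hcase
    have hlog1 : 1 ≤ Real.log L := by
      rw [Real.le_log_iff_exp_le hLpos]; linarith [Real.exp_one_lt_d9]
    obtain ⟨g, hg⟩ : ∃ g, g = Real.log L := ⟨_, rfl⟩
    have hLg : L = Real.exp g := by rw [hg, Real.exp_log hLpos]
    rw [← hg] at hell1 hb hlog1
    have hmg : 9 * g ≤ 9 * m * g := by nlinarith
    have hlz : Real.log (Real.exp ((L - 9 * m * g) / 2)) = (L - 9 * m * g) / 2 := Real.log_exp _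
    have hz2 : Real.exp ((L - 9 * m * g) / 2) ^ 2 = Real.exp (L - 9 * m * g) := by
      rw [sq, ← Real.exp_add]; ring_nf
    have hε : (L ^ 2)⁻¹ = Real.exp (-(2 * g)) := by
      rw [Real.exp_neg, hLg, ← Real.exp_nat_mul]; norm_num
    have hεX : (L ^ 2)⁻¹ * X = Real.exp (L - 2 * g) := by
      rw [hε, hXe, ← Real.exp_add]; ring_nf
    have hz3 : Real.exp ((L - 9 * m * g) / 2) ≤ 3 * (L ^ 2)⁻¹ * X := by
      rw [mul_assoc 3, hεX]
      have : Real.exp ((L - 9 * m * g) / 2) ≤ Real.exp (L - 2 * g) := Real.exp_le_exp.2 (by linarith)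
      linarith [Real.exp_pos (L - 2 * g)]
    have hz1 : 1 ≤ Real.exp ((L - 9 * m * g) / 2) := Real.one_le_exp (by linarith)
    have main := hN2 (L ^ 2)⁻¹ (Real.exp ((L - 9 * m * g) / 2)) (by positivity)
      (inv_le_one_of_one_le₀ (by nlinarith)) hz1
      (by rw [hz2, hXe]; exact Real.exp_le_exp.2 (by linarith)) hz3 (hz1.trans hz3) (by rw [hlz]; linarith)
    refine main.trans (mul_le_mul_of_nonneg_left ?_ hT)
    have hR : (Real.exp ((L - 9 * m * g) / 2) ^ 2 / X) ^ m⁻¹ = (L ^ 9)⁻¹ := by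
      rw [hz2]
      have : Real.exp (L - 9 * m * g) / X = Real.exp (-(9 * m * g)) := by
        rw [hXe, ← Real.exp_sub]; ring_nf
      rw [this, ← Real.exp_mul, hLg, ← Real.exp_nat_mul, ← Real.exp_neg]
      congr 1
      have : m ≠ 0 := by linarith
      field_simp
      norm_num
    rw [hR, hlz, inv_inv]
    have t3 : (L ^ 2) ^ 2 * (L ^ 9)⁻¹ * (2 + (L - 9 * m * g) / 2) ^ 3 ≤ (L ^ 2)⁻¹ := by
      calc _ ≤ (L ^ 2) ^ 2 * (L ^ 9)⁻¹ * L ^ 3 := by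
            refine mul_le_mul_of_nonneg_left (pow_le_pow_left₀ (by linarith) (by linarith) 3) (by positivity)
        _ = _ := by field_simp
    obtain ⟨v, hv⟩ : ∃ v, v = 9 * m * g + 2 * C2 := ⟨_, rfl⟩
    have hv0 : 0 ≤ v := by rw [hv]; positivity
    have hv2 : v ≤ L / 2 := by linarith
    have t1 : (1 + 2 * (L ^ 2)⁻¹) / ((L - 9 * m * g) / 2 - C2) ≤ 2 / L * (1 + (2 * v + 1) / L) := by
      have e : (L - 9 * m * g) / 2 - C2 = (L - v) / 2 := by rw [hv]; ring
      rw [e, div_le_iff₀ (by linarith)]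
      have e2 : 2 / L * (1 + (2 * v + 1) / L) * ((L - v) / 2) = ((L + 2 * v + 1) * (L - v)) / L ^ 2 := by field_simp; ring
      have e3 : 1 + 2 * (L ^ 2)⁻¹ = (L ^ 2 + 2) / L ^ 2 := by field_simp
      rw [e2, e3]
      refine div_le_div_of_nonneg_right ?_ (by positivity)
      have hvv : 0 ≤ v * (L - 2 * v) := mul_nonneg hv0 (by linarith)
      have e4 : (L + 2 * v + 1) * (L - v) = L ^ 2 + v * (L - 2 * v) + (L - v) := by ring
      rw [e4]; linarith
    have hd : (2 * v + 1) + C2 ≤ (C1 * L0 ^ 2 / c0 + (18 * m + 5 * C2 + 1)) * l := by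
      have p1 : 0 ≤ C1 * L0 ^ 2 / c0 * l := by positivity
      have p2 : (18 * m + 5 * C2 + 1) * g ≤ (18 * m + 5 * C2 + 1) * l :=
        mul_le_mul_of_nonneg_left hell1 (by positivity)
      have p3 : (5 * C2 + 1) * 1 ≤ (5 * C2 + 1) * g := mul_le_mul_of_nonneg_left hlog1 (by positivity)
      rw [hv]; linarith
    calc _ ≤ 2 / L * (1 + (2 * v + 1) / L) + C2 * (L ^ 2)⁻¹ + C2 * (L ^ 2)⁻¹ := by
          refine add_le_add (add_le_add t1 le_rfl) (mul_le_mul_of_nonneg_left t3 hC2)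
      _ = 2 / L * (1 + ((2 * v + 1) + C2) / L) := by field_simp; ring
      _ ≤ _ := by gcongr

section clsN
open NumberField NumberField.mixedEmbedding NumberField.InfinitePlace NumberField.Units Module MeasureTheory
open scoped Classical nonZeroDivisors

variable {K : Type*} [Field K] [NumberField K]

variable (K) in
theorem class_final : ∃ C : ℝ, 0 < C ∧ ∀ (q c : Ideal (𝓞 K))
    (Ω : Finset ((𝓞 K ⧸ q) × ({w : InfinitePlace K // IsReal w} → SignType))), q ≠ ⊥ → c ≠ ⊥ →
    IsCoprime c q → UInv q Ω → (∀ m ∈ Ω, ∀ w, m.2 w ≠ 0) → ∀ x : ℝ, Ideal.absNorm q < x →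
    (((Bf q c Ω x).filter (fun p => p.IsPrime)).card : ℝ) ≤ TT q Ω x *
      (2 / Real.log (x / Ideal.absNorm q) * (1 + C * Real.log (Real.log (3 * (x / Ideal.absNorm q))) /
        Real.log (x / Ideal.absNorm q))) := by
  obtain ⟨C1, hC1, h1⟩ := trivial_bd K
  obtain ⟨C2, hC2, h2⟩ := sieve_two K
  obtain ⟨C, hC, h⟩ := analytic C1 C2 (finrank ℚ K : ℝ) hC1 hC2 (by exact_mod_cast finrank_pos (R := ℚ) (M := K))
  refine ⟨C, hC, fun q c Ω hq hc hcop hU hσ x hx => ?_⟩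
  have hQ := absNorm_pos hq
  have hQ0 : (0:ℝ) < Ideal.absNorm q := by linarith
  have hx0 : 0 < x := by linarith
  refine h _ _ _ (by rwa [one_lt_div hQ0]) (by unfold TT; positivity) (h1 q c Ω hq hc hcop hU x hx.le) ?_
  intro ε z h0 hε1 hz hzX hz3 h13 hlz
  rw [le_div_iff₀ hQ0] at hzX
  have e : 3 * ε * (x / Ideal.absNorm q) ≤ 3 * ε * x := by
    refine mul_le_mul_of_nonneg_left (div_le_self hx0.le hQ) (by positivity)
  refine h2 q c Ω hq hc hcop hU hσ x ε z h0 hε1 hz hzX (hz3.trans e) ?_ hlz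
  rw [← mul_div_assoc, le_div_iff₀ hQ0, one_mul] at h13
  exact h13

end clsN
end BT


namespace BT
section clsO
open NumberField NumberField.mixedEmbedding NumberField.InfinitePlace NumberField.Units Module MeasureTheory
open scoped Classical nonZeroDivisors

variable {K : Type*} [Field K] [NumberField K]

theorem fac_nonneg {C X : ℝ} (hC : 0 < C) (hX : 1 < X) :
    0 ≤ 2 / Real.log X * (1 + C * Real.log (Real.log (3 * X)) / Real.log X) := by
  have h1 : 0 < Real.log X := Real.log_pos hX
  have h3X : Real.log (3 * X) = Real.log 3 + Real.log X := Real.log_mul (by norm_num) (by linarith)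
  have hl3 : 0 < Real.log 3 := Real.log_pos (by norm_num)
  have h2 : 0 < Real.log (Real.log (3 * X)) :=
    log_log_three_pos.trans_le (Real.log_le_log hl3 (by rw [h3X]; linarith))
  positivity

theorem fin_ray (x : ℝ) (q a : Ideal (𝓞 K)) (S : Finset (Ideal (𝓞 K)))
    (h : ∀ p : Ideal (𝓞 K), p.IsPrime → p ≠ ⊥ → (Ideal.absNorm p : ℝ) ≤ x → SameRayClass K q p a → p ∈ S) :
    (piRay K x q a : ℝ) ≤ S.card := by
  unfold piRay
  have : Nat.card {p : Ideal (𝓞 K) | p.IsPrime ∧ p ≠ ⊥ ∧ (Ideal.absNorm p : ℝ) ≤ x ∧ SameRayClass K q p a} ≤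
      Nat.card (S : Set (Ideal (𝓞 K))) := by
    refine Nat.card_mono S.finite_toSet ?_
    rintro p ⟨h1, h2, h3, h4⟩
    exact h p h1 h2 h3 h4
  have h2 : Nat.card (S : Set (Ideal (𝓞 K))) = S.card := by simp
  rw [h2] at this
  exact (Nat.cast_le (α := ℝ)).2 this

set_option maxHeartbeats 1600000 in
theorem nondeg (C : ℝ) (hC : 0 < C) (hfin : ∀ (q c : Ideal (𝓞 K))
    (Ω : Finset ((𝓞 K ⧸ q) × ({w : InfinitePlace K // IsReal w} → SignType))), q ≠ ⊥ → c ≠ ⊥ →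
    IsCoprime c q → UInv q Ω → (∀ m ∈ Ω, ∀ w, m.2 w ≠ 0) → ∀ x : ℝ, Ideal.absNorm q < x →
    (((Bf q c Ω x).filter (fun p => p.IsPrime)).card : ℝ) ≤ TT q Ω x *
      (2 / Real.log (x / Ideal.absNorm q) * (1 + C * Real.log (Real.log (3 * (x / Ideal.absNorm q))) /
        Real.log (x / Ideal.absNorm q))))
    (q a : Ideal (𝓞 K)) (hq : q ≠ ⊥) (ha : a ≠ ⊥) (hcop : IsCoprime a q) (hnd : q ≠ ⊤ ∨ Nonempty (K →+* ℝ))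
    (x : ℝ) (hx : Ideal.absNorm q < x) :
    (piRay K x q a : ℝ) ≤ x / rayClassNumber K q * (2 / Real.log (x / Ideal.absNorm q) *
      (1 + C * Real.log (Real.log (3 * (x / Ideal.absNorm q))) / Real.log (x / Ideal.absNorm q))) := by
  obtain ⟨ξ, c, hξ, hc0, hcq, hac⟩ := exists_cofactor q a hq ha
  have hQ := absNorm_pos hq
  have hx0 : 0 < x := by linarith
  have h1 := hfin q c (Orb q hq ξ) hq hc0 hcq (UInv_Orb q hq ξ) (sign_Orb q hq ξ hξ) x hx
  have h2 := fin_ray x q a ((Bf q c (Orb q hq ξ) x).filter (fun p => p.IsPrime)) (by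
    intro p hp hp0 hpx hs
    rw [Finset.mem_filter, mem_Bf q c _ hx0.le]
    exact ⟨⟨ray_mem_KK q a c hq ξ hac hnd p hp0 hs, hpx⟩, hp⟩)
  refine (h2.trans h1).trans (mul_le_mul_of_nonneg_right ?_ (fac_nonneg hC (by rwa [one_lt_div (by linarith)])))
  obtain ⟨r1, r2⟩ := ray_card q hq ξ hξ (by rw [← hac]; exact hcop.mul_left hcq)
  have r1' : (0:ℝ) < rayClassNumber K q := by exact_mod_cast r1
  have r2' : (rayClassNumber K q : ℝ) * (Orb q hq ξ).card ≤ classNumber K * ((Nat.card (𝓞 K ⧸ q)ˣ : ℝ) * (SgS K).card) := by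
    exact_mod_cast r2
  have r3 : (0:ℝ) < (Orb q hq ξ).card := by exact_mod_cast Orb_pos q hq ξ
  unfold TT
  generalize (classNumber K * ((Nat.card (𝓞 K ⧸ q)ˣ : ℝ) * (SgS K).card) : ℝ) = W at *
  generalize ((Orb q hq ξ).card : ℝ) = O at *
  generalize (rayClassNumber K q : ℝ) = R at *
  have hW : 0 < W := lt_of_lt_of_le (by positivity) r2'
  rw [div_le_div_iff₀ hW r1']
  have := mul_le_mul_of_nonneg_right r2' hx0.le
  linarith

theorem deg_rcn (hd : ¬ Nonempty (K →+* ℝ)) : rayClassNumber K ⊤ = 1 := by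
  unfold rayClassNumber
  rw [Nat.card_eq_one_iff_unique]
  have hall : ∀ a b : Ideal (𝓞 K), SameRayClass K ⊤ a b := fun a b =>
    ⟨0, 0, trivial, trivial, fun φ => (hd ⟨φ⟩).elim, fun φ => (hd ⟨φ⟩).elim, by simp⟩
  refine ⟨⟨?_⟩, ⟨Quot.mk _ ⟨⊤, top_ne_bot, ?_⟩⟩⟩
  · rintro ⟨a⟩ ⟨b⟩
    exact Quot.sound (hall a.1 b.1)
  · rw [Ideal.isCoprime_iff_sup_eq]; simp

theorem deg (C : ℝ) (hC : 0 < C) (hfin : ∀ (q c : Ideal (𝓞 K))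
    (Ω : Finset ((𝓞 K ⧸ q) × ({w : InfinitePlace K // IsReal w} → SignType))), q ≠ ⊥ → c ≠ ⊥ →
    IsCoprime c q → UInv q Ω → (∀ m ∈ Ω, ∀ w, m.2 w ≠ 0) → ∀ x : ℝ, Ideal.absNorm q < x →
    (((Bf q c Ω x).filter (fun p => p.IsPrime)).card : ℝ) ≤ TT q Ω x *
      (2 / Real.log (x / Ideal.absNorm q) * (1 + C * Real.log (Real.log (3 * (x / Ideal.absNorm q))) /
        Real.log (x / Ideal.absNorm q))))
    (a : Ideal (𝓞 K)) (hd : ¬ Nonempty (K →+* ℝ))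
    (x : ℝ) (hx : Ideal.absNorm (⊤ : Ideal (𝓞 K)) < x) :
    (piRay K x ⊤ a : ℝ) ≤ x / rayClassNumber K ⊤ * (2 / Real.log (x / Ideal.absNorm (⊤ : Ideal (𝓞 K))) *
      (1 + C * Real.log (Real.log (3 * (x / Ideal.absNorm (⊤ : Ideal (𝓞 K))))) /
        Real.log (x / Ideal.absNorm (⊤ : Ideal (𝓞 K))))) := by
  rw [deg_rcn hd, Nat.cast_one, div_one]
  obtain ⟨cc, hcc0, hcc⟩ := cc_exists K
  have htop : (⊤ : Ideal (𝓞 K)) ≠ ⊥ := top_ne_bot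
  have hQ := absNorm_pos htop
  have hx0 : 0 < x := by linarith
  have hf := fac_nonneg hC (X := x / Ideal.absNorm (⊤ : Ideal (𝓞 K))) (by rwa [one_lt_div (by linarith)])
  have h1 : ∀ c, (((Bf ⊤ (cc c) (Ow K) x).filter (fun p => p.IsPrime)).card : ℝ) ≤ _ := fun c =>
    hfin ⊤ (cc c) (Ow K) htop (hcc0 c) (by rw [Ideal.isCoprime_iff_sup_eq]; simp) UInv_Ow
      (fun m hm => (mem_Ow m).1 hm) x hx
  generalize (2 / Real.log (x / Ideal.absNorm (⊤ : Ideal (𝓞 K))) *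
      (1 + C * Real.log (Real.log (3 * (x / Ideal.absNorm (⊤ : Ideal (𝓞 K))))) /
        Real.log (x / Ideal.absNorm (⊤ : Ideal (𝓞 K))))) = Y at *
  have h2 := fin_ray x ⊤ a (Finset.univ.biUnion fun c => (Bf ⊤ (cc c) (Ow K) x).filter (fun p => p.IsPrime)) (by
    intro p hp hp0 hpx _
    rw [Finset.mem_biUnion]
    refine ⟨ClassGroup.mk0 ⟨p, mem_nonZeroDivisors_of_ne_zero hp0⟩, Finset.mem_univ _, ?_⟩
    rw [Finset.mem_filter, mem_Bf ⊤ _ _ hx0.le]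
    exact ⟨⟨(hcc p hp0 _).2 rfl, hpx⟩, hp⟩)
  have h3 : ((Finset.univ.biUnion fun c => (Bf ⊤ (cc c) (Ow K) x).filter (fun p => p.IsPrime)).card : ℝ) ≤
      ∑ c, (((Bf ⊤ (cc c) (Ow K) x).filter (fun p => p.IsPrime)).card : ℝ) := by
    exact_mod_cast Finset.card_biUnion_le
  refine (h2.trans h3).trans ((Finset.sum_le_sum fun c _ => h1 c).trans ?_)
  rw [Finset.sum_const, Finset.card_univ, nsmul_eq_mul, ← mul_assoc]
  refine mul_le_mul_of_nonneg_right ?_ hf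
  have hh : (0:ℝ) < classNumber K := by exact_mod_cast Fintype.card_pos (α := ClassGroup (𝓞 K))
  have hE : (0:ℝ) < (SgS K).card := by exact_mod_cast SgS_pos
  have hph := phi_pos (⊤ : Ideal (𝓞 K)) htop
  have hcl : (Fintype.card (ClassGroup (𝓞 K)) : ℝ) = classNumber K := rfl
  unfold TT
  rw [hcl, card_Ow]
  generalize (classNumber K : ℝ) = h at *
  generalize ((SgS K).card : ℝ) = E at *
  generalize (Nat.card (𝓞 K ⧸ (⊤ : Ideal (𝓞 K)))ˣ : ℝ) = f at *
  have : h * (E * x / (h * (f * E))) = x / f := by field_simp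
  rw [this]
  exact div_le_self hx0.le hph

theorem bot_zero (q : Ideal (𝓞 K)) (hnd : q ≠ ⊤ ∨ Nonempty (K →+* ℝ)) (x : ℝ) :
    (piRay K x q ⊥ : ℝ) = 0 := by
  have h := fin_ray x q ⊥ ∅ (by
    rintro p hp hp0 hpx ⟨α, β, hα, hβ, hα', hβ', he⟩
    exfalso
    rw [Ideal.mul_bot, Ideal.mul_eq_bot] at he
    rcases he with he | he
    · rw [Ideal.span_singleton_eq_bot] at he
      subst he
      rcases hnd with h | ⟨⟨φ⟩⟩
      · apply h
        rw [Ideal.eq_top_iff_one]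
        simpa using q.neg_mem hα
      · have := hα' φ
        simp at this
    · exact hp0 he)
  have : (0:ℝ) ≤ piRay K x q ⊥ := by positivity
  simp at h ⊢
  exact h

end clsO
end BT


/-- (Hinz–Lodemann) For a number field `F` there is `C > 0` such that for all nonzero integral
ideals `q`, `a` with `(a,q) = 1` and all `x > N(q)`,
`π(x,q,a) ≤ (2x/(h(q) log(x/N(q)))) (1 + C log log(3x/N(q))/log(x/N(q)))`. -/
theorem brun_titchmarsh_number_fields (F : Type) [Field F] [NumberField F] :
    ∃ C : ℝ, 0 < C ∧
      ∀ q a : Ideal (𝓞 F), q ≠ ⊥ → IsCoprime a q →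
      ∀ x : ℝ, (Ideal.absNorm q : ℝ) < x →
        (piRay F x q a : ℝ) ≤
          (2 * x / ((rayClassNumber F q : ℝ) * Real.log (x / (Ideal.absNorm q : ℝ)))) *
            (1 + C * Real.log (Real.log (3 * x / (Ideal.absNorm q : ℝ))) /
              Real.log (x / (Ideal.absNorm q : ℝ))) := by
  obtain ⟨C, hC, hfin⟩ := BT.class_final F
  refine ⟨C, hC, fun q a hq hcop x hx => ?_⟩
  have hQ := BT.absNorm_pos hq
  have key : (piRay F x q a : ℝ) ≤ x / rayClassNumber F q * (2 / Real.log (x / Ideal.absNorm q) *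
      (1 + C * Real.log (Real.log (3 * (x / Ideal.absNorm q))) / Real.log (x / Ideal.absNorm q))) := by
    by_cases hnd : q ≠ ⊤ ∨ Nonempty (F →+* ℝ)
    · by_cases ha : a = ⊥
      · subst ha
        rw [BT.bot_zero q hnd x]
        refine mul_nonneg (div_nonneg (by linarith) (by positivity)) (BT.fac_nonneg hC ?_)
        rwa [one_lt_div (by linarith)]
      · exact BT.nondeg C hC hfin q a hq ha hcop hnd x hx
    · rw [not_or, not_not] at hnd
      obtain ⟨rfl, hd⟩ := hnd
      exact BT.deg C hC hfin a hd x hx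
  refine key.trans (le_of_eq ?_)
  rw [mul_div_assoc 3 x, ← mul_assoc, div_mul_div_comm, mul_comm x 2]
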